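/- Fix a number field k and quadratic extensions L_1, \dots, L_r of k whose compositum L satisfies [L : k] = 2^r. Call a finite prime of k nonsplit if it does not split in any of the L_i. Then there is a constant c > 0 such that, as y \to \infty, the number of squarefree nonzero ideals I of O_k with absolute norm N(I) \le y, all of whose prime divisors are nonsplit finite primes, is asymptotic to c\, y/(\log y)^{1 - 1/2^r}. -/

import Mathlib

open NumberField Filter Topology

noncomputable section

variable (k : Type*) [Field k] [NumberField k]

/-- A finite prime `p` of `k` splits in `L` if `p O_L` is a product of two distinct
primes of `L`. -/
def SplitsIn (p : Ideal (𝓞 k)) (L : IntermediateField k (AlgebraicClosure k)) : Prop :=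
  ∃ P Q : Ideal (𝓞 L), P ≠ Q ∧ P.IsPrime ∧ Q.IsPrime ∧
    Ideal.map (algebraMap (𝓞 k) (𝓞 L)) p = P * Q

/-- The Fejér kernel `(sin (v / 2) / (v / 2)) ^ 2`. -/
def fejer (v : ℝ) : ℝ := Real.sinc (v / 2) ^ 2

lemma fejer_nonneg (v : ℝ) : 0 ≤ fejer v := sq_nonneg _

lemma continuous_fejer : Continuous fejer := by
  unfold fejer
  have := Real.continuous_sinc
  fun_prop

lemma fejer_le (v : ℝ) : fejer v ≤ 5 / (1 + v ^ 2) := by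
  rw [le_div_iff₀ (by positivity)]
  have h1 : fejer v ≤ 1 := by
    unfold fejer
    rw [sq_le_one_iff_abs_le_one]
    exact Real.abs_sinc_le_one _
  have h2 : fejer v * v ^ 2 ≤ 4 := by
    by_cases hv : v = 0
    · simp [hv]
    · have : fejer v * v ^ 2 = 4 * Real.sin (v / 2) ^ 2 := by
        unfold fejer
        rw [Real.sinc_of_ne_zero (by positivity)]
        field_simp
        ring
      rw [this]
      nlinarith [Real.sin_sq_le_one (v / 2)]
  nlinarith

lemma integral_one_sub_abs_mul_exp (v : ℝ) :
    ∫ t in (-1 : ℝ)..1, ((1 - |t| : ℝ) : ℂ) * Complex.exp (Complex.I * t * v) = fejer v := by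
  have hc : Continuous fun t : ℝ => ((1 - |t| : ℝ) : ℂ) * Complex.exp (Complex.I * t * v) := by
    fun_prop
  rw [← intervalIntegral.integral_add_adjacent_intervals (b := 0)
    (hc.intervalIntegrable _ _) (hc.intervalIntegrable _ _)]
  by_cases hv : v = 0
  · subst hv
    have h1 : ∫ t in (-1 : ℝ)..0, ((1 - |t| : ℝ) : ℂ) * Complex.exp (Complex.I * t * (0:ℝ)) =
        ((∫ t in (-1 : ℝ)..0, (1 + t) : ℝ) : ℂ) := by
      rw [← intervalIntegral.integral_ofReal]
      refine intervalIntegral.integral_congr fun t ht => ?_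
      rw [Set.uIcc_of_le (by norm_num)] at ht
      simp [abs_of_nonpos ht.2]
    have h2 : ∫ t in (0 : ℝ)..1, ((1 - |t| : ℝ) : ℂ) * Complex.exp (Complex.I * t * (0:ℝ)) =
        ((∫ t in (0 : ℝ)..1, (1 - t) : ℝ) : ℂ) := by
      rw [← intervalIntegral.integral_ofReal]
      refine intervalIntegral.integral_congr fun t ht => ?_
      rw [Set.uIcc_of_le (by norm_num)] at ht
      simp [abs_of_nonneg ht.1]
    rw [h1, h2]
    have e1 : ∫ t in (-1 : ℝ)..0, (1 + t) = 1 / 2 := by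
      rw [intervalIntegral.integral_add] <;> (simp; try norm_num)
    have e2 : ∫ t in (0 : ℝ)..1, (1 - t) = 1 / 2 := by
      rw [intervalIntegral.integral_sub] <;> (simp; try norm_num)
    rw [e1, e2]
    simp [fejer]
    norm_num
  · have hvC : (v : ℂ) ≠ 0 := by exact_mod_cast hv
    have hI := Complex.I_ne_zero
    have hexp : ∀ t : ℝ, HasDerivAt (fun t : ℝ => Complex.exp (Complex.I * t * v))
        (Complex.exp (Complex.I * t * v) * (Complex.I * v)) t := by
      intro t
      have h0 : HasDerivAt (fun t : ℝ => Complex.I * t * (v : ℂ)) (Complex.I * v) t := by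
        simpa using! ((Complex.ofRealCLM.hasDerivAt (x := t)).const_mul Complex.I).mul_const (v : ℂ)
      exact h0.cexp
    have hlin : ∀ t : ℝ, HasDerivAt (fun t : ℝ => (t : ℂ)) 1 t := fun t =>
      Complex.ofRealCLM.hasDerivAt (x := t)
    have h1 : ∫ t in (-1 : ℝ)..0, ((1 - |t| : ℝ) : ℂ) * Complex.exp (Complex.I * t * v) =
        (fun t : ℝ => Complex.exp (Complex.I * t * v) *
          ((1 + t) / (Complex.I * v) + 1 / (v : ℂ) ^ 2)) 0 -
        (fun t : ℝ => Complex.exp (Complex.I * t * v) *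
          ((1 + t) / (Complex.I * v) + 1 / (v : ℂ) ^ 2)) (-1) := by
      refine intervalIntegral.integral_eq_sub_of_hasDerivAt (f := fun t : ℝ =>
        Complex.exp (Complex.I * t * v) * ((1 + t) / (Complex.I * v) + 1 / (v : ℂ) ^ 2))
        (fun t ht => ?_) (hc.intervalIntegrable _ _)
      rw [Set.uIcc_of_le (by norm_num)] at ht
      convert! (hexp t).mul ((((hlin t).const_add 1).div_const (Complex.I * v)).add_const
        (1 / (v : ℂ) ^ 2)) using 1
      rw [abs_of_nonpos ht.2]
      push_cast
      field_simp
      ring_nf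
      simp only [Complex.I_sq]
      ring
    have h2 : ∫ t in (0 : ℝ)..1, ((1 - |t| : ℝ) : ℂ) * Complex.exp (Complex.I * t * v) =
        (fun t : ℝ => Complex.exp (Complex.I * t * v) *
          ((1 - t) / (Complex.I * v) - 1 / (v : ℂ) ^ 2)) 1 -
        (fun t : ℝ => Complex.exp (Complex.I * t * v) *
          ((1 - t) / (Complex.I * v) - 1 / (v : ℂ) ^ 2)) 0 := by
      refine intervalIntegral.integral_eq_sub_of_hasDerivAt (f := fun t : ℝ =>
        Complex.exp (Complex.I * t * v) * ((1 - t) / (Complex.I * v) - 1 / (v : ℂ) ^ 2))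
        (fun t ht => ?_) (hc.intervalIntegrable _ _)
      rw [Set.uIcc_of_le (by norm_num)] at ht
      convert! (hexp t).mul ((((hlin t).const_sub 1).div_const (Complex.I * v)).sub_const
        (1 / (v : ℂ) ^ 2)) using 1
      rw [abs_of_nonneg ht.1]
      push_cast
      field_simp
      ring_nf
      simp only [Complex.I_sq]
      ring
    have hf : (fejer v : ℂ) = (2 - 2 * Complex.cos v) / (v : ℂ) ^ 2 := by
      have : fejer v = (2 - 2 * Real.cos v) / v ^ 2 := by
        unfold fejer
        rw [Real.sinc_of_ne_zero (by positivity)]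
        have : Real.cos v = 1 - 2 * Real.sin (v / 2) ^ 2 := by
          rw [← Real.cos_two_mul_eq_one_sub]
          ring_nf
        rw [this]
        field_simp
        ring
      rw [this]
      push_cast
      rfl
    rw [h1, h2, hf, Complex.cos]
    simp
    have e1 : Complex.I * (v : ℂ) = v * Complex.I := mul_comm _ _
    rw [e1]
    field_simp
    ring_nf

lemma integral_one_sub_abs_mul_exp_Ioc (v : ℝ) :
    ∫ t in Set.Ioc (-1 : ℝ) 1, ((1 - |t| : ℝ) : ℂ) * Complex.exp (Complex.I * t * v) =
      fejer v := by
  rw [← integral_one_sub_abs_mul_exp, intervalIntegral.integral_of_le (by norm_num)]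

open MeasureTheory in
/-- Smoothing with the Fejér kernel sees only the Laplace transform on a bounded vertical
segment. -/
lemma integral_mul_fejer_eq {b : ℝ → ℝ} {σ : ℝ}
    (hb : Integrable fun u => b u * Real.exp (-(σ * u))) (l y : ℝ) :
    ((∫ u, b u * Real.exp (-(σ * u)) * fejer (l * (y - u)) : ℝ) : ℂ) =
      ∫ t in Set.Ioc (-1 : ℝ) 1, ((1 - |t| : ℝ) : ℂ) * Complex.exp (Complex.I * t * (l * y)) *
        ∫ u : ℝ, (b u : ℂ) * Complex.exp (-((σ + Complex.I * (l * t : ℝ)) * u)) := by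
  have key : ∀ t u : ℝ, ((1 - |t| : ℝ) : ℂ) * Complex.exp (Complex.I * t * (l * y)) *
      ((b u : ℂ) * Complex.exp (-((σ + Complex.I * (l * t : ℝ)) * u))) =
      ((1 - |t| : ℝ) : ℂ) * Complex.exp (Complex.I * t * (l * (y - u) : ℝ)) *
        ((b u * Real.exp (-(σ * u)) : ℝ) : ℂ) := by
    intro t u
    have : Complex.exp (Complex.I * t * (l * y)) *
        Complex.exp (-((σ + Complex.I * (l * t : ℝ)) * u)) =
        Complex.exp (Complex.I * t * (l * (y - u) : ℝ)) * Complex.exp (-(σ * u)) := by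
      rw [← Complex.exp_add, ← Complex.exp_add]
      congr 1
      push_cast
      ring
    push_cast
    push_cast at this
    linear_combination ((1 - ((|t| : ℝ) : ℂ)) * (b u : ℂ)) * this
  simp_rw [← integral_const_mul, key]
  rw [integral_integral_swap]
  · rw [← integral_complex_ofReal]
    refine integral_congr_ae (Eventually.of_forall fun u => ?_)
    simp only
    rw [integral_mul_const, integral_one_sub_abs_mul_exp_Ioc]
    push_cast
    ring
  · have h1 : Integrable (Function.uncurry fun (_ : ℝ) (u : ℝ) =>
        ((b u * Real.exp (-(σ * u)) : ℝ) : ℂ))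
        ((volume.restrict (Set.Ioc (-1 : ℝ) 1)).prod volume) :=
      (hb.ofReal (𝕜 := ℂ)).comp_snd (volume.restrict (Set.Ioc (-1 : ℝ) 1))
    refine h1.bdd_mul (c := 1) (Continuous.aestronglyMeasurable (by fun_prop)) ?_
    have hae : ∀ᵐ t ∂(volume.restrict (Set.Ioc (-1 : ℝ) 1)), t ∈ Set.Ioc (-1 : ℝ) 1 :=
      ae_restrict_mem measurableSet_Ioc
    have := Measure.quasiMeasurePreserving_fst (μ := volume.restrict (Set.Ioc (-1 : ℝ) 1))
      (ν := (volume : Measure ℝ)) |>.ae hae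
    filter_upwards [this] with x hx
    rw [norm_mul, Complex.norm_exp, Complex.norm_real, Real.norm_eq_abs]
    have : |x.1| ≤ 1 := abs_le.mpr ⟨hx.1.le, hx.2⟩
    have h2 : (Complex.I * x.1 * ((l * (y - x.2) : ℝ) : ℂ)).re = 0 := by
      rw [Complex.re_mul_ofReal]
      simp
    rw [h2, Real.exp_zero, mul_one, abs_of_nonneg (by linarith)]
    linarith [abs_nonneg x.1]

open MeasureTheory in
lemma continuous_integral_mul_cexp {b : ℝ → ℝ} {σ : ℝ}
    (hb : Integrable fun u => b u * Real.exp (-(σ * u))) :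
    Continuous fun t : ℝ => ∫ u : ℝ, (b u : ℂ) * Complex.exp (-((σ + Complex.I * t) * u)) := by
  have e : ∀ t u : ℝ, (b u : ℂ) * Complex.exp (-((σ + Complex.I * t) * u)) =
      ((b u * Real.exp (-(σ * u)) : ℝ) : ℂ) * Complex.exp (-(Complex.I * t * u)) := by
    intro t u
    push_cast
    rw [mul_assoc, ← Complex.exp_add]
    congr 2
    ring
  simp_rw [e]
  refine continuous_of_dominated (bound := fun u => ‖b u * Real.exp (-(σ * u))‖) ?_ ?_ hb.norm ?_
  · intro t
    exact (hb.ofReal (𝕜 := ℂ)).aestronglyMeasurable.mul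
      (Continuous.aestronglyMeasurable (by fun_prop))
  · intro t
    refine Eventually.of_forall fun u => ?_
    rw [norm_mul, Complex.norm_exp, Complex.norm_real]
    have : (-(Complex.I * t * u)).re = 0 := by simp
    rw [this, Real.exp_zero, mul_one]
  · refine Eventually.of_forall fun u => ?_
    fun_prop

open MeasureTheory in
lemma integrableOn_abs_rpow {α : ℝ} (hα : α < 1) :
    IntegrableOn (fun t : ℝ => |t| ^ (-α)) (Set.Ioc (-1 : ℝ) 1) := by
  have h1 : IntervalIntegrable (fun t : ℝ => t ^ (-α)) volume 0 1 :=
    intervalIntegral.intervalIntegrable_rpow' (by linarith)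
  have h2 : IntegrableOn (fun t : ℝ => |t| ^ (-α)) (Set.Ioc (0 : ℝ) 1) := by
    rw [intervalIntegrable_iff_integrableOn_Ioc_of_le zero_le_one] at h1
    refine h1.congr_fun (fun t ht => ?_) measurableSet_Ioc
    simp [abs_of_pos ht.1]
  have h3 : IntervalIntegrable (fun t : ℝ => |t| ^ (-α)) volume 0 1 := by
    rwa [intervalIntegrable_iff_integrableOn_Ioc_of_le zero_le_one]
  have h4 : IntervalIntegrable (fun t : ℝ => |t| ^ (-α)) volume (-1) 0 := by
    have := h3.comp_sub_left 0
    simp only [zero_sub, abs_neg, sub_zero] at this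
    exact this.symm
  rw [← intervalIntegrable_iff_integrableOn_Ioc_of_le (by norm_num)]
  exact h4.trans h3

open MeasureTheory in
/-- The boundary behaviour of a Laplace transform controls Fejér means. -/
lemma exists_tendsto_integral_mul_fejer {b : ℝ → ℝ}
    (hb : ∀ σ : ℝ, 0 < σ → Integrable fun u => b u * Real.exp (-(σ * u)))
    {R0 : ℝ → ℂ} {α : ℝ} (hα : α < 1)
    (hlim : ∀ t : ℝ, t ≠ 0 → Tendsto (fun σ : ℝ => ∫ u : ℝ, (b u : ℂ) *
      Complex.exp (-((σ + Complex.I * t) * u))) (𝓝[>] 0) (𝓝 (R0 t)))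
    (hbd : ∀ B : ℝ, ∃ C : ℝ, ∀ σ t : ℝ, 0 < σ → σ ≤ 1 → t ≠ 0 → |t| ≤ B →
      ‖∫ u : ℝ, (b u : ℂ) * Complex.exp (-((σ + Complex.I * t) * u))‖ ≤ C * |t| ^ (-α))
    {l : ℝ} (hl : 0 < l) :
    ∃ ρ : ℝ → ℝ, Tendsto ρ atTop (𝓝 0) ∧ ∀ y, Tendsto (fun σ : ℝ =>
      ∫ u, b u * Real.exp (-(σ * u)) * fejer (l * (y - u))) (𝓝[>] 0) (𝓝 (ρ y)) := by
  obtain ⟨C, hC⟩ := hbd l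
  set μ := (volume : Measure ℝ).restrict (Set.Ioc (-1 : ℝ) 1)
  have hmem : ∀ᵐ t ∂μ, t ∈ Set.Ioc (-1 : ℝ) 1 := ae_restrict_mem measurableSet_Ioc
  have hne : ∀ᵐ t ∂μ, t ≠ 0 := ae_restrict_of_ae (by
    simpa using (Measure.ae_ne (volume : Measure ℝ) 0))
  set Rs : ℝ → ℝ → ℂ := fun σ t => ∫ u : ℝ, (b u : ℂ) *
    Complex.exp (-((σ + Complex.I * (l * t : ℝ)) * u)) with hRs
  have hRcont : ∀ σ : ℝ, 0 < σ → Continuous (Rs σ) := fun σ hσ =>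
    (continuous_integral_mul_cexp (hb σ hσ)).comp (continuous_const.mul continuous_id)
  have hRlim : ∀ᵐ t ∂μ, Tendsto (fun σ => Rs σ t) (𝓝[>] 0) (𝓝 (R0 (l * t))) := by
    filter_upwards [hne] with t ht
    exact hlim (l * t) (by positivity)
  have hseq : Tendsto (fun n : ℕ => (1 : ℝ) / (n + 1)) atTop (𝓝[>] 0) := by
    refine tendsto_nhdsWithin_iff.mpr ⟨tendsto_one_div_add_atTop_nhds_zero_nat, ?_⟩
    exact Eventually.of_forall fun n => by simp only [Set.mem_Ioi]; positivity
  have hR0m : AEStronglyMeasurable (fun t => R0 (l * t)) μ := by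
    refine aestronglyMeasurable_of_tendsto_ae atTop (f := fun (n : ℕ) => Rs (1 / (n + 1)))
      (fun n => (hRcont _ (by positivity)).aestronglyMeasurable) ?_
    filter_upwards [hRlim] with t ht
    exact ht.comp hseq
  have hRbd : ∀ σ : ℝ, 0 < σ → σ ≤ 1 → ∀ t ∈ Set.Ioc (-1 : ℝ) 1, t ≠ 0 →
      ‖Rs σ t‖ ≤ C * l ^ (-α) * |t| ^ (-α) := by
    intro σ h0 h1 t ht ht0
    have habs : |l * t| = l * |t| := by rw [abs_mul, abs_of_pos hl]
    have ht1 : |t| ≤ 1 := abs_le.mpr ⟨ht.1.le, ht.2⟩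
    have := hC σ (l * t) h0 h1 (by positivity) (by rw [habs]; nlinarith)
    rw [habs, Real.mul_rpow hl.le (abs_nonneg t), ← mul_assoc] at this
    exact this
  have hdom : Integrable (fun t : ℝ => C * l ^ (-α) * |t| ^ (-α)) μ :=
    (integrableOn_abs_rpow hα).const_mul _
  have hev : ∀ᶠ σ : ℝ in 𝓝[>] 0, 0 < σ ∧ σ ≤ 1 :=
    (Ioc_mem_nhdsGT (zero_lt_one (α := ℝ)))
  have hwt : ∀ t ∈ Set.Ioc (-1 : ℝ) 1, ∀ y : ℝ,
      ‖((1 - |t| : ℝ) : ℂ) * Complex.exp (Complex.I * t * (l * y))‖ ≤ 1 := by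
    intro t ht y
    have ht1 : |t| ≤ 1 := abs_le.mpr ⟨ht.1.le, ht.2⟩
    rw [norm_mul, Complex.norm_exp, Complex.norm_real, Real.norm_eq_abs]
    have h2 : (Complex.I * t * (l * y)).re = 0 := by
      have : Complex.I * t * (l * y) = Complex.I * ((t * (l * y) : ℝ) : ℂ) := by push_cast; ring
      rw [this, Complex.re_mul_ofReal]; simp
    rw [h2, Real.exp_zero, mul_one, abs_of_nonneg (by linarith)]
    linarith [abs_nonneg t]
  set P : ℝ → ℂ := fun y : ℝ => ∫ t, ((1 - |t| : ℝ) : ℂ) *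
    Complex.exp (Complex.I * t * (l * y)) * R0 (l * t) ∂μ with hP
  have hconv : ∀ y : ℝ, Tendsto (fun σ : ℝ => ∫ t, ((1 - |t| : ℝ) : ℂ) *
      Complex.exp (Complex.I * t * (l * y)) * Rs σ t ∂μ) (𝓝[>] 0) (𝓝 (P y)) := by
    intro y
    refine tendsto_integral_filter_of_dominated_convergence
      (fun t : ℝ => C * l ^ (-α) * |t| ^ (-α)) ?_ ?_ hdom ?_
    · filter_upwards [hev] with σ hσ
      exact Continuous.aestronglyMeasurable (by have := hRcont σ hσ.1; fun_prop)
    · filter_upwards [hev] with σ hσ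
      filter_upwards [hmem, hne] with t ht ht0
      rw [norm_mul]
      refine (mul_le_mul (hwt t ht y) (hRbd σ hσ.1 hσ.2 t ht ht0) (norm_nonneg _)
        zero_le_one).trans_eq (one_mul _)
    · filter_upwards [hRlim] with t ht
      exact ht.const_mul _
  refine ⟨fun y => (P y).re, ?_, fun y => ?_⟩
  · have hRL := (Real.tendsto_integral_exp_smul_cocompact
      (fun t => (Set.Ioc (-1 : ℝ) 1).indicator
        (fun t => ((1 - |t| : ℝ) : ℂ) * R0 (l * t)) t)).mono_left atBot_le_cocompact
    have h2 : Tendsto (fun y : ℝ => -(l * y) / (2 * Real.pi)) atTop atBot := by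
      refine Tendsto.atBot_div_const (by positivity) ?_
      exact tendsto_neg_atTop_atBot.comp (tendsto_id.const_mul_atTop hl)
    have h3 := hRL.comp h2
    have h4 : P = (fun w : ℝ => ∫ v : ℝ, Real.fourierChar (-(v * w)) •
        (Set.Ioc (-1 : ℝ) 1).indicator (fun t => ((1 - |t| : ℝ) : ℂ) * R0 (l * t)) v) ∘
        fun y : ℝ => -(l * y) / (2 * Real.pi) := by
      funext y
      simp only [hP, Function.comp]
      rw [← integral_indicator measurableSet_Ioc]
      refine integral_congr_ae (Eventually.of_forall fun t => ?_)
      simp only [Set.indicator_apply]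
      split_ifs with h
      · rw [Circle.smul_def, Real.fourierChar_apply, smul_eq_mul]
        have : (2 * Real.pi * (-(t * (-(l * y) / (2 * Real.pi)))) : ℝ) = t * (l * y) := by
          field_simp
        rw [this]
        push_cast
        rw [show Complex.I * t * (l * y) = t * (l * y) * Complex.I by ring]
        ring
      · simp
    rw [h4]
    have := (Complex.continuous_re.tendsto 0).comp h3
    simpa [Function.comp_def] using this
  · have h1 := (Complex.continuous_re.tendsto _).comp (hconv y)
    refine h1.congr' ?_
    filter_upwards [hev] with σ hσ
    have := integral_mul_fejer_eq (hb σ hσ.1) l y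
    simp only [Function.comp]
    rw [← this, Complex.ofReal_re]

open MeasureTheory in
/-- Fejér means of a nonnegative function are compared to those of a model function through
the boundary behaviour of the Laplace transform of the difference. -/
lemma tendsto_integral_mul_fejer_sub {a m : ℝ → ℝ} (ha0 : ∀ u, 0 ≤ a u)
    (haneg : ∀ u < 0, a u = 0) (hmneg : ∀ u < 0, m u = 0)
    (ha : ∀ σ : ℝ, 0 < σ → Integrable fun u => a u * Real.exp (-(σ * u)))
    (hm : ∀ σ : ℝ, 0 < σ → Integrable fun u => m u * Real.exp (-(σ * u)))
    (hmf : ∀ l y : ℝ, 0 < l → Integrable fun u => m u * fejer (l * (y - u)))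
    {c : ℝ} {R0 : ℝ → ℂ} {α : ℝ} (hα : α < 1)
    (hlim : ∀ t : ℝ, t ≠ 0 → Tendsto (fun σ : ℝ => ∫ u : ℝ, ((a u - c * m u : ℝ) : ℂ) *
      Complex.exp (-((σ + Complex.I * t) * u))) (𝓝[>] 0) (𝓝 (R0 t)))
    (hbd : ∀ B : ℝ, ∃ C : ℝ, ∀ σ t : ℝ, 0 < σ → σ ≤ 1 → t ≠ 0 → |t| ≤ B →
      ‖∫ u : ℝ, ((a u - c * m u : ℝ) : ℂ) *
        Complex.exp (-((σ + Complex.I * t) * u))‖ ≤ C * |t| ^ (-α))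
    {l : ℝ} (hl : 0 < l) :
    (∀ y, Integrable fun u => a u * fejer (l * (y - u))) ∧
    Tendsto (fun y => (∫ u, a u * fejer (l * (y - u))) - c * ∫ u, m u * fejer (l * (y - u)))
      atTop (𝓝 0) := by
  have hb : ∀ σ : ℝ, 0 < σ → Integrable fun u => (a u - c * m u) * Real.exp (-(σ * u)) := by
    intro σ hσ
    refine ((ha σ hσ).sub ((hm σ hσ).const_mul c)).congr (Eventually.of_forall fun u => ?_)
    simp only [Pi.sub_apply]
    ring
  obtain ⟨ρ, hρ0, hρ⟩ := exists_tendsto_integral_mul_fejer hb hα hlim hbd hl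
  have hf1 : ∀ v, fejer v ≤ 1 := fun v => by
    unfold fejer
    rw [sq_le_one_iff_abs_le_one]
    exact Real.abs_sinc_le_one _
  have hcf : ∀ y, Continuous fun u => fejer (l * (y - u)) := fun y =>
    continuous_fejer.comp (by fun_prop)
  have hmulint : ∀ {g : ℝ → ℝ} (y : ℝ), Integrable g →
      Integrable fun u => g u * fejer (l * (y - u)) := by
    intro g y hg
    refine (hg.bdd_mul (c := 1) (hcf y).aestronglyMeasurable
      (Eventually.of_forall fun u => ?_)).congr (Eventually.of_forall fun u => mul_comm _ _)
    rw [Real.norm_eq_abs, abs_of_nonneg (fejer_nonneg _)]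
    exact hf1 _
  have hev : ∀ᶠ σ : ℝ in 𝓝[>] 0, 0 < σ := self_mem_nhdsWithin
  have hdct : ∀ {g : ℝ → ℝ} (y : ℝ), (∀ u < 0, g u = 0) →
      Integrable (fun u => g u * fejer (l * (y - u))) →
      Tendsto (fun σ : ℝ => ∫ u, g u * Real.exp (-(σ * u)) * fejer (l * (y - u))) (𝓝[>] 0)
        (𝓝 (∫ u, g u * fejer (l * (y - u)))) := by
    intro g y hg hgi
    refine tendsto_integral_filter_of_dominated_convergence
      (fun u => ‖g u * fejer (l * (y - u))‖) ?_ ?_ hgi.norm ?_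
    · refine Eventually.of_forall fun σ => ?_
      have : AEStronglyMeasurable (fun u : ℝ => Real.exp (-(σ * u))) volume :=
        Continuous.aestronglyMeasurable (by fun_prop)
      refine (hgi.aestronglyMeasurable.mul this).congr (Eventually.of_forall fun u => ?_)
      simp only [Pi.mul_apply]
      ring
    · filter_upwards [hev] with σ hσ
      refine Eventually.of_forall fun u => ?_
      rcases lt_or_ge u 0 with hu | hu
      · simp [hg u hu]
      · rw [mul_right_comm, norm_mul]
        refine mul_le_of_le_one_right (norm_nonneg _) ?_
        rw [Real.norm_eq_abs, Real.abs_exp, Real.exp_le_one_iff]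
        nlinarith
    · refine Eventually.of_forall fun u => ?_
      have : Tendsto (fun σ : ℝ => g u * Real.exp (-(σ * u)) * fejer (l * (y - u))) (𝓝 0)
          (𝓝 (g u * Real.exp (-(0 * u)) * fejer (l * (y - u)))) :=
        Continuous.tendsto (by fun_prop) 0
      simp only [zero_mul, neg_zero, Real.exp_zero, mul_one] at this
      exact this.mono_left nhdsWithin_le_nhds
  have hlima : ∀ y, Tendsto (fun σ : ℝ => ∫ u, a u * Real.exp (-(σ * u)) * fejer (l * (y - u)))
      (𝓝[>] 0) (𝓝 (ρ y + c * ∫ u, m u * fejer (l * (y - u)))) := by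
    intro y
    refine ((hρ y).add ((hdct y hmneg (hmf l y hl)).const_mul c)).congr' ?_
    filter_upwards [hev] with σ hσ
    rw [← integral_const_mul, ← integral_add (hmulint y (hb σ hσ))
      ((hmulint y (hm σ hσ)).const_mul c)]
    refine integral_congr_ae (Eventually.of_forall fun u => ?_)
    simp only
    ring
  have hseq : Tendsto (fun n : ℕ => (1 : ℝ) / (n + 1)) atTop (𝓝[>] 0) := by
    refine tendsto_nhdsWithin_iff.mpr ⟨tendsto_one_div_add_atTop_nhds_zero_nat, ?_⟩
    exact Eventually.of_forall fun n => by simp only [Set.mem_Ioi]; positivity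
  have hai : ∀ y, Integrable fun u => a u * fejer (l * (y - u)) := by
    intro y
    refine integrable_of_tendsto
      (G := fun (n : ℕ) u => a u * Real.exp (-(1 / ((n : ℝ) + 1) * u)) * fejer (l * (y - u)))
      ?_ ?_ ?_
    · refine Eventually.of_forall fun u => ?_
      have : Tendsto (fun σ : ℝ => a u * Real.exp (-(σ * u)) * fejer (l * (y - u))) (𝓝 0)
          (𝓝 (a u * Real.exp (-(0 * u)) * fejer (l * (y - u)))) :=
        Continuous.tendsto (by fun_prop) 0
      simp only [zero_mul, neg_zero, Real.exp_zero, mul_one] at this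
      exact (this.mono_left nhdsWithin_le_nhds).comp hseq
    · intro n
      exact (hmulint y (ha _ (by positivity))).aestronglyMeasurable
    · have h1 : ∀ n : ℕ, ∫⁻ u, ‖a u * Real.exp (-(1 / ((n : ℝ) + 1) * u)) *
          fejer (l * (y - u))‖ₑ = ENNReal.ofReal (∫ u, a u *
            Real.exp (-(1 / ((n : ℝ) + 1) * u)) * fejer (l * (y - u))) := by
        intro n
        have hnn : ∀ u, 0 ≤ a u * Real.exp (-(1 / ((n : ℝ) + 1) * u)) * fejer (l * (y - u)) :=
          fun u => mul_nonneg (mul_nonneg (ha0 u) (Real.exp_pos _).le) (fejer_nonneg _)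
        rw [ofReal_integral_eq_lintegral_ofReal (hmulint y (ha _ (by positivity)))
          (Eventually.of_forall hnn)]
        refine lintegral_congr fun u => ?_
        rw [Real.enorm_eq_ofReal (hnn u)]
      simp_rw [h1]
      have h2 := ENNReal.tendsto_ofReal ((hlima y).comp hseq)
      simp only [Function.comp_def] at h2
      rw [h2.liminf_eq]
      exact ENNReal.ofReal_ne_top
  refine ⟨hai, hρ0.congr fun y => ?_⟩
  have := tendsto_nhds_unique (hdct y haneg (hai y)) (hlima y)
  rw [this]
  ring

open MeasureTheory in
lemma integrable_one_add_abs_rpow {γ : ℝ} (hγ : γ < 1) :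
    Integrable fun v : ℝ => (1 + |v|) ^ (γ - 2) := by
  have := integrable_one_add_norm (E := ℝ) (μ := volume) (r := 2 - γ) (by simp; linarith)
  simpa [neg_sub] using this

lemma one_add_abs_rpow_mul_fejer_le {γ l κ v : ℝ} (hκ : 1 + v ^ 2 ≤ κ * (1 + (l * v) ^ 2)) :
    (1 + |v|) ^ γ * fejer (l * v) ≤ 10 * κ * (1 + |v|) ^ (γ - 2) := by
  have hp : 0 < 1 + |v| := by positivity
  have h1 : (1 + |v|) ^ γ = (1 + |v|) ^ (γ - 2) * (1 + |v|) ^ 2 := by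
    rw [← Real.rpow_natCast (1 + |v|) 2, ← Real.rpow_add hp]
    norm_num
  have h2 : (1 + |v|) ^ 2 * fejer (l * v) ≤ 10 * κ := by
    have h3 : (1 + |v|) ^ 2 ≤ 2 * (1 + v ^ 2) := by
      nlinarith [sq_nonneg (1 - |v|), sq_abs v]
    calc (1 + |v|) ^ 2 * fejer (l * v)
        ≤ (2 * (κ * (1 + (l * v) ^ 2))) * (5 / (1 + (l * v) ^ 2)) :=
          mul_le_mul (by linarith) (fejer_le _) (fejer_nonneg _) (by nlinarith [sq_nonneg (1 + |v|)])
      _ = 10 * κ := by field_simp; ring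
  rw [h1]
  have := mul_le_mul_of_nonneg_left h2 (Real.rpow_nonneg hp.le (γ - 2))
  nlinarith

open MeasureTheory in
lemma integrable_one_add_abs_rpow_mul_fejer {γ l : ℝ} (hγ : γ < 1) (hl : 0 < l) :
    Integrable fun v : ℝ => (1 + |v|) ^ γ * fejer (l * v) := by
  refine ((integrable_one_add_abs_rpow hγ).const_mul (10 * (1 + 1 / l ^ 2))).mono' ?_ ?_
  · refine Continuous.aestronglyMeasurable ?_
    have h1 : Continuous fun v : ℝ => (1 + |v|) ^ γ := by
      refine Continuous.rpow_const (by fun_prop) fun v => Or.inl ?_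
      positivity
    exact h1.mul (continuous_fejer.comp (by fun_prop))
  · refine Eventually.of_forall fun v => ?_
    rw [Real.norm_eq_abs, abs_of_nonneg (mul_nonneg (by positivity) (fejer_nonneg _))]
    refine one_add_abs_rpow_mul_fejer_le ?_
    have : (1 + 1 / l ^ 2) * (1 + (l * v) ^ 2) = 1 + v ^ 2 + (l * v) ^ 2 + 1 / l ^ 2 := by
      field_simp
      ring
    rw [this]
    have : 0 ≤ 1 / l ^ 2 := by positivity
    nlinarith [sq_nonneg (l * v)]

open MeasureTheory in
lemma exists_setIntegral_fejer_tail_le {γ δ : ℝ} (hγ : γ < 1) (hδ : 0 < δ) :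
    ∃ D : ℝ, 0 ≤ D ∧ ∀ l : ℝ, 0 < l →
      ∫ v in {v : ℝ | δ < |v|}, (1 + |v|) ^ γ * fejer (l * v) ≤ D / l ^ 2 := by
  have hS : MeasurableSet {v : ℝ | δ < |v|} := measurableSet_lt (by fun_prop) (by fun_prop)
  refine ⟨10 * (1 + 1 / δ ^ 2) * ∫ v : ℝ, (1 + |v|) ^ (γ - 2), ?_, fun l hl => ?_⟩
  · exact mul_nonneg (by positivity) (integral_nonneg fun v => by positivity)
  · have hW := (integrable_one_add_abs_rpow hγ).const_mul (10 * ((1 + 1 / δ ^ 2) / l ^ 2))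
    calc ∫ v in {v : ℝ | δ < |v|}, (1 + |v|) ^ γ * fejer (l * v)
        ≤ ∫ v in {v : ℝ | δ < |v|}, 10 * ((1 + 1 / δ ^ 2) / l ^ 2) * (1 + |v|) ^ (γ - 2) := by
          refine setIntegral_mono_on (integrable_one_add_abs_rpow_mul_fejer hγ hl).integrableOn
            hW.integrableOn hS fun v hv => ?_
          refine one_add_abs_rpow_mul_fejer_le ?_
          have hv2 : δ ^ 2 ≤ v ^ 2 := by
            rw [← sq_abs v]
            exact pow_le_pow_left₀ hδ.le (le_of_lt hv) 2
          have h1 : 1 ≤ 1 / δ ^ 2 * v ^ 2 := by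
            rw [one_div, inv_mul_eq_div, le_div_iff₀ (by positivity)]
            linarith
          have h2 : (1 + 1 / δ ^ 2) / l ^ 2 * (1 + (l * v) ^ 2) =
              (1 + 1 / δ ^ 2) / l ^ 2 + (1 + 1 / δ ^ 2) * v ^ 2 := by
            field_simp
          rw [h2]
          have : 0 ≤ (1 + 1 / δ ^ 2) / l ^ 2 := by positivity
          nlinarith
      _ ≤ ∫ v : ℝ, 10 * ((1 + 1 / δ ^ 2) / l ^ 2) * (1 + |v|) ^ (γ - 2) :=
          setIntegral_le_integral hW (Eventually.of_forall fun v => by positivity)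
      _ = _ := by
          rw [integral_const_mul]
          ring

open MeasureTheory in
lemma integral_fejer_pos : 0 < ∫ v, fejer v := by
  have hi : Integrable fejer := by
    simpa using integrable_one_add_abs_rpow_mul_fejer (γ := 0) (l := 1) (by norm_num) one_pos
  refine (integral_pos_iff_support_of_nonneg fejer_nonneg hi).mpr ?_
  refine (continuous_fejer.isOpen_support).measure_pos _ ⟨0, ?_⟩
  simp [fejer]

open MeasureTheory in
lemma integral_fejer_mul {l : ℝ} (hl : 0 < l) :
    ∫ v, fejer (l * v) = (∫ v, fejer v) / l := by
  rw [Measure.integral_comp_mul_left, abs_of_pos (by positivity), smul_eq_mul]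
  field_simp

lemma tendsto_add_rpow_div_rpow (δ γ : ℝ) :
    Tendsto (fun y : ℝ => (y + δ) ^ γ / y ^ γ) atTop (𝓝 1) := by
  have h1 : Tendsto (fun y : ℝ => 1 + δ / y) atTop (𝓝 1) := by
    simpa using tendsto_const_nhds.add (tendsto_const_nhds.div_atTop tendsto_id (a := δ))
      (a := (1 : ℝ))
  have h2 := h1.rpow_const (p := γ) (Or.inl one_ne_zero)
  rw [Real.one_rpow] at h2
  refine h2.congr' ?_
  filter_upwards [eventually_gt_atTop 0, eventually_gt_atTop (-δ)] with y hy hy'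
  rw [← Real.div_rpow (by linarith) hy.le]
  congr 1
  field_simp

open MeasureTheory in
lemma tendsto_integral_rpow_mul_fejer {γ l : ℝ} (hγ0 : 0 ≤ γ) (hγ : γ < 1) (hl : 0 < l) :
    Tendsto (fun y : ℝ => (∫ v, (if 0 < y - v then (y - v) ^ γ else 0) * fejer (l * v)) / y ^ γ)
      atTop (𝓝 ((∫ v, fejer v) / l)) := by
  rw [← integral_fejer_mul hl]
  have hm : ∀ y : ℝ, Measurable fun v : ℝ => if 0 < y - v then (y - v) ^ γ else 0 := fun y =>
    Measurable.ite (measurableSet_lt (by fun_prop) (by fun_prop)) (by fun_prop) (by fun_prop)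
  have : Tendsto (fun y : ℝ => ∫ v, (if 0 < y - v then (y - v) ^ γ else 0) / y ^ γ * fejer (l * v))
      atTop (𝓝 (∫ v, 1 * fejer (l * v))) := by
    refine tendsto_integral_filter_of_dominated_convergence
      (fun v : ℝ => (1 + |v|) ^ γ * fejer (l * v)) ?_ ?_
      (integrable_one_add_abs_rpow_mul_fejer hγ hl) ?_
    · refine Eventually.of_forall fun y => ?_
      have hf : Continuous fun v => fejer (l * v) := continuous_fejer.comp (by fun_prop)
      exact (((hm y).div_const _).mul hf.measurable).aestronglyMeasurable
    · filter_upwards [eventually_ge_atTop 1] with y hy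
      refine Eventually.of_forall fun v => ?_
      rw [norm_mul, Real.norm_eq_abs (fejer _), abs_of_nonneg (fejer_nonneg _)]
      refine mul_le_mul_of_nonneg_right ?_ (fejer_nonneg _)
      split_ifs with h
      · rw [← Real.div_rpow h.le (by linarith), Real.norm_eq_abs,
          abs_of_nonneg (Real.rpow_nonneg (by positivity) _)]
        refine Real.rpow_le_rpow (by positivity) ?_ hγ0
        rw [div_le_iff₀ (by linarith)]
        have := neg_abs_le v
        nlinarith [abs_nonneg v]
      · simp only [zero_div, norm_zero]
        positivity
    · refine Eventually.of_forall fun v => Tendsto.mul_const _ ?_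
      refine (tendsto_add_rpow_div_rpow (-v) γ).congr' ?_
      filter_upwards [eventually_gt_atTop v] with y hy
      rw [if_pos (by linarith), sub_eq_add_neg]
  simp only [one_mul] at this
  refine this.congr fun y => ?_
  rw [← integral_div]
  refine integral_congr_ae (Eventually.of_forall fun v => ?_)
  simp only
  ring

open MeasureTheory in
/-- Unsmoothing Fejér means of a slowly decreasing function. -/
lemma tendsto_div_rpow_of_integral_mul_fejer {a : ℝ → ℝ} (ha0 : ∀ u, 0 ≤ a u)
    (haneg : ∀ u < 0, a u = 0) (hmono : Monotone fun u => Real.exp u * a u) {γ c : ℝ} (hγ0 : 0 ≤ γ) (hγ : γ < 1)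
    (hai : ∀ l y : ℝ, 0 < l → Integrable fun v => a (y - v) * fejer (l * v))
    (hA : ∀ l : ℝ, 0 < l → Tendsto (fun y : ℝ => (∫ v, a (y - v) * fejer (l * v)) / y ^ γ) atTop
      (𝓝 (c * ((∫ v, fejer v) / l)))) :
    Tendsto (fun y : ℝ => a y / y ^ γ) atTop (𝓝 c) := by
  set J := ∫ v, fejer v with hJ
  have hJ0 : 0 < J := integral_fejer_pos
  set A : ℝ → ℝ → ℝ := fun l y => ∫ v, a (y - v) * fejer (l * v) with hAdef
  have hshift : ∀ l δ : ℝ, 0 < l →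
      Tendsto (fun y : ℝ => A l (y + δ) / y ^ γ) atTop (𝓝 (c * (J / l))) := by
    intro l δ hl
    have h1 := ((hA l hl).comp (tendsto_atTop_add_const_right atTop δ tendsto_id)).mul
      (tendsto_add_rpow_div_rpow δ γ)
    rw [mul_one] at h1
    refine h1.congr' ?_
    filter_upwards [eventually_gt_atTop (-δ)] with y hy
    have : 0 < (y + δ) ^ γ := Real.rpow_pos_of_pos (by linarith) _
    simp only [Function.comp, id]
    rw [div_mul_div_cancel₀ this.ne']
  have hc0 : 0 ≤ c := by
    have h1 := ge_of_tendsto' (hA 1 one_pos |>.congr' ?_) (b := 0) (f := fun y => |A 1 y / y ^ γ|)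
      fun y => abs_nonneg _
    · rw [div_one] at h1
      exact nonneg_of_mul_nonneg_left h1 hJ0
    · filter_upwards [eventually_gt_atTop 0] with y hy
      rw [abs_of_nonneg]
      exact div_nonneg (integral_nonneg fun v => mul_nonneg (ha0 _) (fejer_nonneg _))
        (Real.rpow_nonneg hy.le _)
  have hslow : ∀ x y : ℝ, x ≤ y → Real.exp (x - y) * a x ≤ a y := by
    intro x y hxy
    have := hmono hxy
    simp only at this
    rw [Real.exp_sub, div_mul_eq_mul_div, div_le_iff₀ (Real.exp_pos _)]
    linarith
  have hfi : ∀ l : ℝ, 0 < l → Integrable fun v => fejer (l * v) := fun l hl => by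
    simpa using integrable_one_add_abs_rpow_mul_fejer (γ := 0) (by norm_num) hl
  have hSm : ∀ δ : ℝ, MeasurableSet {v : ℝ | δ < |v|} := fun δ =>
    measurableSet_lt (by fun_prop) (by fun_prop)
  have hSc : ∀ δ v : ℝ, v ∈ {v : ℝ | δ < |v|}ᶜ → -δ ≤ v ∧ v ≤ δ := by
    intro δ v hv
    simp only [Set.mem_compl_iff, Set.mem_ofPred_eq, not_lt] at hv
    exact abs_le.mp hv
  -- upper bound
  have hup : ∀ δ l D : ℝ, 0 < δ → 0 < l → 0 ≤ D →
      (∫ v in {v : ℝ | δ < |v|}, (1 + |v|) ^ γ * fejer (l * v) ≤ D / l ^ 2) → ∀ y,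
      a y * (J / l - D / l ^ 2) ≤ Real.exp (2 * δ) * A l (y + δ) := by
    intro δ l D hδ hl hD0 hD y
    have h1 : J / l - D / l ^ 2 ≤ ∫ v in {v : ℝ | δ < |v|}ᶜ, fejer (l * v) := by
      have h2 := integral_add_compl (hSm δ) (hfi l hl)
      rw [integral_fejer_mul hl] at h2
      have h3 : ∫ v in {v : ℝ | δ < |v|}, fejer (l * v) ≤
          ∫ v in {v : ℝ | δ < |v|}, (1 + |v|) ^ γ * fejer (l * v) := by
        refine setIntegral_mono (hfi l hl).integrableOn
          (integrable_one_add_abs_rpow_mul_fejer hγ hl).integrableOn fun v => ?_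
        refine le_mul_of_one_le_left (fejer_nonneg _) (Real.one_le_rpow ?_ hγ0)
        linarith [abs_nonneg v]
      linarith
    have h4 : a y * ∫ v in {v : ℝ | δ < |v|}ᶜ, fejer (l * v) ≤ Real.exp (2 * δ) * A l (y + δ) := by
      rw [← integral_const_mul]
      calc ∫ v in {v : ℝ | δ < |v|}ᶜ, a y * fejer (l * v)
          ≤ ∫ v in {v : ℝ | δ < |v|}ᶜ, Real.exp (2 * δ) * (a (y + δ - v) * fejer (l * v)) := by
            refine setIntegral_mono_on ((hfi l hl).const_mul _).integrableOn
              ((hai l (y + δ) hl).const_mul _).integrableOn (hSm δ).compl fun v hv => ?_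
            obtain ⟨hv1, hv2⟩ := hSc δ v hv
            rw [← mul_assoc]
            refine mul_le_mul_of_nonneg_right ?_ (fejer_nonneg _)
            have := hslow y (y + δ - v) (by linarith)
            have h5 : Real.exp (-(2 * δ)) ≤ Real.exp (y - (y + δ - v)) :=
              Real.exp_le_exp.mpr (by linarith)
            have h6 := (mul_le_mul_of_nonneg_right h5 (ha0 y)).trans this
            have h7 := mul_le_mul_of_nonneg_left h6 (Real.exp_pos (2 * δ)).le
            rwa [← mul_assoc, ← Real.exp_add, add_neg_cancel, Real.exp_zero, one_mul] at h7
        _ = Real.exp (2 * δ) * ∫ v in {v : ℝ | δ < |v|}ᶜ, a (y + δ - v) * fejer (l * v) :=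
            integral_const_mul _ _
        _ ≤ _ := by
            refine mul_le_mul_of_nonneg_left ?_ (Real.exp_pos _).le
            exact setIntegral_le_integral (hai l (y + δ) hl)
              (Eventually.of_forall fun v => mul_nonneg (ha0 _) (fejer_nonneg _))
    exact (mul_le_mul_of_nonneg_left h1 (ha0 y)).trans h4
  have hupper : ∀ x, c < x → ∀ᶠ y in atTop, a y / y ^ γ < x := by
    intro x hx
    obtain ⟨δ, hδ, hδx⟩ : ∃ δ : ℝ, 0 < δ ∧ Real.exp (2 * δ) * c < x := by
      have : Tendsto (fun δ : ℝ => Real.exp (2 * δ) * c) (𝓝[>] 0) (𝓝 c) := by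
        have h : Tendsto (fun δ : ℝ => Real.exp (2 * δ) * c) (𝓝 0) (𝓝 (Real.exp (2 * 0) * c)) :=
          Continuous.tendsto (by fun_prop) 0
        simp only [mul_zero, Real.exp_zero, one_mul] at h
        exact h.mono_left nhdsWithin_le_nhds
      exact (eventually_mem_nhdsWithin.and (this.eventually_lt_const hx)).exists
    obtain ⟨D, hD0, hD⟩ := exists_setIntegral_fejer_tail_le hγ hδ
    obtain ⟨l, hl, hDl, hlx⟩ : ∃ l : ℝ, 0 < l ∧ D / (J * l) < 1 ∧
        Real.exp (2 * δ) * c < x * (1 - D / (J * l)) := by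
      have h0 : Tendsto (fun l : ℝ => D / (J * l)) atTop (𝓝 0) :=
        tendsto_const_nhds.div_atTop (tendsto_id.const_mul_atTop hJ0)
      have h1 : Tendsto (fun l : ℝ => x * (1 - D / (J * l))) atTop (𝓝 x) := by
        simpa using (h0.const_sub 1).const_mul x
      exact ((eventually_gt_atTop 0).and ((h0.eventually_lt_const one_pos).and
        (h1.eventually_const_lt hδx))).exists
    have hJl : J / l - D / l ^ 2 = J / l * (1 - D / (J * l)) := by field_simp
    have hJl0 : 0 < J / l := by positivity
    have h2 := (hshift l δ hl).const_mul (Real.exp (2 * δ))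
    have h3 : Real.exp (2 * δ) * (c * (J / l)) < x * (J / l - D / l ^ 2) := by
      rw [hJl]
      nlinarith
    filter_upwards [h2.eventually_lt_const h3, eventually_gt_atTop 0] with y hy hy0
    have h4 := hup δ l D hδ hl hD0 (hD l hl) y
    have hyp : 0 < y ^ γ := Real.rpow_pos_of_pos hy0 _
    have h5 : 0 < J / l - D / l ^ 2 := by
      rw [hJl]
      exact mul_pos hJl0 (by linarith)
    rw [div_lt_iff₀ hyp]
    rw [← mul_div_assoc, div_lt_iff₀ hyp] at hy
    have h6 : a y * (J / l - D / l ^ 2) < x * y ^ γ * (J / l - D / l ^ 2) := by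
      calc _ ≤ _ := h4
        _ < _ := hy
        _ = _ := by ring
    exact lt_of_mul_lt_mul_right h6 h5.le
  -- global bound
  obtain ⟨C, hC0, hC⟩ : ∃ C : ℝ, 0 ≤ C ∧ ∀ u, a u ≤ C * (1 + |u|) ^ γ := by
    obtain ⟨Y, hY⟩ := eventually_atTop.mp
      ((hupper (c + 1) (by linarith)).and (eventually_gt_atTop 0))
    have hY0 : 0 < Y := (hY Y le_rfl).2
    refine ⟨max (c + 1) (Real.exp Y * a Y), le_max_of_le_left (by linarith), fun u => ?_⟩
    have hone : 1 ≤ (1 + |u|) ^ γ := Real.one_le_rpow (by linarith [abs_nonneg u]) hγ0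
    rcases lt_or_ge u 0 with hu | hu
    · rw [haneg u hu]
      exact mul_nonneg (le_max_of_le_left (by linarith)) (by positivity)
    · rcases le_total u Y with huY | huY
      · have h1 := hmono huY
        simp only at h1
        have h2 : a u ≤ Real.exp u * a u :=
          le_mul_of_one_le_left (ha0 u) (Real.one_le_exp hu)
        calc a u ≤ Real.exp Y * a Y := h2.trans h1
          _ ≤ max (c + 1) (Real.exp Y * a Y) * 1 := by rw [mul_one]; exact le_max_right _ _
          _ ≤ _ := mul_le_mul_of_nonneg_left hone (le_max_of_le_left (by linarith))
      · obtain ⟨h1, h2⟩ := hY u huY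
        rw [div_lt_iff₀ (Real.rpow_pos_of_pos h2 _)] at h1
        refine h1.le.trans (mul_le_mul (le_max_left _ _) ?_ (Real.rpow_nonneg h2.le _)
          (le_max_of_le_left (by linarith)))
        exact Real.rpow_le_rpow h2.le (by linarith [le_abs_self u]) hγ0
  have hlow : ∀ δ l D : ℝ, 0 < δ → 0 < l → 0 ≤ D →
      (∫ v in {v : ℝ | δ < |v|}, (1 + |v|) ^ γ * fejer (l * v) ≤ D / l ^ 2) → ∀ y, δ ≤ y →
      A l (y + -δ) ≤ Real.exp (2 * δ) * a y * (J / l) + C * (y + 1) ^ γ * (D / l ^ 2) := by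
    intro δ l D hδ hl hD0 hD y hyδ
    have h1 := integral_add_compl (hSm δ) (hai l (y + -δ) hl)
    have h2 : ∫ v in {v : ℝ | δ < |v|}ᶜ, a (y + -δ - v) * fejer (l * v) ≤
        Real.exp (2 * δ) * a y * (J / l) := by
      calc _ ≤ ∫ v in {v : ℝ | δ < |v|}ᶜ, Real.exp (2 * δ) * a y * fejer (l * v) := by
            refine setIntegral_mono_on (hai l _ hl).integrableOn
              ((hfi l hl).const_mul _).integrableOn (hSm δ).compl fun v hv => ?_
            obtain ⟨hv1, hv2⟩ := hSc δ v hv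
            refine mul_le_mul_of_nonneg_right ?_ (fejer_nonneg _)
            have := hslow (y + -δ - v) y (by linarith)
            have h5 : Real.exp (-(2 * δ)) ≤ Real.exp ((y + -δ - v) - y) :=
              Real.exp_le_exp.mpr (by linarith)
            have h6 := (mul_le_mul_of_nonneg_right h5 (ha0 _)).trans this
            have h7 := mul_le_mul_of_nonneg_left h6 (Real.exp_pos (2 * δ)).le
            rwa [← mul_assoc, ← Real.exp_add, add_neg_cancel, Real.exp_zero, one_mul] at h7
        _ ≤ ∫ v, Real.exp (2 * δ) * a y * fejer (l * v) :=
            setIntegral_le_integral ((hfi l hl).const_mul _) (Eventually.of_forall fun v =>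
              mul_nonneg (mul_nonneg (Real.exp_pos _).le (ha0 _)) (fejer_nonneg _))
        _ = _ := by rw [integral_const_mul, integral_fejer_mul hl]
    have h3 : ∫ v in {v : ℝ | δ < |v|}, a (y + -δ - v) * fejer (l * v) ≤
        C * (y + 1) ^ γ * (D / l ^ 2) := by
      have hw := integrable_one_add_abs_rpow_mul_fejer hγ hl
      calc _ ≤ ∫ v in {v : ℝ | δ < |v|}, C * (y + 1) ^ γ * ((1 + |v|) ^ γ * fejer (l * v)) := by
            refine setIntegral_mono (hai l _ hl).integrableOn
              (hw.const_mul _).integrableOn fun v => ?_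
            rw [← mul_assoc]
            refine mul_le_mul_of_nonneg_right ((hC _).trans ?_) (fejer_nonneg _)
            rw [mul_assoc, ← Real.mul_rpow (by linarith) (by positivity)]
            refine mul_le_mul_of_nonneg_left (Real.rpow_le_rpow (by positivity) ?_ hγ0) hC0
            have h8 := abs_sub (y + -δ) v
            rw [abs_of_nonneg (show 0 ≤ y + -δ by linarith)] at h8
            nlinarith [abs_nonneg v]
        _ = C * (y + 1) ^ γ * ∫ v in {v : ℝ | δ < |v|}, ((1 + |v|) ^ γ * fejer (l * v)) :=
            integral_const_mul _ _
        _ ≤ _ := mul_le_mul_of_nonneg_left (hD) (mul_nonneg hC0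
            (Real.rpow_nonneg (by linarith) _))
    simp only [hAdef]
    linarith
  have hlower : ∀ x, x < c → ∀ᶠ y in atTop, x < a y / y ^ γ := by
    intro x hx
    obtain ⟨δ, hδ, hδx⟩ : ∃ δ : ℝ, 0 < δ ∧ Real.exp (2 * δ) * x < c := by
      have : Tendsto (fun δ : ℝ => Real.exp (2 * δ) * x) (𝓝[>] 0) (𝓝 x) := by
        have h : Tendsto (fun δ : ℝ => Real.exp (2 * δ) * x) (𝓝 0) (𝓝 (Real.exp (2 * 0) * x)) :=
          Continuous.tendsto (by fun_prop) 0
        simp only [mul_zero, Real.exp_zero, one_mul] at h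
        exact h.mono_left nhdsWithin_le_nhds
      exact (eventually_mem_nhdsWithin.and (this.eventually_lt_const hx)).exists
    obtain ⟨D, hD0, hD⟩ := exists_setIntegral_fejer_tail_le hγ hδ
    obtain ⟨l, hl, hlx⟩ : ∃ l : ℝ, 0 < l ∧
        Real.exp (2 * δ) * x < c - C * (D / (J * l)) := by
      have h0 : Tendsto (fun l : ℝ => D / (J * l)) atTop (𝓝 0) :=
        tendsto_const_nhds.div_atTop (tendsto_id.const_mul_atTop hJ0)
      have h1 : Tendsto (fun l : ℝ => c - C * (D / (J * l))) atTop (𝓝 c) := by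
        simpa using tendsto_const_nhds.sub (h0.const_mul C) (a := c)
      exact ((eventually_gt_atTop 0).and (h1.eventually_const_lt hδx)).exists
    have hJl0 : 0 < J / l := by positivity
    have h2 := (hshift l (-δ) hl).sub
      ((tendsto_add_rpow_div_rpow 1 γ).const_mul (C * (D / l ^ 2)))
    have h3 : Real.exp (2 * δ) * x * (J / l) < c * (J / l) - C * (D / l ^ 2) * 1 := by
      have : c * (J / l) - C * (D / l ^ 2) * 1 = (c - C * (D / (J * l))) * (J / l) := by field_simp
      rw [this]
      exact mul_lt_mul_of_pos_right hlx hJl0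
    filter_upwards [h2.eventually_const_lt h3, eventually_gt_atTop 0, eventually_ge_atTop δ]
      with y hy hy0 hyδ
    have h4 := hlow δ l D hδ hl hD0 (hD l hl) y hyδ
    have hyp : 0 < y ^ γ := Real.rpow_pos_of_pos hy0 _
    rw [lt_div_iff₀ hyp]
    have h5 : A l (y + -δ) / y ^ γ - C * (D / l ^ 2) * ((y + 1) ^ γ / y ^ γ) =
        (A l (y + -δ) - C * (D / l ^ 2) * (y + 1) ^ γ) / y ^ γ := by ring
    rw [h5, lt_div_iff₀ hyp] at hy
    have h6 : x * y ^ γ * (Real.exp (2 * δ) * (J / l)) < a y * (Real.exp (2 * δ) * (J / l)) := by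
      nlinarith
    exact lt_of_mul_lt_mul_right h6 (mul_pos (Real.exp_pos _) hJl0).le
  exact tendsto_order.mpr ⟨hlower, hupper⟩

open MeasureTheory in
lemma integrable_ite_rpow_mul_exp {γ σ : ℝ} (hγ : -1 < γ) (hσ : 0 < σ) :
    Integrable fun u : ℝ => (if 0 < u then u ^ γ else 0) * Real.exp (-(σ * u)) := by
  have h := integrableOn_rpow_mul_exp_neg_mul_rpow (p := 1) hγ one_pos hσ
  rw [← integrable_indicator_iff measurableSet_Ioi] at h
  refine h.congr (Eventually.of_forall fun u => ?_)
  simp only [Set.indicator_apply, Set.mem_Ioi, Real.rpow_one, neg_mul]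
  split_ifs <;> simp

open MeasureTheory in
/-- A Wiener–Ikehara type theorem with a boundary singularity of order less than `2`. -/
theorem tendsto_div_rpow_of_laplace {a : ℝ → ℝ} (ha0 : ∀ u, 0 ≤ a u)
    (haneg : ∀ u < 0, a u = 0) (hmono : Monotone fun u => Real.exp u * a u)
    (ha : ∀ σ : ℝ, 0 < σ → Integrable fun u => a u * Real.exp (-(σ * u)))
    {γ c : ℝ} (hγ0 : 0 ≤ γ) (hγ : γ < 1) {R0 : ℝ → ℂ} {α : ℝ} (hα : α < 1)
    (hlim : ∀ t : ℝ, t ≠ 0 → Tendsto (fun σ : ℝ => ∫ u : ℝ,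
      ((a u - c * (if 0 < u then u ^ γ else 0) : ℝ) : ℂ) *
        Complex.exp (-((σ + Complex.I * t) * u))) (𝓝[>] 0) (𝓝 (R0 t)))
    (hbd : ∀ B : ℝ, ∃ C : ℝ, ∀ σ t : ℝ, 0 < σ → σ ≤ 1 → t ≠ 0 → |t| ≤ B →
      ‖∫ u : ℝ, ((a u - c * (if 0 < u then u ^ γ else 0) : ℝ) : ℂ) *
        Complex.exp (-((σ + Complex.I * t) * u))‖ ≤ C * |t| ^ (-α)) :
    Tendsto (fun y : ℝ => a y / y ^ γ) atTop (𝓝 c) := by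
  have hsub : ∀ (f : ℝ → ℝ) (l y : ℝ), (fun v => f (y - v) * fejer (l * v)) =
      (fun u => f u * fejer (l * (y - u))) ∘ fun v => y - v := by
    intro f l y
    funext v
    simp
  have hmf : ∀ l y : ℝ, 0 < l → Integrable fun u : ℝ => (if 0 < u then u ^ γ else 0) *
      fejer (l * (y - u)) := by
    intro l y hl
    have hmm : Measurable fun u : ℝ => if 0 < u then u ^ γ else 0 :=
      Measurable.ite (measurableSet_lt (by fun_prop) (by fun_prop)) (by fun_prop) (by fun_prop)
    have hf : Measurable fun u => fejer (l * (y - u)) :=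
      (continuous_fejer.comp (by fun_prop)).measurable
    have hw := ((integrable_one_add_abs_rpow_mul_fejer hγ hl).comp_sub_left y).const_mul
      ((1 + |y|) ^ γ)
    refine hw.mono' (hmm.mul hf).aestronglyMeasurable (Eventually.of_forall fun u => ?_)
    rw [norm_mul, Real.norm_eq_abs (fejer _), abs_of_nonneg (fejer_nonneg _), ← mul_assoc]
    refine mul_le_mul_of_nonneg_right ?_ (fejer_nonneg _)
    split_ifs with h
    · rw [Real.norm_eq_abs, abs_of_nonneg (Real.rpow_nonneg h.le _),
        ← Real.mul_rpow (by positivity) (by positivity)]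
      refine Real.rpow_le_rpow h.le ?_ hγ0
      have := le_abs_self y
      have := neg_abs_le (y - u)
      nlinarith [abs_nonneg y, abs_nonneg (y - u)]
    · rw [norm_zero]
      positivity
  have key := fun {l : ℝ} (hl : 0 < l) => tendsto_integral_mul_fejer_sub ha0 haneg
    (fun u hu => if_neg hu.le.not_gt) ha
    (fun σ hσ => integrable_ite_rpow_mul_exp (by linarith) hσ) hmf hα hlim hbd hl
  refine tendsto_div_rpow_of_integral_mul_fejer ha0 haneg hmono hγ0 hγ (fun l y hl => ?_)
    fun l hl => ?_
  · rw [hsub]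
    exact ((key hl).1 y).comp_sub_left y
  · have h1 := (key hl).2
    have h2 : Tendsto (fun y : ℝ => ((∫ u, a u * fejer (l * (y - u))) -
        c * ∫ u : ℝ, (if 0 < u then u ^ γ else 0) * fejer (l * (y - u))) / y ^ γ) atTop (𝓝 0) := by
      have h1' := h1.norm
      rw [norm_zero] at h1'
      refine squeeze_zero_norm' ?_ h1'
      filter_upwards [eventually_ge_atTop 1] with y hy
      rw [norm_div]
      refine div_le_self (norm_nonneg _) ?_
      rw [Real.norm_eq_abs, abs_of_nonneg (by positivity)]
      exact Real.one_le_rpow hy hγ0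
    have h3 := h2.add ((tendsto_integral_rpow_mul_fejer hγ0 hγ hl).const_mul c)
    rw [zero_add] at h3
    refine h3.congr fun y : ℝ => ?_
    have e : ∀ f : ℝ → ℝ, ∫ v, f (y - v) * fejer (l * v) = ∫ u, f u * fejer (l * (y - u)) := by
      intro f
      rw [← integral_sub_left_eq_self _ volume y]
      simp
    rw [e, e (fun u => if 0 < u then u ^ γ else 0)]
    ring

section LatticePoints

open NumberField.mixedEmbedding NumberField.mixedEmbedding.fundamentalCone
  NumberField.InfinitePlace NumberField.Units NumberField.Units.dirichletUnitTheorem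
  MeasureTheory ENNReal

variable (K : Type*) [Field K] [NumberField K]

open scoped Classical in
/-- The parameter boxes with `w₀`-coordinate at most `p` and other coordinates in `[q₁, q₂)`. -/
abbrev paramBox (p q₁ q₂ : ℝ) : Set (realSpace K) :=
  Set.univ.pi fun w ↦ if w = w₀ then Set.Iic p else Set.Ico q₁ q₂

/-- The subset of the mixed space parametrized by a box. -/
def coneBox (p q₁ q₂ : ℝ) : Set (mixedSpace K) :=
  normAtAllPlaces ⁻¹' (expMapBasis '' paramBox K p q₁ q₂)

lemma coneBox_zero_zero_one : coneBox K 0 0 1 = normLeOne K := (normLeOne_eq_preimage K).symm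

lemma measurableSet_paramBox (p q₁ q₂ : ℝ) : MeasurableSet (paramBox K p q₁ q₂) := by
  refine MeasurableSet.univ_pi fun _ ↦ ?_
  split_ifs
  · exact measurableSet_Iic
  · exact measurableSet_Ico

lemma measurableSet_coneBox (p q₁ q₂ : ℝ) : MeasurableSet (coneBox K p q₁ q₂) := by
  refine (continuous_normAtAllPlaces K).measurable ?_
  exact (measurableSet_paramBox K p q₁ q₂).image_of_continuousOn_injOn
    (continuous_expMapBasis K).continuousOn (injective_expMapBasis K).injOn

open scoped Classical in
lemma setLIntegral_paramBox_exp {n : ℕ} (hn : 0 < n) (p q₁ q₂ : ℝ) :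
    ∫⁻ (x : realSpace K) in paramBox K p q₁ q₂, .ofReal (Real.exp (x w₀ * n)) =
      (n : ℝ≥0∞)⁻¹ * (.ofReal (Real.exp (p * n)) * .ofReal (q₂ - q₁) ^
        (Finset.univ.erase (w₀ : InfinitePlace K)).card) := by
  have hn : 0 < (n : ℝ) := Nat.cast_pos.mpr hn
  rw [volume_pi, paramBox, Measure.restrict_pi_pi, lintegral_eq_lmarginal_univ 0,
    lmarginal_erase' _ (by fun_prop) (Finset.mem_univ w₀), if_pos rfl]
  simp_rw [Function.update_self, lmarginal, lintegral_const, Measure.pi_univ, if_neg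
    (Finset.ne_of_mem_erase (Subtype.prop _)), Measure.restrict_apply_univ, Real.volume_Ico,
    Finset.prod_const, Finset.card_univ, Fintype.card_coe, mul_comm _ (n : ℝ)]
  rw [← ofReal_integral_eq_lintegral_ofReal (integrableOn_exp_mul_Iic hn _), integral_exp_mul_Iic
    hn, ofReal_div_of_pos hn, ofReal_natCast, ENNReal.div_eq_inv_mul, mul_assoc]
  filter_upwards with _ using Real.exp_nonneg _

open scoped Classical in
lemma exists_volume_coneBox_eq : ∃ A : ℝ≥0∞, ∀ p q₁ q₂ : ℝ, volume (coneBox K p q₁ q₂) =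
    A * (.ofReal (Real.exp (p * Module.finrank ℚ K)) * .ofReal (q₂ - q₁) ^
        (Finset.univ.erase (w₀ : InfinitePlace K)).card) := by
  refine ⟨2 ^ nrRealPlaces K * .ofReal (2 * Real.pi) ^ nrComplexPlaces K *
    ((2 : ℝ≥0∞)⁻¹ ^ nrComplexPlaces K * ENNReal.ofReal (regulator K) * (Module.finrank ℚ K) *
      (Module.finrank ℚ K : ℝ≥0∞)⁻¹), fun p q₁ q₂ => ?_⟩
  have h : normAtAllPlaces ⁻¹' (normAtAllPlaces '' coneBox K p q₁ q₂) = coneBox K p q₁ q₂ :=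
    Set.preimage_image_preimage
  rw [volume_eq_two_pow_mul_two_pi_pow_mul_integral h
    (measurableSet_coneBox K p q₁ q₂), coneBox,
    normAtAllPlaces_image_preimage_expMapBasis,
    setLIntegral_expMapBasis_image (measurableSet_paramBox K p q₁ q₂) (by fun_prop)]
  simp_rw [ENNReal.inv_mul_cancel_right
    (Finset.prod_ne_zero_iff.mpr fun _ _ ↦ ofReal_ne_zero_iff.mpr (expMapBasis_pos _ _))
    (prod_ne_top fun _ _ ↦ ofReal_ne_top)]
  rw [setLIntegral_paramBox_exp K Module.finrank_pos]
  simp only [mul_assoc]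

open scoped Classical in
/-- The volume of a cone box. -/
lemma exists_volume_coneBox : ∃ m : ℕ, ∀ p q₁ q₂ : ℝ, q₁ ≤ q₂ → volume (coneBox K p q₁ q₂) =
    volume (normLeOne K) * .ofReal (Real.exp (p * Module.finrank ℚ K) * (q₂ - q₁) ^ m) := by
  obtain ⟨A, hA⟩ := exists_volume_coneBox_eq K
  refine ⟨(Finset.univ.erase (w₀ : InfinitePlace K)).card, fun p q₁ q₂ h => ?_⟩
  have h1 := hA 0 0 1
  rw [coneBox_zero_zero_one] at h1
  simp only [zero_mul, Real.exp_zero, ofReal_one, sub_zero, one_pow, mul_one] at h1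
  rw [h1, hA, ENNReal.ofReal_mul (Real.exp_pos _).le, ENNReal.ofReal_pow (by linarith)]



lemma abs_log_sub_log_le {a b θ : ℝ} (hθ : θ ≤ 1 / 2) (ha : 0 < a) (hb : 0 < b)
    (h : |b - a| ≤ θ * a) : |Real.log b - Real.log a| ≤ 2 * θ := by
  obtain ⟨h1, h2⟩ := abs_le.mp h
  rw [abs_le]
  constructor
  · have h3 := Real.log_le_sub_one_of_pos (div_pos ha hb)
    rw [Real.log_div ha.ne' hb.ne'] at h3
    have h4 : a / b - 1 ≤ 2 * θ := by
      rw [sub_le_iff_le_add, div_le_iff₀ hb]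
      have h5 : 0 ≤ θ := by
        by_contra hc
        nlinarith [abs_nonneg (b - a)]
      nlinarith [mul_nonneg h5 ha.le]
    linarith
  · have h3 := Real.log_le_sub_one_of_pos (div_pos hb ha)
    rw [Real.log_div hb.ne' ha.ne'] at h3
    have h4 : b / a - 1 ≤ θ := by
      rw [sub_le_iff_le_add, div_le_iff₀ ha]
      nlinarith
    have h5 : 0 ≤ θ := by
      by_contra hc
      nlinarith [abs_nonneg (b - a)]
    linarith

open scoped Classical in
lemma abs_normAtPlace_sub_le (x y : mixedSpace K) (w : InfinitePlace K) :
    |normAtPlace w y - normAtPlace w x| ≤ ‖y - x‖ := by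
  have h0 : ∀ z : mixedSpace K, normAtPlace w z ≤ ‖z‖ := fun z => by
    rw [norm_eq_sup'_normAtPlace]
    exact Finset.le_sup' (fun w => normAtPlace w z) (Finset.mem_univ w)
  have h1 := normAtPlace_add_le w (y - x) x
  have h2 := normAtPlace_add_le w (x - y) y
  rw [sub_add_cancel] at h1 h2
  have h3 := h0 (y - x)
  have h4 := h0 (x - y)
  rw [norm_sub_rev] at h4
  rw [abs_le]
  constructor <;> linarith

open scoped Classical in
/-- The parametrization of the fundamental cone is inversely Hölder away from the origin. -/
lemma exists_expMapBasis_near : ∃ C : ℝ, 1 ≤ C ∧ ∀ θ : ℝ, 0 < θ → θ ≤ 1 / 2 →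
    ∀ (x y : mixedSpace K) (p : realSpace K), normAtAllPlaces x = expMapBasis p →
      (∀ w, w ≠ w₀ → -1 ≤ p w ∧ p w ≤ 2) → C * θ ≤ ‖x‖ → ‖y - x‖ ≤ θ ^ 2 →
      ∃ p' : realSpace K, normAtAllPlaces y = expMapBasis p' ∧ ∀ w, |p' w - p w| ≤ C * θ := by
  set L := (completeBasis K).equivFunL
  set B := 2 * ‖(L.symm : (InfinitePlace K → ℝ) →L[ℝ] realSpace K)‖ with hB
  set B' := ‖(L : realSpace K →L[ℝ] (InfinitePlace K → ℝ))‖ with hB'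
  have hB0 : 0 ≤ B := by positivity
  refine ⟨Real.exp (2 * B) + 4 * B', ?_, ?_⟩
  · have : 1 ≤ Real.exp (2 * B) := Real.one_le_exp (by positivity)
    have : 0 ≤ B' := norm_nonneg _
    linarith
  intro θ hθ0 hθ x y p hx hp hxn hyx
  have hmult : ∀ w : InfinitePlace K, (1 : ℝ) ≤ w.mult := fun w => by
    exact_mod_cast w.mult_pos
  have hmult2 : ∀ w : InfinitePlace K, (w.mult : ℝ) ≤ 2 := fun w => by
    rw [InfinitePlace.mult]; split_ifs <;> norm_num
  have ha : ∀ w, normAtPlace w x = expMapBasis p w := fun w => congr_fun hx w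
  -- two-sided bounds on the coordinates
  have hbd : ∀ w, Real.exp (p w₀) * Real.exp (-B) ≤ normAtPlace w x ∧
      normAtPlace w x ≤ Real.exp (p w₀) * Real.exp B := by
    intro w
    set q : realSpace K := fun i => if i = w₀ then 0 else p i
    have hq : ‖q‖ ≤ 2 := by
      refine (pi_norm_le_iff_of_nonneg (by norm_num)).mpr fun i => ?_
      simp only [q]
      split_ifs with hi
      · simp
      · rw [Real.norm_eq_abs, abs_le]
        have := hp i hi
        constructor <;> linarith
    have hz : |L.symm q w| ≤ B := by
      have h1 : ‖L.symm q‖ ≤ ‖(L.symm : (InfinitePlace K → ℝ) →L[ℝ] realSpace K)‖ * ‖q‖ :=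
        (L.symm : (InfinitePlace K → ℝ) →L[ℝ] realSpace K).le_opNorm q
      have h2 := norm_le_pi_norm (L.symm q) w
      rw [Real.norm_eq_abs] at h2
      nlinarith [norm_nonneg (L.symm : (InfinitePlace K → ℝ) →L[ℝ] realSpace K)]
    have hz' : |(w.mult : ℝ)⁻¹ * L.symm q w| ≤ B := by
      rw [abs_mul, abs_of_nonneg (by positivity)]
      exact (mul_le_of_le_one_left (abs_nonneg _) (inv_le_one_of_one_le₀ (hmult w))).trans hz
    obtain ⟨hz1, hz2⟩ := abs_le.mp hz'
    have e : normAtPlace w x = Real.exp (p w₀) * Real.exp ((w.mult : ℝ)⁻¹ * L.symm q w) := by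
      rw [ha w, expMapBasis_apply'' p]
      rfl
    rw [e]
    constructor
    · exact mul_le_mul_of_nonneg_left (Real.exp_le_exp.mpr hz1) (Real.exp_pos _).le
    · exact mul_le_mul_of_nonneg_left (Real.exp_le_exp.mpr hz2) (Real.exp_pos _).le
  have hxle : ‖x‖ ≤ Real.exp (p w₀) * Real.exp B := by
    rw [norm_eq_sup'_normAtPlace]
    exact Finset.sup'_le _ _ fun w _ => (hbd w).2
  have hage : ∀ w, θ ≤ normAtPlace w x := by
    intro w
    refine le_trans ?_ (hbd w).1
    have h1 : Real.exp (2 * B) * θ ≤ Real.exp (p w₀) * Real.exp B := by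
      refine le_trans ?_ (hxn.trans hxle)
      have : 0 ≤ B' := norm_nonneg _
      nlinarith
    have h2 : Real.exp (2 * B) * Real.exp (-B) * Real.exp (-B) = 1 := by
      rw [← Real.exp_add, ← Real.exp_add, ← Real.exp_zero]; congr 1; ring
    have h3 : Real.exp B * Real.exp (-B) = 1 := by
      rw [← Real.exp_add, ← Real.exp_zero]; congr 1; ring
    have h4 := mul_le_mul_of_nonneg_right h1 (mul_pos (Real.exp_pos (-B)) (Real.exp_pos (-B))).le
    calc θ = Real.exp (2 * B) * θ * (Real.exp (-B) * Real.exp (-B)) := by linear_combination -θ * h2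
      _ ≤ _ := h4
      _ = _ := by linear_combination (Real.exp (p w₀) * Real.exp (-B)) * h3
  have hdiff : ∀ w, |normAtPlace w y - normAtPlace w x| ≤ θ * normAtPlace w x := fun w => by
    refine (abs_normAtPlace_sub_le K x y w).trans (hyx.trans ?_)
    nlinarith [hage w]
  have hypos : ∀ w, 0 < normAtPlace w y := fun w => by
    have := (abs_le.mp (hdiff w)).1
    nlinarith [hage w]
  set z' : realSpace K := fun w => w.mult * Real.log (normAtPlace w y) with hz'
  refine ⟨L z', ?_, fun w => ?_⟩
  · funext w
    have : expMapBasis (L z') w = Real.exp ((w.mult : ℝ)⁻¹ * L.symm (L z') w) := rfl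
    rw [this, ContinuousLinearEquiv.symm_apply_apply, hz']
    simp only
    rw [inv_mul_cancel_left₀ mult_coe_ne_zero, Real.exp_log (hypos w)]
  · have hpz : p = L (L.symm p) := (L.apply_symm_apply p).symm
    have h1 : ‖L z' - p‖ ≤ B' * ‖z' - L.symm p‖ := by
      conv_lhs => rw [hpz, ← map_sub]
      exact (L : realSpace K →L[ℝ] (InfinitePlace K → ℝ)).le_opNorm _
    have h2 : ‖z' - L.symm p‖ ≤ 4 * θ := by
      refine (pi_norm_le_iff_of_nonneg (by positivity)).mpr fun v => ?_
      have h3 : L.symm p v = v.mult * Real.log (normAtPlace v x) := by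
        have : expMapBasis p v = Real.exp ((v.mult : ℝ)⁻¹ * L.symm p v) := rfl
        rw [ha v, this, Real.log_exp, mul_inv_cancel_left₀ mult_coe_ne_zero]
      rw [Pi.sub_apply, h3, hz', ← mul_sub, Real.norm_eq_abs, abs_mul, abs_of_nonneg (by positivity)]
      have h4 := abs_log_sub_log_le hθ (hθ0.trans_le (hage v)) (hypos v) (hdiff v)
      calc _ ≤ 2 * (2 * θ) := mul_le_mul (hmult2 v) h4 (abs_nonneg _) (by norm_num)
        _ = _ := by ring
    have h5 := norm_le_pi_norm (L z' - p) w
    rw [Real.norm_eq_abs, Pi.sub_apply] at h5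
    have h6 : 0 ≤ B' := norm_nonneg _
    have := mul_le_mul_of_nonneg_left h2 h6
    nlinarith [Real.exp_pos (2 * B)]

end LatticePoints

section Lattice

open MeasureTheory

/-- Comparison of the number of lattice points in a bounded set with volumes. -/
lemma exists_card_inter_span_bounds {E : Type*} [NormedAddCommGroup E] [NormedSpace ℝ E]
    [FiniteDimensional ℝ E] [MeasurableSpace E] [BorelSpace E] (μ : Measure E)
    [μ.IsAddHaarMeasure] {ι : Type*} [Finite ι] (b : Module.Basis ι ℝ E) :
    ∃ ρ v : ℝ, 0 < ρ ∧ 0 < v ∧ ∀ S : Set E, Bornology.IsBounded S →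
      (∀ U : Set E, μ U ≠ ⊤ → (∀ x ∈ S, ∀ y, ‖y - x‖ ≤ ρ → y ∈ U) →
        ((S ∩ Submodule.span ℤ (Set.range b)).ncard : ℝ) * v ≤ μ.real U) ∧
      (∀ U : Set E, (∀ y ∈ U, ∀ x, ‖x - y‖ ≤ ρ → x ∈ S) →
        μ.real U ≤ ((S ∩ Submodule.span ℤ (Set.range b)).ncard : ℝ) * v) := by
  have := Fintype.ofFinite ι
  set F := ZSpan.fundamentalDomain b
  have hFb := ZSpan.fundamentalDomain_isBounded b
  have hFm : MeasurableSet F := ZSpan.fundamentalDomain_measurableSet b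
  obtain ⟨ρ, hρ0, hρ⟩ := hFb.exists_pos_norm_le
  have hFfin : μ F ≠ ⊤ := hFb.measure_lt_top.ne
  have hv : 0 < μ.real F := ENNReal.toReal_pos (ZSpan.measure_fundamentalDomain_ne_zero b) hFfin
  refine ⟨ρ, μ.real F, hρ0, hv, fun S hS => ?_⟩
  have hfin : (S ∩ Submodule.span ℤ (Set.range b)).Finite := ZSpan.setFinite_inter b hS
  set A := hfin.toFinset with hA
  have hcard : (S ∩ Submodule.span ℤ (Set.range b)).ncard = A.card :=
    Set.ncard_eq_toFinset_card _ hfin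
  have htr : ∀ l : E, μ ((fun x => l + x) '' F) = μ F := fun l => by
    rw [Set.image_add_left, measure_preimage_add]
  have htm : ∀ l : E, MeasurableSet ((fun x => l + x) '' F) := fun l => by
    rw [Set.image_add_left]
    exact hFm.preimage (measurable_const_add _)
  have hsum : μ (⋃ l ∈ A, (fun x => l + x) '' F) = A.card * μ F := by
    rw [measure_biUnion_finset]
    · simp
    · intro l hl l' hl' hne
      rw [Function.onFun, Set.disjoint_left]
      rintro _ ⟨x, hx, rfl⟩ ⟨x', hx', he⟩
      apply hne
      have hl1 : l ∈ Submodule.span ℤ (Set.range b) := (hfin.mem_toFinset.mp hl).2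
      have hl1' : l' ∈ Submodule.span ℤ (Set.range b) := (hfin.mem_toFinset.mp hl').2
      have h1 := ZSpan.fract_zSpan_add b x hl1
      have h2 := ZSpan.fract_zSpan_add b x' hl1'
      rw [ZSpan.fract_eq_self.mpr hx] at h1
      rw [ZSpan.fract_eq_self.mpr hx'] at h2
      simp only at he
      rw [he, h1] at h2
      rw [h2] at he
      exact (add_right_cancel he).symm
    · exact fun l _ => htm l
  constructor
  · intro U hU hSU
    have hsub : (⋃ l ∈ A, (fun x => l + x) '' F) ⊆ U := by
      refine Set.iUnion₂_subset fun l hl => ?_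
      rintro _ ⟨x, hx, rfl⟩
      refine hSU l (hfin.mem_toFinset.mp hl).1 _ ?_
      rw [add_sub_cancel_left]
      exact hρ x hx
    have h1 := ENNReal.toReal_mono hU (measure_mono (μ := μ) hsub)
    rw [hsum, ENNReal.toReal_mul, ENNReal.toReal_natCast] at h1
    rw [hcard]
    exact h1
  · intro U hUS
    have hsub : U ⊆ (⋃ l ∈ A, (fun x => l + x) '' F) := by
      intro y hy
      have hl := (ZSpan.floor b y).2
      have hf := ZSpan.fract_mem_fundamentalDomain b y
      have hs : ((ZSpan.floor b y : E)) ∈ S := by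
        refine hUS y hy _ ?_
        rw [norm_sub_rev]
        exact hρ _ hf
      refine Set.mem_iUnion₂.mpr ⟨ZSpan.floor b y, hfin.mem_toFinset.mpr ⟨hs, hl⟩,
        ZSpan.fract b y, hf, ?_⟩
      simp [ZSpan.fract_apply]
    have hne : μ (⋃ l ∈ A, (fun x => l + x) '' F) ≠ ⊤ := by
      rw [hsum]
      exact ENNReal.mul_ne_top (ENNReal.natCast_ne_top _) hFfin
    have h1 := ENNReal.toReal_mono hne (measure_mono (μ := μ) hsub)
    rw [hsum, ENNReal.toReal_mul, ENNReal.toReal_natCast] at h1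
    rw [hcard]
    exact h1

end Lattice

section LatticePoints

open NumberField.mixedEmbedding NumberField.mixedEmbedding.fundamentalCone
  NumberField.InfinitePlace NumberField.Units NumberField.Units.dirichletUnitTheorem
  MeasureTheory ENNReal

variable (K : Type*) [Field K] [NumberField K]

open scoped Classical in
lemma exists_normLeOne_sandwich : ∃ C : ℝ, 1 ≤ C ∧ ∀ θ : ℝ, 0 < θ → θ ≤ 1 / 2 →
    ∀ (x y : mixedSpace K), ‖y - x‖ ≤ θ ^ 2 →
      (x ∈ normLeOne K → y ∈ coneBox K (C * θ) (-(C * θ)) (1 + C * θ) ∪ Metric.ball 0 (C * θ)) ∧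
      (x ∈ coneBox K (-(C * θ)) (C * θ) (1 - C * θ) → y ∉ normLeOne K →
        x ∈ Metric.ball 0 (C * θ)) := by
  obtain ⟨C, hC1, hC⟩ := exists_expMapBasis_near K
  refine ⟨C + 1, by linarith, fun θ hθ0 hθ x y hxy => ⟨fun hx => ?_, fun hx hy => ?_⟩⟩
  · rw [← coneBox_zero_zero_one] at hx
    obtain ⟨p, hp, hxp⟩ := hx
    rcases lt_or_ge ‖x‖ (C * θ) with h | h
    · right
      rw [mem_ball_zero_iff]
      have := norm_add_le (y - x) x
      rw [sub_add_cancel] at this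
      nlinarith
    · left
      have hp0 : p w₀ ≤ 0 := by simpa using hp w₀ trivial
      have hp1 : ∀ w ≠ w₀, 0 ≤ p w ∧ p w < 1 := fun w hw => by
        simpa [hw] using hp w trivial
      obtain ⟨p', h1, h2⟩ := hC θ hθ0 hθ x y p hxp.symm
        (fun w hw => ⟨by linarith [(hp1 w hw).1], by linarith [(hp1 w hw).2]⟩) h hxy
      refine ⟨p', fun w _ => ?_, h1.symm⟩
      have h3 := abs_le.mp (h2 w)
      by_cases hw : w = w₀
      · subst hw
        simp only [if_true, Set.mem_Iic]
        nlinarith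
      · simp only [hw, if_false, Set.mem_Ico]
        have := hp1 w hw
        constructor <;> nlinarith
  · obtain ⟨p, hp, hxp⟩ := hx
    rw [mem_ball_zero_iff]
    by_contra hb
    push Not at hb
    apply hy
    have hp0 : p w₀ ≤ -((C + 1) * θ) := by simpa using hp w₀ trivial
    have hp1 : ∀ w ≠ w₀, (C + 1) * θ ≤ p w ∧ p w < 1 - (C + 1) * θ := fun w hw => by
      simpa [hw] using hp w trivial
    have hCθ : 0 < (C + 1) * θ := by positivity
    obtain ⟨p', h1, h2⟩ := hC θ hθ0 hθ x y p hxp.symm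
      (fun w hw => ⟨by linarith [(hp1 w hw).1], by linarith [(hp1 w hw).2]⟩) (by nlinarith) hxy
    rw [← coneBox_zero_zero_one]
    refine ⟨p', fun w _ => ?_, h1.symm⟩
    have h3 := abs_le.mp (h2 w)
    by_cases hw : w = w₀
    · subst hw
      simp only [if_true, Set.mem_Iic]
      nlinarith
    · simp only [hw, if_false, Set.mem_Ico]
      have := hp1 w hw
      constructor <;> nlinarith


open scoped Classical in
lemma exists_volume_coneBox_bounds (C : ℝ) (hC : 1 ≤ C) : ∃ D θ₀ : ℝ, 0 < D ∧ 0 < θ₀ ∧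
    ∀ θ : ℝ, 0 < θ → θ ≤ θ₀ →
      volume (coneBox K (C * θ) (-(C * θ)) (1 + C * θ) ∪ Metric.ball 0 (C * θ)) ≠ ⊤ ∧
      volume.real (coneBox K (C * θ) (-(C * θ)) (1 + C * θ) ∪ Metric.ball 0 (C * θ)) ≤
        volume.real (normLeOne K) + D * θ ∧
      volume.real (normLeOne K) - D * θ ≤
        volume.real (coneBox K (-(C * θ)) (C * θ) (1 - C * θ) \ Metric.ball 0 (C * θ)) := by
  obtain ⟨m, hm⟩ := exists_volume_coneBox K
  set n := Module.finrank ℚ K with hn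
  set V := volume.real (normLeOne K) with hV
  have hVt : volume (normLeOne K) ≠ ⊤ := (isBounded_normLeOne K).measure_lt_top.ne
  set W := volume.real (Metric.ball (0 : mixedSpace K) 1) with hW
  have hn1 : 1 ≤ n := Module.finrank_pos
  let f : ℝ → ℝ := fun θ => Real.exp (C * θ * n) * (1 + 2 * (C * θ)) ^ m
  have hf : DifferentiableAt ℝ f 0 := by fun_prop
  obtain ⟨M, hM⟩ := hf.isBigO_sub.bound
  obtain ⟨ε, hε, hεM⟩ := Metric.eventually_nhds_iff.mp hM
  have hf0 : f 0 = 1 := by simp [f]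
  have hfb : ∀ θ, |θ| < ε → |f θ - 1| ≤ M * |θ| := fun θ hθ => by
    have := @hεM θ (by simpa using hθ)
    simpa [hf0] using this
  have hvol : ∀ θ : ℝ, -(1 / 2) ≤ C * θ → volume (coneBox K (C * θ) (-(C * θ)) (1 + C * θ)) =
      volume (normLeOne K) * .ofReal (f θ) := fun θ hθ => by
    rw [hm _ _ _ (by linarith)]
    congr 3
    ring
  have hf_nonneg : ∀ θ : ℝ, -(1 / 2) ≤ C * θ → 0 ≤ f θ := fun θ hθ => by
    have : 0 ≤ 1 + 2 * (C * θ) := by linarith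
    positivity
  have hvolr : ∀ θ : ℝ, -(1 / 2) ≤ C * θ →
      volume.real (coneBox K (C * θ) (-(C * θ)) (1 + C * θ)) = V * f θ := fun θ hθ => by
    rw [measureReal_def, hvol θ hθ, ENNReal.toReal_mul, ENNReal.toReal_ofReal (hf_nonneg θ hθ)]
    rfl
  have hball : ∀ θ : ℝ, 0 < θ → C * θ ≤ 1 →
      volume.real (Metric.ball (0 : mixedSpace K) (C * θ)) ≤ C * W * θ := fun θ hθ h1 => by
    have hCθ : 0 ≤ C * θ := by positivity
    rw [measureReal_def, Measure.addHaar_ball _ _ hCθ, ENNReal.toReal_mul,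
      ENNReal.toReal_ofReal (by positivity), mixedEmbedding.finrank]
    have : (C * θ) ^ n ≤ (C * θ) ^ 1 := pow_le_pow_of_le_one hCθ h1 hn1
    rw [pow_one] at this
    calc (C * θ) ^ n * W ≤ (C * θ) * W := mul_le_mul_of_nonneg_right this measureReal_nonneg
      _ = _ := by ring
  have hM0 : 0 ≤ M := by
    have := hfb (ε / 2) (by rw [abs_of_pos (by positivity)]; linarith)
    by_contra hc
    have h2 : 0 < |ε / 2| := by positivity
    nlinarith [abs_nonneg (f (ε / 2) - 1)]
  have hV0 : 0 ≤ V := measureReal_nonneg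
  have hW0 : 0 ≤ W := measureReal_nonneg
  refine ⟨V * M + C * W + 1, min (ε / 2) (1 / (2 * C)), by positivity, by positivity,
    fun θ hθ0 hθ => ?_⟩
  have h1 : |θ| < ε := by
    rw [abs_of_pos hθ0]
    linarith [hθ.trans (min_le_left _ _)]
  have h2 : C * θ ≤ 1 / 2 := by
    have := hθ.trans (min_le_right _ _)
    rw [le_div_iff₀ (by positivity)] at this
    linarith
  have hCθ : 0 ≤ C * θ := by positivity
  have hbl : volume (Metric.ball (0 : mixedSpace K) (C * θ)) ≠ ⊤ := measure_ball_lt_top.ne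
  have hb := hball θ hθ0 (by linarith)
  have hcl := hvol θ (by linarith)
  refine ⟨?_, ?_, ?_⟩
  · refine ((measure_union_le _ _).trans_lt (ENNReal.add_lt_top.mpr ⟨?_, hbl.lt_top⟩)).ne
    rw [hcl]
    exact ENNReal.mul_lt_top hVt.lt_top ENNReal.ofReal_lt_top
  · refine (measureReal_union_le _ _).trans ?_
    rw [hvolr θ (by linarith)]
    have h3 := (abs_le.mp (hfb θ h1)).2
    rw [abs_of_pos hθ0] at h3
    nlinarith
  · have h4 := le_measureReal_sdiff (μ := volume) (s₁ := coneBox K (C * -θ) (-(C * -θ)) (1 + C * -θ))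
      (s₂ := Metric.ball (0 : mixedSpace K) (C * θ)) (h := hbl)
    rw [hvolr (-θ) (by linarith)] at h4
    have e : coneBox K (C * -θ) (-(C * -θ)) (1 + C * -θ) =
      coneBox K (-(C * θ)) (C * θ) (1 - C * θ) := by
      congr 1 <;> ring
    rw [e] at h4
    have h3 := (abs_le.mp (hfb (-θ) (by rwa [abs_neg]))).1
    rw [abs_neg, abs_of_pos hθ0] at h3
    nlinarith

open scoped Classical in
lemma exists_card_smul_normLeOne_inter_idealLattice
    (I : (FractionalIdeal (nonZeroDivisors (𝓞 K)) K)ˣ) :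
    ∃ κ D T₀ : ℝ, ∀ T, T₀ ≤ T → 0 < T ∧
      |((({x : mixedSpace K | T⁻¹ • x ∈ normLeOne K} ∩ idealLattice K I).ncard : ℝ) -
        κ * T ^ Module.finrank ℚ K)| ≤ D * T ^ Module.finrank ℚ K / Real.sqrt T := by
  obtain ⟨C, hC1, hC⟩ := exists_normLeOne_sandwich K
  obtain ⟨D, θ₀, hD0, hθ₀, hvol⟩ := exists_volume_coneBox_bounds K C hC1
  obtain ⟨ρ, v, hρ, hv, hcount⟩ := exists_card_inter_span_bounds
    (volume : Measure (mixedSpace K)) (fractionalIdealLatticeBasis K I)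
  set n := Module.finrank ℚ K with hn
  set θ₁ := min θ₀ (1 / 2) with hθ₁
  have hθ₁0 : 0 < θ₁ := by positivity
  refine ⟨volume.real (normLeOne K) / v, D * Real.sqrt ρ / v, ρ / θ₁ ^ 2, fun T hT => ?_⟩
  have hT0 : 0 < T := lt_of_lt_of_le (by positivity) hT
  refine ⟨hT0, ?_⟩
  set θ := Real.sqrt (ρ / T) with hθ
  have hθ0 : 0 < θ := Real.sqrt_pos.mpr (by positivity)
  have hθ2 : θ ^ 2 = ρ / T := Real.sq_sqrt (by positivity)
  have hθle : θ ≤ θ₁ := by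
    rw [hθ, Real.sqrt_le_left hθ₁0.le, div_le_iff₀ hT0]
    rw [div_le_iff₀ (by positivity)] at hT
    linarith
  obtain ⟨hUt, hU, hL⟩ := hvol θ hθ0 (hθle.trans (min_le_left _ _))
  have hSb : Bornology.IsBounded {x : mixedSpace K | T⁻¹ • x ∈ normLeOne K} := by
    have := (isBounded_normLeOne K).smul₀ T
    refine this.subset fun x hx => ⟨T⁻¹ • x, hx, ?_⟩
    simp [smul_smul, hT0.ne']
  obtain ⟨hc1, hc2⟩ := hcount _ hSb
  rw [span_idealLatticeBasis] at hc1 hc2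
  have hpre : ∀ A : Set (mixedSpace K), volume ((fun x => T⁻¹ • x) ⁻¹' A) =
      .ofReal (T ^ n) * volume A := fun A => by
    rw [Measure.addHaar_preimage_smul _ (inv_ne_zero hT0.ne'), mixedEmbedding.finrank, inv_pow,
      inv_inv, abs_of_pos (by positivity)]
  have hprer : ∀ A : Set (mixedSpace K), volume.real ((fun x => T⁻¹ • x) ⁻¹' A) =
      T ^ n * volume.real A := fun A => by
    rw [measureReal_def, hpre, ENNReal.toReal_mul, ENNReal.toReal_ofReal (by positivity)]
    rfl
  have hscale : ∀ x y : mixedSpace K, ‖y - x‖ ≤ ρ → ‖T⁻¹ • y - T⁻¹ • x‖ ≤ θ ^ 2 := by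
    intro x y h
    rw [← smul_sub, _root_.norm_smul, hθ2, norm_inv, Real.norm_eq_abs, abs_of_pos hT0, inv_mul_eq_div]
    gcongr
  have h12 : θ ≤ 1 / 2 := hθle.trans (min_le_right _ _)
  have b1 := hc1 ((fun x => T⁻¹ • x) ⁻¹' (coneBox K (C * θ) (-(C * θ)) (1 + C * θ) ∪
      Metric.ball 0 (C * θ))) (by
      rw [hpre]
      exact ENNReal.mul_ne_top ENNReal.ofReal_ne_top hUt)
    (fun x hx y hy => (hC θ hθ0 h12 _ _ (hscale x y hy)).1 hx)
  have b2 := hc2 ((fun x => T⁻¹ • x) ⁻¹' (coneBox K (-(C * θ)) (C * θ) (1 - C * θ) \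
      Metric.ball 0 (C * θ))) (fun y hy x hx => by
    by_contra hne
    exact hy.2 ((hC θ hθ0 h12 _ _ (hscale y x hx)).2 hy.1 hne))
  rw [hprer] at b1 b2
  set N := ((({x : mixedSpace K | T⁻¹ • x ∈ normLeOne K} ∩ idealLattice K I).ncard : ℝ)) with hN
  have hTn : 0 < T ^ n := by positivity
  have e1 := mul_le_mul_of_nonneg_left hU hTn.le
  have e2 := mul_le_mul_of_nonneg_left hL hTn.le
  have hsq : D * Real.sqrt ρ / v * T ^ n / Real.sqrt T = T ^ n * (D * θ) / v := by
    rw [hθ, Real.sqrt_div hρ.le]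
    have := Real.sqrt_pos.mpr hT0
    field_simp
  rw [hsq, div_mul_eq_mul_div, ← mul_le_mul_iff_of_pos_right hv, div_mul_cancel₀ _ hv.ne',
    ← abs_of_pos hv, ← abs_mul, abs_of_pos hv, sub_mul, div_mul_cancel₀ _ hv.ne', abs_le]
  constructor <;> linarith

end LatticePoints

section IdealCount

open NumberField.mixedEmbedding NumberField.mixedEmbedding.fundamentalCone
  NumberField.InfinitePlace NumberField.Units Ideal Submodule
open scoped nonZeroDivisors

variable (K : Type*) [Field K] [NumberField K]

lemma card_class_norm_le_eq {C : ClassGroup (𝓞 K)} {J : (Ideal (𝓞 K))⁰} {s : ℝ}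
    (hJ : ClassGroup.mk0 J = C⁻¹) :
    Nat.card {I : (Ideal (𝓞 K))⁰ // absNorm (I : Ideal (𝓞 K)) ≤ s ∧ ClassGroup.mk0 I = C}
      = Nat.card {I : (Ideal (𝓞 K))⁰ // (J : Ideal (𝓞 K)) ∣ I ∧ IsPrincipal (I : Ideal (𝓞 K)) ∧
        absNorm (I : Ideal (𝓞 K)) ≤ s * absNorm (J : Ideal (𝓞 K))} := by
  simp_rw [← nonZeroDivisors_dvd_iff_dvd_coe]
  refine Nat.card_congr ?_
  refine ((Equiv.dvd J).subtypeEquiv fun I ↦ ?_).trans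
    (Equiv.subtypeSubtypeEquivSubtypeInter (fun I : (Ideal (𝓞 K))⁰ ↦ J ∣ I) _)
  rw [← ClassGroup.mk0_eq_one_iff (SetLike.coe_mem _)]
  simp_rw [Equiv.dvd_apply, Submonoid.coe_mul, ← Submonoid.mul_def, _root_.map_mul, hJ,
    inv_mul_eq_one, Nat.cast_mul, mul_comm s, eq_comm, and_comm, and_congr_left_iff]
  exact fun _ ↦
    (mul_le_mul_iff_of_pos_left (Nat.cast_pos.mpr (absNorm_pos_of_nonZeroDivisors J))).symm

lemma card_idealSet_norm_le_eq (J : (Ideal (𝓞 K))⁰) {s T : ℝ} (hT : 0 < T)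
    (hs : T ^ Module.finrank ℚ K = s) :
    Nat.card {a : idealSet K J // mixedEmbedding.norm (a : mixedSpace K) ≤ s} =
      ({x : mixedSpace K | T⁻¹ • x ∈ normLeOne K} ∩
        idealLattice K (FractionalIdeal.mk0 K J)).ncard := by
  rw [← Nat.card_coe_set_eq]
  refine Nat.card_congr ((Equiv.subtypeSubtypeEquivSubtypeInter (· ∈ idealSet K J)
    (mixedEmbedding.norm · ≤ s)).trans (Equiv.subtypeEquivProp ?_))
  ext x
  have h1 : T⁻¹ • x ∈ normLeOne K ↔ x ∈ fundamentalCone K ∧ mixedEmbedding.norm x ≤ s := by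
    rw [normLeOne, Set.mem_inter_iff, Set.mem_ofPred_eq, smul_mem_iff_mem (inv_ne_zero hT.ne'),
      mixedEmbedding.norm_smul, abs_of_pos (inv_pos.mpr hT), inv_pow, hs,
      inv_mul_le_iff₀ (by rw [← hs]; positivity), mul_one]
  rw [Set.mem_inter_iff, Set.mem_ofPred_eq, h1, mem_idealSet, SetLike.mem_coe, mem_idealLattice,
    FractionalIdeal.coe_mk0]
  constructor
  · rintro ⟨⟨hx, a, ha, rfl⟩, hn⟩
    exact ⟨⟨hx, hn⟩, (a : K), ⟨a, ha, rfl⟩, rfl⟩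
  · rintro ⟨⟨hx, hn⟩, _, ⟨a, ha, rfl⟩, rfl⟩
    exact ⟨⟨hx, a, ha, rfl⟩, hn⟩

lemma exists_card_class_norm_le (C : ClassGroup (𝓞 K)) :
    ∃ κ D s₀ : ℝ, ∀ s : ℝ, s₀ ≤ s →
      |(Nat.card {I : (Ideal (𝓞 K))⁰ // absNorm (I : Ideal (𝓞 K)) ≤ s ∧ ClassGroup.mk0 I = C} : ℝ)
        - κ * s| ≤ D * s ^ (1 - 1 / (2 * Module.finrank ℚ K : ℝ)) := by
  obtain ⟨J, hJ⟩ := ClassGroup.mk0_surjective C⁻¹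
  obtain ⟨κ, D, T₀, h⟩ := exists_card_smul_normLeOne_inter_idealLattice K (FractionalIdeal.mk0 K J)
  set n := Module.finrank ℚ K with hn
  have hn0 : n ≠ 0 := Module.finrank_pos.ne'
  have hnr : (0 : ℝ) < n := by positivity
  have hNJ : (0 : ℝ) < absNorm (J : Ideal (𝓞 K)) := by
    exact_mod_cast absNorm_pos_of_nonZeroDivisors J
  set q : ℝ := ((absNorm (J : Ideal (𝓞 K)) : ℕ) : ℝ) with hq
  have hw : (0 : ℝ) < torsionOrder K := by
    exact_mod_cast Nat.pos_of_ne_zero (torsionOrder_ne_zero K)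
  set w : ℝ := (torsionOrder K : ℝ)
  set e : ℝ := 1 - 1 / (2 * n : ℝ) with he
  refine ⟨κ * q / w, D * q ^ e / w, max 1 (max T₀ 1 ^ n / q), fun s hs => ?_⟩
  have hs1 : 1 ≤ s := (le_max_left _ _).trans hs
  have hs0 : 0 < s := by linarith
  have hs2 : max T₀ 1 ^ n ≤ s * q := by
    have := (le_max_right _ _).trans hs
    rwa [div_le_iff₀ hNJ] at this
  set T := (s * q) ^ (1 / n : ℝ) with hT
  have hTn : T ^ n = s * q := by
    rw [hT, ← Real.rpow_natCast, ← Real.rpow_mul (by positivity), one_div_mul_cancel hnr.ne',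
      Real.rpow_one]
  have hT1 : max T₀ 1 ≤ T := by
    rw [← hTn] at hs2
    exact le_of_pow_le_pow_left₀ hn0 (by positivity) hs2
  obtain ⟨hT0, hb⟩ := h T ((le_max_left _ _).trans hT1)
  have hsq : T ^ n / Real.sqrt T = s ^ e * q ^ e := by
    rw [← Real.mul_rpow hs0.le hNJ.le, hTn, Real.sqrt_eq_rpow, hT, ← Real.rpow_mul (by positivity),
      he, Real.rpow_sub (by positivity), Real.rpow_one]
    congr 2
    field_simp
  rw [mul_div_assoc, hsq, hTn, ← card_idealSet_norm_le_eq K J hT0 hTn,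
    ← card_isPrincipal_dvd_norm_le, ← card_class_norm_le_eq K hJ, Nat.cast_mul] at hb
  set N : ℝ := (Nat.card
    {I : (Ideal (𝓞 K))⁰ // absNorm (I : Ideal (𝓞 K)) ≤ s ∧ ClassGroup.mk0 I = C} : ℝ)
  have e1 : N - κ * q / w * s = (N * w - κ * (s * q)) / w := by
    field_simp
  rw [e1, abs_div, abs_of_pos hw, div_le_iff₀ hw]
  refine hb.trans (le_of_eq ?_)
  field_simp

lemma finite_norm_le (s : ℝ) : Finite {I : (Ideal (𝓞 K))⁰ // absNorm (I : Ideal (𝓞 K)) ≤ s} := by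
  rcases lt_or_ge s 0 with hs | hs
  · refine @Finite.of_subsingleton _ ⟨fun a => ?_⟩
    have := a.2
    have h0 : (0 : ℝ) ≤ absNorm (a.1 : Ideal (𝓞 K)) := Nat.cast_nonneg _
    linarith
  · simp_rw [← Nat.le_floor_iff hs]
    exact finite_setOfPred_absNorm_le₀ ⌊s⌋₊

/-- The number of nonzero ideals of norm at most `s`, with a power-saving error term. -/
theorem exists_card_norm_le : ∃ κ D δ : ℝ, 0 < κ ∧ 0 ≤ D ∧ 0 < δ ∧ δ < 1 ∧ ∀ s : ℝ, 1 ≤ s →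
    |(Nat.card {I : (Ideal (𝓞 K))⁰ // absNorm (I : Ideal (𝓞 K)) ≤ s} : ℝ) - κ * s| ≤
      D * s ^ (1 - δ) := by
  classical
  choose κ D s₀ h using exists_card_class_norm_le K
  have hn : (1 : ℝ) ≤ Module.finrank ℚ K := by
    exact_mod_cast (Module.finrank_pos : 0 < Module.finrank ℚ K)
  set δ : ℝ := 1 / (2 * Module.finrank ℚ K : ℝ) with hδ
  have hδ0 : 0 < δ := by positivity
  have hδ1 : δ < 1 := by
    rw [hδ, div_lt_one (by positivity)]
    linarith
  set N : ℝ → ℝ := fun s =>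
    (Nat.card {I : (Ideal (𝓞 K))⁰ // absNorm (I : Ideal (𝓞 K)) ≤ s} : ℝ) with hN
  have hsum : ∀ s, N s = ∑ C : ClassGroup (𝓞 K), (Nat.card {I : (Ideal (𝓞 K))⁰ //
      absNorm (I : Ideal (𝓞 K)) ≤ s ∧ ClassGroup.mk0 I = C} : ℝ) := by
    intro s
    have : Finite {I : (Ideal (𝓞 K))⁰ // absNorm (I : Ideal (𝓞 K)) ≤ s} := finite_norm_le K s
    have : Fintype {I : (Ideal (𝓞 K))⁰ // absNorm (I : Ideal (𝓞 K)) ≤ s} := Fintype.ofFinite _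
    let e := fun C : ClassGroup (𝓞 K) ↦ Equiv.subtypeSubtypeEquivSubtypeInter
      (fun I : (Ideal (𝓞 K))⁰ ↦ (absNorm I.1 : ℝ) ≤ s) (fun I ↦ ClassGroup.mk0 I = C)
    simp_rw [hN, ← Nat.card_congr (e _), Nat.card_eq_fintype_card, Fintype.subtype_card]
    rw [Fintype.card, Finset.card_eq_sum_card_fiberwise (f := fun I ↦ ClassGroup.mk0 I.1)
      (t := Finset.univ) (fun _ _ ↦ Finset.mem_univ _), Nat.cast_sum]
  set κ' := ∑ C, κ C
  set D' := ∑ C, D C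
  obtain ⟨s₁, hs₁⟩ := (Set.finite_range s₀).bddAbove
  have hbig : ∀ s, s₁ ≤ s → |N s - κ' * s| ≤ D' * s ^ (1 - δ) := by
    intro s hs
    rw [hsum, Finset.sum_mul, ← Finset.sum_sub_distrib, Finset.sum_mul]
    exact (Finset.abs_sum_le_sum_abs _ _).trans (Finset.sum_le_sum fun C _ =>
      h C s ((hs₁ ⟨C, rfl⟩).trans hs))
  have hlim : Tendsto (fun s : ℝ => N s / s) atTop (𝓝 κ') := by
    rw [← tendsto_sub_nhds_zero_iff]
    have h0 : Tendsto (fun s : ℝ => D' * s ^ (-δ)) atTop (𝓝 0) := by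
      simpa using (tendsto_rpow_neg_atTop hδ0).const_mul D'
    refine squeeze_zero_norm' ?_ h0
    filter_upwards [eventually_ge_atTop s₁, eventually_gt_atTop 0] with s h1 h2
    have e1 : N s / s - κ' = (N s - κ' * s) / s := by field_simp
    rw [e1, Real.norm_eq_abs, abs_div, abs_of_pos h2, div_le_iff₀ h2]
    refine (hbig s h1).trans (le_of_eq ?_)
    rw [mul_assoc, ← Real.rpow_add_one h2.ne']
    congr 2
    ring
  have hκ : 0 < κ' := by
    rw [tendsto_nhds_unique hlim (NumberField.Ideal.tendsto_norm_le_div_atTop₀ K)]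
    have := regulator_pos K
    have h2 : 0 < torsionOrder K := Nat.pos_of_ne_zero (torsionOrder_ne_zero K)
    have h3 : (0 : ℝ) < |(discr K : ℝ)| := abs_pos.mpr (by exact_mod_cast discr_ne_zero K)
    have h4 : 0 < classNumber K := Nat.pos_of_ne_zero (classNumber_ne_zero K)
    positivity
  have hmono : Monotone N := by
    intro s t hst
    have := finite_norm_le K t
    simp only [hN]
    exact_mod_cast Nat.card_le_card_of_injective
      (fun I : {I : (Ideal (𝓞 K))⁰ // (absNorm (I : Ideal (𝓞 K)) : ℝ) ≤ s} =>
        (⟨I.1, I.2.trans hst⟩ : {I : (Ideal (𝓞 K))⁰ // (absNorm (I : Ideal (𝓞 K)) : ℝ) ≤ t}))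
      (fun a b hab => Subtype.ext (congrArg (fun x => x.1) hab))
  refine ⟨κ', |D'| + N (max s₁ 1) + κ' * max s₁ 1, δ, hκ, ?_, hδ0, hδ1, fun s hs => ?_⟩
  · have : 0 ≤ N (max s₁ 1) := Nat.cast_nonneg _
    positivity
  · have hN0 : ∀ t, 0 ≤ N t := fun t => Nat.cast_nonneg _
    have hp : 1 ≤ s ^ (1 - δ) := Real.one_le_rpow hs (by linarith)
    have hm : 0 ≤ κ' * max s₁ 1 := by positivity
    rcases le_total s₁ s with h1 | h1
    · refine (hbig s h1).trans (mul_le_mul_of_nonneg_right ?_ (by positivity))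
      linarith [le_abs_self D', hN0 (max s₁ 1)]
    · have h2 : s ≤ max s₁ 1 := h1.trans (le_max_left _ _)
      have h3 := hmono h2
      have h4 : κ' * s ≤ κ' * max s₁ 1 := by gcongr
      calc |N s - κ' * s| ≤ N (max s₁ 1) + κ' * max s₁ 1 := by
            rw [abs_le]
            have : 0 ≤ κ' * s := by positivity
            constructor <;> linarith [hN0 s]
        _ ≤ (|D'| + N (max s₁ 1) + κ' * max s₁ 1) * 1 := by linarith [abs_nonneg D']
        _ ≤ _ := mul_le_mul_of_nonneg_left hp (by linarith [abs_nonneg D', hN0 (max s₁ 1)])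

end IdealCount

section CountingFunction

open MeasureTheory

/-- The number of indices whose norm is at most `t`. -/
def normCount {ι : Type*} (N : ι → ℕ) (t : ℝ) : ℝ := Nat.card {i // (N i : ℝ) ≤ t}

variable {ι : Type*} {N : ι → ℕ}

lemma normCount_nonneg (t : ℝ) : 0 ≤ normCount N t := Nat.cast_nonneg _

lemma normCount_of_lt_one (hN : ∀ i, 1 ≤ N i) {t : ℝ} (ht : t < 1) : normCount N t = 0 := by
  have : IsEmpty {i // (N i : ℝ) ≤ t} := ⟨fun ⟨i, hi⟩ => by
    have : (1 : ℝ) ≤ N i := by exact_mod_cast hN i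
    linarith⟩
  simp [normCount]

lemma monotone_normCount (hfin : ∀ t : ℝ, Finite {i // (N i : ℝ) ≤ t}) :
    Monotone (normCount N) := by
  intro s t hst
  have := hfin t
  simp only [normCount]
  exact_mod_cast Nat.card_le_card_of_injective
    (fun I : {i // (N i : ℝ) ≤ s} => (⟨I.1, I.2.trans hst⟩ : {i // (N i : ℝ) ≤ t}))
    (fun a b hab => Subtype.ext (congrArg (fun x => x.1) hab))

lemma sum_Icc_card_fiber (hN : ∀ i, 1 ≤ N i) (hfin : ∀ t : ℝ, Finite {i // (N i : ℝ) ≤ t})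
    {t : ℝ} (ht : 0 ≤ t) :
    ∑ k ∈ Finset.Icc 1 ⌊t⌋₊, (Nat.card {i // N i = k} : ℝ) = normCount N t := by
  classical
  have := hfin t
  have : Fintype {i // (N i : ℝ) ≤ t} := Fintype.ofFinite _
  rw [normCount, Nat.card_eq_fintype_card, Fintype.card,
    Finset.card_eq_sum_card_fiberwise (f := fun I ↦ N I.1) (t := Finset.Icc 1 ⌊t⌋₊)
    (fun i _ ↦ by simpa using ⟨hN i.1, Nat.le_floor i.2⟩), Nat.cast_sum]
  refine Finset.sum_congr rfl fun k hk => ?_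
  have hk : (k : ℝ) ≤ t := (Nat.le_floor_iff ht).mp (Finset.mem_Icc.mp hk).2
  congr 1
  rw [← Fintype.card_subtype, ← Nat.card_eq_fintype_card]
  exact Nat.card_congr ((Equiv.subtypeSubtypeEquivSubtype (p := fun i => (N i : ℝ) ≤ t)
    (q := fun i => N i = k) fun {i} hi => by rw [hi]; exact hk).symm)

lemma isBigO_sum_card_fiber (hN : ∀ i, 1 ≤ N i) (hfin : ∀ t : ℝ, Finite {i // (N i : ℝ) ≤ t})
    {A : ℝ} (hA : ∀ t, 1 ≤ t → normCount N t ≤ A * t) :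
    (fun n : ℕ => ∑ k ∈ Finset.Icc 1 n, (Nat.card {i // N i = k} : ℝ)) =O[atTop]
      fun n => (n : ℝ) ^ (1 : ℝ) := by
  refine Asymptotics.IsBigO.of_bound A ?_
  filter_upwards [eventually_ge_atTop 1] with n hn
  have h := sum_Icc_card_fiber hN hfin (t := n) (Nat.cast_nonneg n)
  rw [Nat.floor_natCast] at h
  rw [h, Real.norm_of_nonneg (normCount_nonneg _), Real.rpow_one, Real.norm_of_nonneg (by positivity)]
  exact hA n (by exact_mod_cast hn)

lemma finite_fiber (hfin : ∀ t : ℝ, Finite {i // (N i : ℝ) ≤ t}) (n : ℕ) :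
    Finite {i // N i = n} := by
  have := hfin n
  exact Finite.of_injective (fun I : {i // N i = n} =>
    (⟨I.1, by rw [I.2]⟩ : {i // (N i : ℝ) ≤ (n : ℝ)}))
    (fun a b hab => Subtype.ext (congrArg (fun x => x.1) hab))

lemma summable_norm_rpow (hN : ∀ i, 1 ≤ N i) (hfin : ∀ t : ℝ, Finite {i // (N i : ℝ) ≤ t})
    {A : ℝ} (hA : ∀ t, 1 ≤ t → normCount N t ≤ A * t) {σ : ℝ} (hσ : 1 < σ) :
    Summable fun i => (N i : ℝ) ^ (-σ) := by
  have hS := LSeriesSummable_of_sum_norm_bigO_and_nonneg (s := (σ : ℂ))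
    (isBigO_sum_card_fiber hN hfin hA) (fun _ => Nat.cast_nonneg _) zero_le_one (by simpa using hσ)
  rw [← (Equiv.sigmaFiberEquiv N).summable_iff, summable_sigma_of_nonneg (fun _ => by
    simp only [Function.comp]; positivity)]
  have := fun n => finite_fiber hfin n
  refine ⟨fun n => Summable.of_finite, ?_⟩
  refine hS.norm.congr fun n => ?_
  rw [tsum_congr (g := fun _ => (n : ℝ) ^ (-σ)) (fun i => by simp [i.2]), tsum_const,
    LSeries.norm_term_eq]
  split_ifs with h
  · subst h
    have : IsEmpty {i // N i = 0} := ⟨fun ⟨i, hi⟩ => by have := hN i; omega⟩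
    simp
  · rw [Complex.norm_real, Real.norm_of_nonneg (Nat.cast_nonneg _), Complex.ofReal_re,
      Real.rpow_neg (by positivity), nsmul_eq_mul]
    rfl

lemma tsum_norm_cpow_eq (hN : ∀ i, 1 ≤ N i) (hfin : ∀ t : ℝ, Finite {i // (N i : ℝ) ≤ t})
    {A : ℝ} (hA : ∀ t, 1 ≤ t → normCount N t ≤ A * t) {s : ℂ} (hs : 1 < s.re) :
    ∑' i, (N i : ℂ) ^ (-s) = s * mellin (fun t => (normCount N t : ℂ)) (-s) := by
  have hL := LSeries_eq_mul_integral_of_nonneg (s := s) (fun n => (Nat.card {i // N i = n} : ℝ))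
    zero_le_one (by simpa using hs) (isBigO_sum_card_fiber hN hfin hA) (fun _ => Nat.cast_nonneg _)
  have hsum : Summable fun i => (N i : ℂ) ^ (-s) := by
    refine Summable.of_norm ((summable_norm_rpow hN hfin hA hs).congr fun i => ?_)
    rw [Complex.norm_natCast_cpow_of_pos (hN i), Complex.neg_re]
  have := fun n => finite_fiber hfin n
  have hsig := Summable.tsum_sigma'
    (fun n => Summable.of_finite) ((Equiv.sigmaFiberEquiv N).summable_iff.mpr hsum)
  simp only [Function.comp_apply] at hsig
  rw [← (Equiv.sigmaFiberEquiv N).tsum_eq, hsig]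
  have e1 : ∀ n : ℕ, ∑' c : {i // N i = n}, (N ((Equiv.sigmaFiberEquiv N) ⟨n, c⟩) : ℂ) ^ (-s) =
      LSeries.term (fun n => ((Nat.card {i // N i = n} : ℝ) : ℂ)) s n := fun n => by
    rw [tsum_congr (g := fun _ => (n : ℂ) ^ (-s)) (fun i => by simp [i.2]), tsum_const,
      LSeries.term_def]
    split_ifs with h
    · subst h
      have : IsEmpty {i // N i = 0} := ⟨fun ⟨i, hi⟩ => by have := hN i; omega⟩
      simp
    · rw [Complex.cpow_neg, nsmul_eq_mul, Complex.ofReal_natCast]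
      rfl
  rw [tsum_congr e1, ← LSeries, hL, mellin]
  congr 1
  have hsub : Set.Ioi (1 : ℝ) ⊆ Set.Ioi 0 := Set.Ioi_subset_Ioi zero_le_one
  refine Eq.trans ?_ (setIntegral_eq_of_subset_of_ae_sdiff_eq_zero
    measurableSet_Ioi.nullMeasurableSet hsub ?_).symm
  · refine setIntegral_congr_fun measurableSet_Ioi fun t ht => ?_
    have ht : (1 : ℝ) < t := ht
    rw [smul_eq_mul, mul_comm, neg_add, ← sub_eq_add_neg,
      ← sum_Icc_card_fiber hN hfin (t := t) (by linarith)]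
    push_cast
    rfl
  · have hne : ∀ᵐ t : ℝ, t ≠ 1 := by simp [ae_iff]
    filter_upwards [hne] with t ht1 ht
    have h1 : t < 1 := lt_of_le_of_ne (not_lt.mp ht.2) ht1
    simp [normCount_of_lt_one hN h1]

end CountingFunction

section MellinTail

open MeasureTheory

/-- A monotone-type function vanishing below one has a convergent Mellin transform,
differentiable in a half plane. -/
lemma mellin_neg_of_vanish {f : ℝ → ℝ} (hf : LocallyIntegrable f) (h0 : ∀ t < 1, f t = 0)
    {D β : ℝ} (hb : ∀ t, 1 ≤ t → |f t| ≤ D * t ^ β) {s : ℂ} (hs : β < s.re) :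
    MellinConvergent (fun t => (f t : ℂ)) (-s) ∧
    MellinConvergent (fun t => Real.log t • (f t : ℂ)) (-s) ∧
    HasDerivAt (mellin (fun t => (f t : ℂ))) (mellin (fun t => Real.log t • (f t : ℂ)) (-s)) (-s) := by
  have hfc : LocallyIntegrableOn (fun t => (f t : ℂ)) (Set.Ioi 0) := by
    refine LocallyIntegrable.locallyIntegrableOn ?_ _
    intro x
    obtain ⟨U, hU, hUi⟩ := hf x
    exact ⟨U, hU, hUi.ofReal⟩
  have htop : (fun t => (f t : ℂ)) =O[atTop] (· ^ (-(-β))) := by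
    refine Asymptotics.IsBigO.of_bound D ?_
    filter_upwards [eventually_ge_atTop 1] with t ht
    rw [Complex.norm_real, neg_neg, Real.norm_eq_abs, Real.norm_of_nonneg (by positivity)]
    exact hb t ht
  have hbot : (fun t => (f t : ℂ)) =O[𝓝[>] 0] (· ^ (-(-s.re - 1))) := by
    refine Asymptotics.IsBigO.of_bound 1 ?_
    filter_upwards [Ioo_mem_nhdsGT (zero_lt_one (α := ℝ))] with t ht
    rw [h0 t ht.2]
    simp
  have h1 : (-s).re < -β := by simpa using hs
  have h2 : -s.re - 1 < (-s).re := by simp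
  refine ⟨mellinConvergent_of_isBigO_rpow hfc htop h1 hbot h2, ?_⟩
  exact mellin_hasDerivAt_of_isBigO_rpow hfc htop h1 hbot h2

lemma mellin_neg_ite_id {s : ℂ} (hs : 1 < s.re) :
    mellin (fun t => ((if 1 < t then t else 0 : ℝ) : ℂ)) (-s) = 1 / (s - 1) := by
  have hsub : Set.Ioi (1 : ℝ) ⊆ Set.Ioi 0 := Set.Ioi_subset_Ioi zero_le_one
  rw [mellin, setIntegral_eq_of_subset_of_forall_sdiff_eq_zero measurableSet_Ioi hsub]
  · have h1 : ∫ t : ℝ in Set.Ioi 1, (t : ℂ) ^ (-s - 1) • ((if 1 < t then t else 0 : ℝ) : ℂ) =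
        ∫ t : ℝ in Set.Ioi 1, (t : ℂ) ^ (-s) := by
      refine setIntegral_congr_fun measurableSet_Ioi fun t ht => ?_
      have ht : (1 : ℝ) < t := ht
      have ht0 : (t : ℂ) ≠ 0 := by
        exact_mod_cast (zero_lt_one.trans ht).ne'
      simp only [ht, if_true, smul_eq_mul]
      rw [Complex.cpow_sub _ _ ht0, Complex.cpow_one, div_mul_cancel₀ _ ht0]
    rw [h1, integral_Ioi_cpow_of_lt (by simpa using hs) zero_lt_one]
    have : s - 1 ≠ 0 := fun h => by
      rw [sub_eq_zero.mp h] at hs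
      simp at hs
    have h3 : -s + 1 ≠ 0 := fun h => this (by linear_combination -h)
    rw [Complex.ofReal_one, Complex.one_cpow]
    field_simp
    ring
  · intro t ht
    have : ¬ (1 < t) := ht.2
    simp [this]

end MellinTail

section IdealSeries

open Ideal MeasureTheory
open scoped nonZeroDivisors

variable (K : Type*) [Field K] [NumberField K]

lemma one_le_absNorm_of_ne_bot {I : Ideal (𝓞 K)} (hI : I ≠ ⊥) : 1 ≤ absNorm I :=
  Nat.one_le_iff_ne_zero.mpr (absNorm_ne_zero_iff_mem_nonZeroDivisors.mpr
    (mem_nonZeroDivisors_of_ne_zero hI))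

variable {K} in
/-- The counting function of a set of ideals. -/
def idealCount (G : Set (Ideal (𝓞 K))) : ℝ → ℝ := normCount (fun I : G => absNorm I.1)

variable {K} in
/-- The Dirichlet series of a set of ideals. -/
def idealSeries (G : Set (Ideal (𝓞 K))) (s : ℂ) : ℂ := ∑' I : G, (absNorm I.1 : ℂ) ^ (-s)

variable {K} {G : Set (Ideal (𝓞 K))}

lemma finite_ideal_norm_le (hG : ∀ I ∈ G, I ≠ ⊥) (t : ℝ) :
    Finite {I : G // (absNorm I.1 : ℝ) ≤ t} := by
  have := finite_norm_le K t
  exact Finite.of_injective (fun I : {I : G // (absNorm I.1 : ℝ) ≤ t} =>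
    (⟨⟨I.1.1, mem_nonZeroDivisors_of_ne_zero (hG _ I.1.2)⟩, I.2⟩ :
      {I : (Ideal (𝓞 K))⁰ // (absNorm (I : Ideal (𝓞 K)) : ℝ) ≤ t}))
    (fun a b hab => Subtype.ext (Subtype.ext (congrArg (fun x => x.1.1) hab)))

lemma exists_idealCount_le : ∃ A : ℝ, 0 ≤ A ∧ ∀ G : Set (Ideal (𝓞 K)), (∀ I ∈ G, I ≠ ⊥) →
    ∀ t, 1 ≤ t → idealCount G t ≤ A * t := by
  obtain ⟨κ, D, δ, hκ, hD, hδ, hδ1, h⟩ := exists_card_norm_le K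
  refine ⟨κ + D, by positivity, fun G hG t ht => ?_⟩
  have := finite_norm_le K t
  have h1 : idealCount G t ≤ Nat.card {I : (Ideal (𝓞 K))⁰ // (absNorm (I : Ideal (𝓞 K)) : ℝ) ≤ t} := by
    simp only [idealCount, normCount]
    refine Nat.cast_le.mpr (Nat.card_le_card_of_injective
      (fun I : {I : G // (absNorm I.1 : ℝ) ≤ t} =>
        (⟨⟨I.1.1, mem_nonZeroDivisors_of_ne_zero (hG _ I.1.2)⟩, I.2⟩ :
          {I : (Ideal (𝓞 K))⁰ // (absNorm (I : Ideal (𝓞 K)) : ℝ) ≤ t})) ?_)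
    exact (fun a b hab => Subtype.ext (Subtype.ext (congrArg (fun x => x.1.1) hab)))
  have h2 := (abs_le.mp (h t ht)).2
  have h3 : t ^ (1 - δ) ≤ t := by
    conv_rhs => rw [← Real.rpow_one t]
    exact Real.rpow_le_rpow_of_exponent_le ht (by linarith)
  nlinarith

lemma summable_absNorm_rpow {σ : ℝ} (hσ : 1 < σ) :
    Summable fun I : Ideal (𝓞 K) => (absNorm I : ℝ) ^ (-σ) := by
  obtain ⟨A, hA0, hA⟩ := exists_idealCount_le (K := K)
  have hG : ∀ I ∈ {I : Ideal (𝓞 K) | I ≠ ⊥}, I ≠ ⊥ := fun I h => h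
  have := summable_norm_rpow (N := fun I : {I : Ideal (𝓞 K) | I ≠ ⊥} => absNorm I.1)
    (fun I => one_le_absNorm_of_ne_bot K I.2) (finite_ideal_norm_le hG) (hA _ hG) hσ
  refine (Function.Injective.summable_iff
    (Subtype.val_injective (p := fun I => I ∈ {I : Ideal (𝓞 K) | I ≠ ⊥})) ?_).mp this
  intro I hI
  have : I = ⊥ := by simpa using hI
  simp only [this, absNorm_bot, Nat.cast_zero]
  exact Real.zero_rpow (by linarith)

lemma norm_absNorm_cpow (I : Ideal (𝓞 K)) {s : ℂ} (hs : s.re ≠ 0) :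
    ‖(absNorm I : ℂ) ^ (-s)‖ = (absNorm I : ℝ) ^ (-s.re) := by
  rw [Complex.norm_natCast_cpow_of_re_ne_zero _ (by simpa using hs), Complex.neg_re]

lemma summable_absNorm_cpow {s : ℂ} (hs : 1 < s.re) :
    Summable fun I : Ideal (𝓞 K) => ‖(absNorm I : ℂ) ^ (-s)‖ :=
  (summable_absNorm_rpow hs).congr fun I => by
    rw [norm_absNorm_cpow I (by linarith)]

lemma idealSeries_eq_mellin (hG : ∀ I ∈ G, I ≠ ⊥) {s : ℂ} (hs : 1 < s.re) :
    idealSeries G s = s * mellin (fun t => (idealCount G t : ℂ)) (-s) := by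
  obtain ⟨A, hA0, hA⟩ := exists_idealCount_le (K := K)
  exact tsum_norm_cpow_eq (N := fun I : G => absNorm I.1)
    (fun I => one_le_absNorm_of_ne_bot K (hG _ I.2)) (finite_ideal_norm_le hG) (hA _ hG) hs

lemma idealCount_of_lt_one (hG : ∀ I ∈ G, I ≠ ⊥) {t : ℝ} (ht : t < 1) : idealCount G t = 0 :=
  normCount_of_lt_one (fun I => one_le_absNorm_of_ne_bot K (hG _ I.2)) ht

lemma monotone_idealCount (hG : ∀ I ∈ G, I ≠ ⊥) : Monotone (idealCount G) :=
  monotone_normCount (finite_ideal_norm_le hG)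

variable (K) in
/-- The Dedekind zeta function times `s - 1` extends to a neighbourhood of `1 ≤ re s`. -/
theorem exists_zeta_extension : ∃ (δ : ℝ) (H : ℂ → ℂ), 0 < δ ∧
    DifferentiableOn ℂ H {s | 1 - δ < s.re} ∧ H 1 ≠ 0 ∧
    ∀ s : ℂ, 1 < s.re → H s = (s - 1) * idealSeries {I : Ideal (𝓞 K) | I ≠ ⊥} s := by
  obtain ⟨κ, D, δ, hκ, hD, hδ, hδ1, h⟩ := exists_card_norm_le K
  set G := {I : Ideal (𝓞 K) | I ≠ ⊥}
  have hG : ∀ I ∈ G, I ≠ ⊥ := fun I h => h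
  have hcard : ∀ t : ℝ, idealCount G t =
      Nat.card {I : (Ideal (𝓞 K))⁰ // (absNorm (I : Ideal (𝓞 K)) : ℝ) ≤ t} := by
    intro t
    simp only [idealCount, normCount]
    congr 1
    refine Nat.card_congr (Equiv.subtypeEquiv (Equiv.subtypeEquivRight fun I => ?_) fun I => ?_)
    · exact mem_nonZeroDivisors_iff_ne_zero.symm
    · rfl
  set id1 : ℝ → ℝ := fun t => if 1 < t then t else 0 with hid1
  set E : ℝ → ℝ := fun t => idealCount G t - κ * id1 t with hE
  have hlid : LocallyIntegrable id1 := by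
    have : Monotone id1 := by
      intro a b hab
      simp only [hid1]
      split_ifs <;> linarith
    exact this.locallyIntegrable
  have hlM : LocallyIntegrable (idealCount G) := (monotone_idealCount hG).locallyIntegrable
  have hlE : LocallyIntegrable E := hlM.sub (hlid.smul κ)
  have hid0 : ∀ t < 1, id1 t = 0 := fun t ht => by simp [hid1, not_lt.mpr ht.le]
  have hE0 : ∀ t < 1, E t = 0 := fun t ht => by
    simp [hE, hid0 t ht, idealCount_of_lt_one hG ht]
  have hEb : ∀ t, 1 ≤ t → |E t| ≤ (D + κ) * t ^ (1 - δ) := by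
    intro t ht
    have hp : 1 ≤ t ^ (1 - δ) := Real.one_le_rpow ht (by linarith)
    have h1 := h t ht
    rw [← hcard] at h1
    rcases ht.lt_or_eq with ht | ht
    · simp only [hE, hid1, ht, if_true]
      nlinarith
    · subst ht
      simp only [hE, hid1, lt_irrefl, if_false, mul_zero, sub_zero, Real.one_rpow, mul_one] at h1 ⊢
      rw [abs_le] at h1 ⊢
      constructor <;> linarith
  refine ⟨δ, fun s => s * κ + s * (s - 1) * mellin (fun t => (E t : ℂ)) (-s), hδ, ?_, ?_, ?_⟩
  · intro s hs
    have hs : 1 - δ < s.re := hs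
    have h1 := (mellin_neg_of_vanish hlE hE0 hEb hs).2.2.differentiableAt
    have h2 : DifferentiableAt ℂ (fun s : ℂ => mellin (fun t => (E t : ℂ)) (-s)) s :=
      h1.comp s differentiableAt_id.neg
    exact (by fun_prop : DifferentiableAt ℂ _ s).differentiableWithinAt
  · simpa using hκ.ne'
  · intro s hs
    obtain ⟨A, hA0, hA⟩ := exists_idealCount_le (K := K)
    have hcM := (mellin_neg_of_vanish hlM (fun t ht => idealCount_of_lt_one hG ht) (D := A) (β := 1)
      (fun t ht => by
        rw [Real.rpow_one, abs_of_nonneg (show 0 ≤ idealCount G t from normCount_nonneg _)]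
        exact hA G hG t ht) hs).1
    have hcI := (mellin_neg_of_vanish hlid hid0 (D := 1) (β := 1) (fun t ht => by
      simp only [hid1]
      rw [Real.rpow_one, one_mul]
      split_ifs
      · rw [abs_of_nonneg (by linarith)]
      · simp; linarith) hs).1
    have hsub : mellin (fun t => (E t : ℂ)) (-s) =
        mellin (fun t => (idealCount G t : ℂ)) (-s) - κ * mellin (fun t => (id1 t : ℂ)) (-s) := by
      have e1 := (hasMellin_sub hcM (hcI.const_smul (κ : ℂ))).2
      rw [mellin_const_smul, smul_eq_mul] at e1
      rw [← e1]
      congr 1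
      funext t
      simp [hE]
    have h3 : s - 1 ≠ 0 := fun h => by
      rw [sub_eq_zero.mp h] at hs
      simp at hs
    beta_reduce
    rw [hsub, mellin_neg_ite_id hs, idealSeries_eq_mellin hG hs]
    field_simp
    ring

end IdealSeries

section EulerProduct

open Ideal IsDedekindDomain

section Abstract

variable {R : Type*} [CommRing R] {f : Ideal R → ℂ}

lemma summable_asIdeal (hf : Summable fun I => ‖f I‖) :
    Summable fun v : HeightOneSpectrum R => f v.asIdeal :=
  hf.of_norm.comp_injective (fun _ _ h => HeightOneSpectrum.ext h)

variable [IsDedekindDomain R]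

lemma tsum_indicator_eq_add_prime_mul (hf : Summable fun I => ‖f I‖)
    (hmul : ∀ I J, f (I * J) = f I * f J) (A : Set (Ideal R)) {P : Ideal R} (hP : P ≠ ⊥) :
    ∑' I, A.indicator f I =
      ∑' I, {I | I ∈ A ∧ ¬ P ∣ I}.indicator f I + f P * ∑' J, {J | P * J ∈ A}.indicator f J := by
  have hs : ∀ B : Set (Ideal R), Summable (B.indicator f) := fun B => hf.of_norm.indicator B
  have h1 : ∑' I, {I | I ∈ A ∧ P ∣ I}.indicator f I =
      f P * ∑' J, {J | P * J ∈ A}.indicator f J := by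
    have hinj : Function.Injective (fun J : Ideal R => P * J) := mul_right_injective₀ hP
    rw [← tsum_mul_left, ← hinj.tsum_eq]
    · refine tsum_congr fun J => ?_
      by_cases hJ : P * J ∈ A <;> simp [Set.indicator, hJ, hmul]
    · intro I hI
      obtain ⟨J, rfl⟩ := (Set.mem_of_indicator_ne_zero hI).2
      exact ⟨J, rfl⟩
  rw [← h1, ← (hs _).tsum_add (hs _)]
  refine tsum_congr fun I => ?_
  by_cases hA : I ∈ A <;> by_cases hI : P ∣ I <;> simp [Set.indicator, hA, hI]

/-- The ideals in `G` that are divisible by no prime in `T`. -/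
def coprimeTo (G : Set (Ideal R)) (T : Finset (HeightOneSpectrum R)) : Set (Ideal R) :=
  {I | I ∈ G ∧ ∀ v ∈ T, ¬ v.asIdeal ∣ I}

lemma tendsto_tsum_coprimeTo (hf : Summable fun I => ‖f I‖) (h0 : f ⊥ = 0) (h1 : f ⊤ = 1)
    {G : Set (Ideal R)} (hG : ⊤ ∈ G) :
    Tendsto (fun T => ∑' I, (coprimeTo G T).indicator f I) atTop (𝓝 1) := by
  classical
  have hlim : ∑' I : Ideal R, (if I = ⊤ then (1 : ℂ) else 0) = 1 := by
    rw [tsum_ite_eq]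
  rw [← hlim]
  refine tendsto_tsum_of_dominated_convergence hf (fun I => ?_) (Eventually.of_forall fun T I => ?_)
  · refine tendsto_const_nhds.congr' ?_
    by_cases hI : I = ⊤
    · refine Eventually.of_forall fun T => ?_
      have : I ∈ coprimeTo G T := by
        refine ⟨hI ▸ hG, fun v _ hv => v.isPrime.ne_top ?_⟩
        rw [hI] at hv
        exact top_le_iff.mp (Ideal.le_of_dvd hv)
      beta_reduce
      rw [Set.indicator_of_mem this, hI, if_pos rfl, h1]
    · simp only [if_neg hI]
      by_cases hb : I = ⊥
      · refine Eventually.of_forall fun T => ?_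
        simp [hb, Set.indicator, h0]
      · obtain ⟨M, hM, hIM⟩ := Ideal.exists_le_maximal I hI
        have hMb : M ≠ ⊥ := fun h => hb (le_bot_iff.mp (h ▸ hIM))
        filter_upwards [eventually_ge_atTop {(⟨M, hM.isPrime, hMb⟩ : HeightOneSpectrum R)}] with T hT
        rw [Set.indicator_of_notMem]
        exact fun h => h.2 _ (Finset.singleton_subset_iff.mp hT) (Ideal.dvd_iff_le.mpr hIM)
  · exact norm_indicator_le_norm_self _ _

lemma not_dvd_asIdeal_mul_iff {v w : HeightOneSpectrum R} (hvw : v ≠ w) (J : Ideal R) :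
    w.asIdeal ∣ v.asIdeal * J ↔ w.asIdeal ∣ J := by
  refine ⟨fun h => (w.prime.dvd_or_dvd h).resolve_left fun h' => hvw ?_, fun h => h.mul_left _⟩
  have := (w.isPrime.isMaximal w.ne_bot)
  have h2 := (v.isPrime.isMaximal v.ne_bot).eq_of_le w.isPrime.ne_top (Ideal.le_of_dvd h')
  exact HeightOneSpectrum.ext h2

lemma tsum_coprimeTo_univ_insert [DecidableEq (HeightOneSpectrum R)] (hf : Summable fun I => ‖f I‖)
    (hmul : ∀ I J, f (I * J) = f I * f J) {T : Finset (HeightOneSpectrum R)}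
    {v : HeightOneSpectrum R} (hv : v ∉ T) :
    ∑' I, (coprimeTo Set.univ (insert v T)).indicator f I =
      (1 - f v.asIdeal) * ∑' I, (coprimeTo Set.univ T).indicator f I := by
  have h := tsum_indicator_eq_add_prime_mul hf hmul (coprimeTo Set.univ T) v.ne_bot
  have e1 : {I | I ∈ coprimeTo Set.univ T ∧ ¬ v.asIdeal ∣ I} =
      coprimeTo Set.univ (insert v T) := by
    ext I
    simp [coprimeTo, and_comm]
  have e2 : {J | v.asIdeal * J ∈ coprimeTo Set.univ T} = coprimeTo Set.univ T := by
    ext I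
    simp only [coprimeTo, Set.mem_univ, true_and, Set.mem_ofPred_eq]
    refine forall₂_congr fun w hw => ?_
    rw [not_dvd_asIdeal_mul_iff (show v ≠ w from fun h => hv (by rwa [h]))]
  rw [e1, e2] at h
  linear_combination -h

/-- The squarefree ideals whose prime divisors lie in `S`. -/
def squarefreeOver (S : Set (HeightOneSpectrum R)) : Set (Ideal R) :=
  {I | Squarefree I ∧ ∀ v : HeightOneSpectrum R, v.asIdeal ∣ I → v ∈ S}

lemma asIdeal_mul_mem_squarefreeOver {S : Set (HeightOneSpectrum R)} {v : HeightOneSpectrum R}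
    (hv : v ∈ S) (J : Ideal R) :
    v.asIdeal * J ∈ squarefreeOver S ↔ J ∈ squarefreeOver S ∧ ¬ v.asIdeal ∣ J := by
  constructor
  · rintro ⟨h1, h2⟩
    refine ⟨⟨h1.squarefree_of_dvd (dvd_mul_left _ _), fun w hw => h2 w (hw.mul_left _)⟩, ?_⟩
    rintro ⟨J', rfl⟩
    exact v.prime.not_isUnit (h1 v.asIdeal ⟨J', by ring⟩)
  · rintro ⟨⟨h1, h2⟩, h3⟩
    refine ⟨?_, fun w hw => ?_⟩
    · refine squarefree_mul_iff.mpr ⟨?_, v.prime.irreducible.squarefree, h1⟩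
      exact (v.prime.irreducible.isRelPrime_iff_not_dvd).mpr h3
    · by_cases hvw : v = w
      · exact hvw ▸ hv
      · exact h2 w ((not_dvd_asIdeal_mul_iff hvw J).mp hw)

lemma tsum_coprimeTo_squarefreeOver_insert [DecidableEq (HeightOneSpectrum R)]
    (hf : Summable fun I => ‖f I‖)
    (hmul : ∀ I J, f (I * J) = f I * f J) (S : Set (HeightOneSpectrum R))
    {T : Finset (HeightOneSpectrum R)} {v : HeightOneSpectrum R} (hv : v ∉ T) :
    ∑' I, (coprimeTo (squarefreeOver S) T).indicator f I =
      (1 + S.indicator (fun v => f v.asIdeal) v) *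
        ∑' I, (coprimeTo (squarefreeOver S) (insert v T)).indicator f I := by
  have e1 : {I | I ∈ coprimeTo (squarefreeOver S) T ∧ ¬ v.asIdeal ∣ I} =
      coprimeTo (squarefreeOver S) (insert v T) := by
    ext I
    simp only [coprimeTo, Finset.forall_mem_insert, Set.mem_ofPred_eq]
    tauto
  by_cases hS : v ∈ S
  · have h := tsum_indicator_eq_add_prime_mul hf hmul (coprimeTo (squarefreeOver S) T) v.ne_bot
    have e2 : {J | v.asIdeal * J ∈ coprimeTo (squarefreeOver S) T} =
        coprimeTo (squarefreeOver S) (insert v T) := by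
      rw [← e1]
      ext J
      simp only [coprimeTo, Set.mem_ofPred_eq, asIdeal_mul_mem_squarefreeOver hS]
      have : (∀ w ∈ T, ¬ w.asIdeal ∣ v.asIdeal * J) ↔ (∀ w ∈ T, ¬ w.asIdeal ∣ J) :=
        forall₂_congr fun w hw => by rw [not_dvd_asIdeal_mul_iff (show v ≠ w from fun h => hv (by rwa [h]))]
      rw [this]
      tauto
    rw [e1, e2] at h
    rw [Set.indicator_of_mem hS, h]
    ring
  · rw [Set.indicator_of_notMem hS, add_zero, one_mul, ← e1]
    have e2 : {I | I ∈ coprimeTo (squarefreeOver S) T ∧ ¬ v.asIdeal ∣ I} =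
        coprimeTo (squarefreeOver S) T :=
      Set.ext fun I => ⟨fun h => h.1, fun h => ⟨h, fun h' => hS (h.1.2 v h')⟩⟩
    rw [e2]

lemma tendsto_prod_one_add {ι : Type*} {a : ι → ℂ} (ha : Summable a) (h : ∀ i, 1 + a i ≠ 0) :
    Tendsto (fun T : Finset ι => ∏ i ∈ T, (1 + a i)) atTop
      (𝓝 (Complex.exp (∑' i, Complex.log (1 + a i)))) := by
  have h1 := (Complex.summable_log_one_add_of_summable ha).hasSum
  refine ((Complex.continuous_exp.tendsto _).comp h1).congr fun T => ?_
  simp only [Function.comp, Complex.exp_sum]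
  exact Finset.prod_congr rfl fun i _ => Complex.exp_log (h i)

lemma tsum_mul_exp_eq_one (hf : Summable fun I => ‖f I‖) (hmul : ∀ I J, f (I * J) = f I * f J)
    (h0 : f ⊥ = 0) (h1 : f ⊤ = 1) (hlt : ∀ v : HeightOneSpectrum R, ‖f v.asIdeal‖ < 1) :
    (∑' I, f I) * Complex.exp (∑' v : HeightOneSpectrum R, Complex.log (1 + -f v.asIdeal)) = 1 := by
  classical
  have hne : ∀ v : HeightOneSpectrum R, 1 + -f v.asIdeal ≠ 0 := fun v h => by
    have : f v.asIdeal = 1 := by linear_combination -h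
    simpa [this] using hlt v
  have hT : ∀ T : Finset (HeightOneSpectrum R), ∑' I, (coprimeTo Set.univ T).indicator f I =
      (∑' I, f I) * ∏ v ∈ T, (1 + -f v.asIdeal) := by
    intro T
    induction T using Finset.induction_on with
    | empty => simp [coprimeTo]
    | insert v T hv ih =>
      rw [tsum_coprimeTo_univ_insert hf hmul hv, ih, Finset.prod_insert hv]
      ring
  have hl := tendsto_tsum_coprimeTo hf h0 h1 (G := Set.univ) trivial
  have hr := (tendsto_prod_one_add (summable_asIdeal hf).neg hne).const_mul (∑' I, f I)
  exact tendsto_nhds_unique hr (hl.congr hT)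

lemma tsum_squarefreeOver_eq_exp (hf : Summable fun I => ‖f I‖)
    (hmul : ∀ I J, f (I * J) = f I * f J)
    (h0 : f ⊥ = 0) (h1 : f ⊤ = 1) (hlt : ∀ v : HeightOneSpectrum R, ‖f v.asIdeal‖ < 1)
    (S : Set (HeightOneSpectrum R)) :
    ∑' I, (squarefreeOver S).indicator f I = Complex.exp (∑' v : HeightOneSpectrum R,
      Complex.log (1 + S.indicator (fun v => f v.asIdeal) v)) := by
  classical
  have hne : ∀ v : HeightOneSpectrum R, 1 + S.indicator (fun v => f v.asIdeal) v ≠ 0 := fun v h => by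
    by_cases hv : v ∈ S
    · rw [Set.indicator_of_mem hv] at h
      have : f v.asIdeal = -1 := by linear_combination h
      simpa [this] using hlt v
    · simp [Set.indicator_of_notMem hv] at h
  have hT : ∀ T : Finset (HeightOneSpectrum R), ∑' I, (squarefreeOver S).indicator f I =
      (∏ v ∈ T, (1 + S.indicator (fun v => f v.asIdeal) v)) *
        ∑' I, (coprimeTo (squarefreeOver S) T).indicator f I := by
    intro T
    induction T using Finset.induction_on with
    | empty => simp [coprimeTo]
    | insert v T hv ih =>
      rw [ih, tsum_coprimeTo_squarefreeOver_insert hf hmul S hv, Finset.prod_insert hv]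
      ring
  have htop : (⊤ : Ideal R) ∈ squarefreeOver S := by
    refine ⟨?_, fun v hv => (v.isPrime.ne_top (top_le_iff.mp (Ideal.le_of_dvd hv))).elim⟩
    rw [← Ideal.one_eq_top]
    exact squarefree_one
  have hl := tendsto_tsum_coprimeTo hf h0 h1 htop
  have hr := (tendsto_prod_one_add ((summable_asIdeal hf).indicator S) hne).mul hl
  rw [mul_one] at hr
  exact tendsto_nhds_unique (tendsto_const_nhds.congr hT) hr

end Abstract

section NumberField

variable {K : Type*} [Field K] [NumberField K]

lemma two_le_absNorm_asIdeal (v : HeightOneSpectrum (𝓞 K)) : 2 ≤ absNorm v.asIdeal := by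
  have h1 := one_le_absNorm_of_ne_bot K v.ne_bot
  have h2 : absNorm v.asIdeal ≠ 1 := fun h => v.isPrime.ne_top (absNorm_eq_one_iff.mp h)
  omega

lemma norm_asIdeal_cpow_lt_one (v : HeightOneSpectrum (𝓞 K)) {s : ℂ} (hs : 0 < s.re) :
    ‖(absNorm v.asIdeal : ℂ) ^ (-s)‖ < 1 := by
  rw [norm_absNorm_cpow _ hs.ne']
  have := two_le_absNorm_asIdeal v
  exact Real.rpow_lt_one_of_one_lt_of_neg (by exact_mod_cast this) (by linarith)

lemma absNorm_cpow_mul (I J : Ideal (𝓞 K)) (s : ℂ) : (absNorm (I * J) : ℂ) ^ s =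
    (absNorm I : ℂ) ^ s * (absNorm J : ℂ) ^ s := by
  rw [map_mul, Nat.cast_mul, Complex.natCast_mul_natCast_cpow]

lemma absNorm_bot_cpow {s : ℂ} (hs : 0 < s.re) : (absNorm (⊥ : Ideal (𝓞 K)) : ℂ) ^ (-s) = 0 := by
  rw [absNorm_bot, Nat.cast_zero, Complex.zero_cpow]
  intro h
  rw [neg_eq_zero.mp h] at hs
  simp at hs

lemma absNorm_top_cpow (s : ℂ) : (absNorm (⊤ : Ideal (𝓞 K)) : ℂ) ^ s = 1 := by
  simp

/-- Euler product of the Dedekind zeta function, in logarithmic form. -/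
theorem idealSeries_ne_bot_mul_exp {s : ℂ} (hs : 1 < s.re) :
    idealSeries {I : Ideal (𝓞 K) | I ≠ ⊥} s *
      Complex.exp (∑' v : HeightOneSpectrum (𝓞 K),
        Complex.log (1 + -(absNorm v.asIdeal : ℂ) ^ (-s))) = 1 := by
  have hs0 : 0 < s.re := by linarith
  refine Eq.trans ?_ (tsum_mul_exp_eq_one (R := 𝓞 K) (summable_absNorm_cpow hs)
    (fun I J => absNorm_cpow_mul I J _) (absNorm_bot_cpow hs0) (absNorm_top_cpow _)
    (fun v => norm_asIdeal_cpow_lt_one v hs0))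
  congr 1
  rw [idealSeries, tsum_subtype {I : Ideal (𝓞 K) | I ≠ ⊥} fun I => (absNorm I : ℂ) ^ (-s)]
  refine tsum_congr fun I => ?_
  by_cases hI : I = ⊥
  · rw [Set.indicator_of_notMem (by simpa using hI), hI, absNorm_bot_cpow hs0]
  · rw [Set.indicator_of_mem hI]

theorem idealSeries_squarefreeOver (S : Set (HeightOneSpectrum (𝓞 K))) {s : ℂ} (hs : 1 < s.re) :
    idealSeries (squarefreeOver S) s =
      Complex.exp (∑' v : HeightOneSpectrum (𝓞 K),
        Complex.log (1 + S.indicator (fun v => (absNorm v.asIdeal : ℂ) ^ (-s)) v)) := by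
  have hs0 : 0 < s.re := by linarith
  rw [← tsum_squarefreeOver_eq_exp (R := 𝓞 K) (summable_absNorm_cpow hs) (fun I J => absNorm_cpow_mul I J _)
    (absNorm_bot_cpow hs0) (absNorm_top_cpow _) (fun v => norm_asIdeal_cpow_lt_one v hs0)]
  rw [idealSeries, tsum_subtype (squarefreeOver S) fun I => (absNorm I : ℂ) ^ (-s)]

end NumberField

end EulerProduct

section LogZeta

open Ideal IsDedekindDomain Metric

lemma exists_extension_of_exp_eq {H g : ℂ → ℂ} {s₀ : ℂ} {ρ : ℝ} {V : Set ℂ} (hV : IsOpen V)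
    (hVc : Convex ℝ V) (hH : DifferentiableOn ℂ H (ball s₀ ρ)) (hne : ∀ s ∈ ball s₀ ρ, H s ≠ 0)
    (hg : DifferentiableOn ℂ g V) (hexp : ∀ s ∈ ball s₀ ρ ∩ V, Complex.exp (g s) = H s) :
    ∃ h : ℂ → ℂ, DifferentiableOn ℂ h (ball s₀ ρ) ∧ ∀ s ∈ ball s₀ ρ ∩ V, g s = h s := by
  have hd : DifferentiableOn ℂ (fun s => deriv H s / H s) (ball s₀ ρ) :=
    (hH.deriv isOpen_ball).div hH hne
  obtain ⟨h, hh⟩ := hd.isExactOn_ball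
  have hU : IsOpen (ball s₀ ρ ∩ V) := isOpen_ball.inter hV
  have hder : ∀ s ∈ ball s₀ ρ ∩ V, HasDerivAt (fun s => g s - h s) 0 s := by
    intro s hs
    have h1 := (hg.differentiableAt (hV.mem_nhds hs.2)).hasDerivAt
    have h2 : HasDerivAt H (Complex.exp (g s) * deriv g s) s :=
      h1.cexp.congr_of_eventuallyEq (by
        filter_upwards [hU.mem_nhds hs] with z hz using (hexp z hz).symm)
    have h3 : deriv g s = deriv H s / H s := by
      rw [h2.deriv, hexp s hs, mul_div_cancel_left₀ _ (hne s hs.1)]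
    have h4 := h1.sub (hh s hs.1)
    rwa [h3, sub_self] at h4
  obtain ⟨a, ha⟩ := hU.exists_is_const_of_deriv_eq_zero
    ((convex_ball s₀ ρ).inter hVc).isPreconnected
    (fun s hs => (hder s hs).differentiableAt.differentiableWithinAt) (fun s hs => (hder s hs).deriv)
  refine ⟨fun s => h s + a, fun s hs => ?_, fun s hs => ?_⟩
  · exact ((hh s hs).differentiableAt.add_const a).differentiableWithinAt
  · rw [← ha s hs]
    ring

variable (K : Type*) [Field K] [NumberField K]

/-- The logarithm of the Dedekind zeta function, given by the Euler product. -/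
def logZeta (s : ℂ) : ℂ :=
  ∑' v : HeightOneSpectrum (𝓞 K), -Complex.log (1 + -(absNorm v.asIdeal : ℂ) ^ (-s))

variable {K}

lemma exp_logZeta {s : ℂ} (hs : 1 < s.re) :
    Complex.exp (logZeta K s) = idealSeries {I : Ideal (𝓞 K) | I ≠ ⊥} s := by
  rw [logZeta, tsum_neg, Complex.exp_neg]
  exact (eq_inv_of_mul_eq_one_left (idealSeries_ne_bot_mul_exp hs)).symm

lemma summable_asIdeal_rpow {σ : ℝ} (hσ : 1 < σ) :
    Summable fun v : HeightOneSpectrum (𝓞 K) => (absNorm v.asIdeal : ℝ) ^ (-σ) :=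
  (summable_absNorm_rpow hσ).comp_injective (fun _ _ h => HeightOneSpectrum.ext h)

lemma absNorm_rpow_anti (v : HeightOneSpectrum (𝓞 K)) {σ τ : ℝ} (h : σ ≤ τ) :
    (absNorm v.asIdeal : ℝ) ^ (-τ) ≤ (absNorm v.asIdeal : ℝ) ^ (-σ) := by
  have h2 : (2 : ℝ) ≤ absNorm v.asIdeal := by exact_mod_cast two_le_absNorm_asIdeal v
  exact Real.rpow_le_rpow_of_exponent_le (by linarith) (by linarith)

lemma norm_asIdeal_cpow_le_half (v : HeightOneSpectrum (𝓞 K)) {s : ℂ} (hs : 1 ≤ s.re) :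
    ‖(absNorm v.asIdeal : ℂ) ^ (-s)‖ ≤ 1 / 2 := by
  have h2 : (2 : ℝ) ≤ absNorm v.asIdeal := by exact_mod_cast two_le_absNorm_asIdeal v
  rw [norm_absNorm_cpow _ (by linarith)]
  refine (absNorm_rpow_anti v hs).trans ?_
  rw [Real.rpow_neg_one, one_div]
  exact inv_anti₀ (by norm_num) h2

lemma norm_neg_log_le (v : HeightOneSpectrum (𝓞 K)) {s : ℂ} {σ : ℝ} (hσ : 1 ≤ σ) (hs : σ ≤ s.re) :
    ‖-Complex.log (1 + -(absNorm v.asIdeal : ℂ) ^ (-s))‖ ≤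
      3 / 2 * (absNorm v.asIdeal : ℝ) ^ (-σ) := by
  have h := norm_asIdeal_cpow_le_half v (hσ.trans hs)
  rw [norm_neg]
  refine (Complex.norm_log_one_add_half_le_self (by rwa [norm_neg])).trans ?_
  rw [norm_neg, norm_absNorm_cpow _ (by linarith)]
  exact mul_le_mul_of_nonneg_left (absNorm_rpow_anti v hs) (by norm_num)

lemma summable_neg_log {s : ℂ} (hs : 1 < s.re) : Summable fun v : HeightOneSpectrum (𝓞 K) =>
    -Complex.log (1 + -(absNorm v.asIdeal : ℂ) ^ (-s)) :=
  Summable.of_norm_bounded ((summable_asIdeal_rpow hs).mul_left (3 / 2))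
    fun v => norm_neg_log_le v hs.le le_rfl

lemma differentiable_absNorm_cpow (v : HeightOneSpectrum (𝓞 K)) :
    Differentiable ℂ fun s : ℂ => (absNorm v.asIdeal : ℂ) ^ (-s) := by
  have h2 := two_le_absNorm_asIdeal v
  intro s
  exact differentiableAt_id.neg.const_cpow (Or.inl (by exact_mod_cast (by omega)))

lemma differentiableAt_log_one_add {f : ℂ → ℂ} {s : ℂ} (hf : DifferentiableAt ℂ f s)
    (h : ‖f s‖ < 1) : DifferentiableAt ℂ (fun s => Complex.log (1 + f s)) s := by
  refine (hf.const_add 1).clog ?_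
  exact Complex.mem_slitPlane_of_norm_lt_one h

lemma isOpen_lt_re (σ : ℝ) : IsOpen {s : ℂ | σ < s.re} :=
  isOpen_lt continuous_const Complex.continuous_re

lemma differentiableOn_logZeta : DifferentiableOn ℂ (logZeta K) {s | 1 < s.re} := by
  intro s hs
  obtain ⟨σ, h1, h2⟩ := exists_between (show 1 < s.re from hs)
  have : DifferentiableOn ℂ (logZeta K) {s | σ < s.re} := by
    refine Complex.differentiableOn_tsum_of_summable_norm
      ((summable_asIdeal_rpow h1).mul_left (3 / 2)) (fun v z hz => ?_) (isOpen_lt_re σ)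
      fun v z hz => norm_neg_log_le v h1.le (le_of_lt hz)
    have hz : σ < z.re := hz
    refine (differentiableAt_log_one_add (differentiable_absNorm_cpow v z).neg ?_).neg
      |>.differentiableWithinAt
    rw [Pi.neg_apply, norm_neg]
    exact norm_asIdeal_cpow_lt_one v (by linarith)
  exact (this.differentiableAt ((isOpen_lt_re σ).mem_nhds h2)).differentiableWithinAt

lemma re_log_comb_nonneg {a : ℝ} (ha₀ : 0 ≤ a) (ha₁ : a < 1) {z : ℂ} (hz : ‖z‖ = 1) :
    0 ≤ 3 * (-Complex.log (1 + -a)).re + 4 * (-Complex.log (1 + -(a * z))).re +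
      (-Complex.log (1 + -(a * z ^ 2))).re := by
  simp only [← sub_eq_add_neg]
  have hac₀ : ‖(a : ℂ)‖ < 1 := by
    simp only [Complex.norm_of_nonneg ha₀, ha₁]
  have hac₁ : ‖a * z‖ < 1 := by rwa [norm_mul, hz, mul_one]
  have hac₂ : ‖a * z ^ 2‖ < 1 := by rwa [norm_mul, norm_pow, hz, one_pow, mul_one]
  rw [← ((Complex.hasSum_re <| Complex.hasSum_taylorSeries_neg_log hac₀).mul_left 3).add
    ((Complex.hasSum_re <| Complex.hasSum_taylorSeries_neg_log hac₁).mul_left 4) |>.add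
    (Complex.hasSum_re <| Complex.hasSum_taylorSeries_neg_log hac₂) |>.tsum_eq]
  refine tsum_nonneg fun n ↦ ?_
  simp only [← Complex.ofReal_pow, Complex.div_natCast_re, Complex.ofReal_re, mul_pow,
    Complex.mul_re, Complex.ofReal_im, zero_mul, sub_zero]
  rcases n.eq_zero_or_pos with rfl | hn
  · simp
  · simp only [← mul_div_assoc, ← add_div]
    refine div_nonneg ?_ n.cast_nonneg
    rw [← pow_mul, pow_mul', sq, Complex.mul_re, ← sq, ← sq, ← Complex.sq_norm_sub_sq_re, norm_pow, hz]
    convert! (show 0 ≤ 2 * a ^ n * ((z ^ n).re + 1) ^ 2 by positivity) using 1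
    ring

lemma logZeta_comb_nonneg {x : ℝ} (hx : 0 < x) (t : ℝ) :
    0 ≤ 3 * (logZeta K (1 + x)).re + 4 * (logZeta K (1 + x + Complex.I * t)).re +
      (logZeta K (1 + x + 2 * (Complex.I * t))).re := by
  have h₀ : 1 < (1 + x : ℂ).re := by simpa
  have h₁ : 1 < (1 + x + Complex.I * t : ℂ).re := by simpa
  have h₂ : 1 < (1 + x + 2 * (Complex.I * t) : ℂ).re := by simpa
  have H := (((Complex.hasSum_re (summable_neg_log (K := K) h₀).hasSum).mul_left 3).add
    ((Complex.hasSum_re (summable_neg_log (K := K) h₁).hasSum).mul_left 4)).add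
    (Complex.hasSum_re (summable_neg_log (K := K) h₂).hasSum)
  refine H.nonneg fun v => ?_
  have hv := two_le_absNorm_asIdeal v
  have hv0 : (absNorm v.asIdeal : ℂ) ≠ 0 := by exact_mod_cast (by omega)
  have hz : ‖(absNorm v.asIdeal : ℂ) ^ (-(Complex.I * t))‖ = 1 := by
    rw [Complex.norm_natCast_cpow_of_pos (by omega)]
    simp
  have ha1 : (absNorm v.asIdeal : ℝ) ^ (-(1 + x)) < 1 :=
    Real.rpow_lt_one_of_one_lt_of_neg (by exact_mod_cast hv) (by linarith)
  have ea : (((absNorm v.asIdeal : ℝ) ^ (-(1 + x)) : ℝ) : ℂ) = (absNorm v.asIdeal : ℂ) ^ (-(1 + x : ℂ)) := by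
    rw [Complex.ofReal_cpow (by positivity)]
    push_cast
    rfl
  have key := re_log_comb_nonneg (by positivity) ha1 hz
  rw [ea, ← Complex.cpow_add _ _ hv0, ← Complex.cpow_nat_mul, ← Complex.cpow_add _ _ hv0] at key
  have e1 : -(1 + x : ℂ) + -(Complex.I * t) = -(1 + x + Complex.I * t) := by ring
  have e2 : -(1 + x : ℂ) + (2 : ℕ) * -(Complex.I * t) = -(1 + x + 2 * (Complex.I * t)) := by
    push_cast
    ring
  rwa [e1, e2] at key

lemma extension_ne_zero {δ : ℝ} (hδ : 0 < δ) {H : ℂ → ℂ}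
    (hd : DifferentiableOn ℂ H {s | 1 - δ < s.re}) (h1 : H 1 ≠ 0)
    (hH : ∀ s : ℂ, 1 < s.re → H s = (s - 1) * idealSeries {I : Ideal (𝓞 K) | I ≠ ⊥} s)
    {s : ℂ} (hs : s.re = 1) : H s ≠ 0 := by
  intro h0
  set t := s.im
  have hst : s = 1 + Complex.I * t := by
    apply Complex.ext <;> simp [hs, t]
  have ht : t ≠ 0 := fun ht => h1 (by simpa [hst, ht] using h0)
  have hd' : ∀ z : ℂ, z.re = 1 → DifferentiableAt ℂ H z := fun z hz =>
    hd.differentiableAt ((isOpen_lt_re _).mem_nhds (show 1 - δ < z.re by linarith))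
  have hline : ∀ w : ℂ, Tendsto (fun x : ℝ => 1 + x + w) (𝓝[>] 0) (𝓝 (1 + w)) := fun w => by
    refine Tendsto.mono_left ?_ nhdsWithin_le_nhds
    have : Continuous fun x : ℝ => (1 + x + w : ℂ) := by fun_prop
    simpa using this.tendsto 0
  have hc1 : Tendsto (fun x : ℝ => ‖H (1 + x)‖) (𝓝[>] 0) (𝓝 ‖H 1‖) := by
    have := ((hd' 1 (by simp)).continuousAt.tendsto.comp (by simpa using hline 0)).norm
    simpa [Function.comp_def] using this
  have hc2 : Tendsto (fun x : ℝ => ‖H (1 + x + 2 * (Complex.I * t))‖) (𝓝[>] 0)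
      (𝓝 ‖H (1 + 2 * (Complex.I * t))‖) :=
    ((hd' (1 + 2 * (Complex.I * t)) (by simp)).continuousAt.tendsto.comp (hline _)).norm
  have hc3 : Tendsto (fun x : ℝ => ‖H (1 + x + Complex.I * t)‖ / x) (𝓝[>] 0) (𝓝 ‖deriv H s‖) := by
    have e1 := (hd' s hs).hasDerivAt.scomp_of_eq (0 : ℝ)
      (h := fun x : ℝ => 1 + (x : ℂ) + Complex.I * t)
      (((Complex.ofRealCLM.hasDerivAt (x := 0)).const_add 1).add_const _) (by simp [hst])
    have e2 := (hasDerivAt_iff_tendsto_slope.mp e1).mono_left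
      (nhdsWithin_mono (0 : ℝ) (s := Set.Ioi 0) fun x (hx : 0 < x) => hx.ne')
    have e3 := e2.norm
    simp only [Complex.ofRealCLM_apply, Complex.ofReal_one, one_smul] at e3
    refine e3.congr' ?_
    filter_upwards [self_mem_nhdsWithin] with x (hx : 0 < x)
    have : H (1 + ((0 : ℝ) : ℂ) + Complex.I * t) = 0 := by
      rw [← h0, hst]
      simp
    rw [slope_def_module, Function.comp, Function.comp, this, sub_zero, sub_zero, norm_smul, norm_inv,
      Real.norm_of_nonneg hx.le]
    field_simp
  have hx : Tendsto (fun x : ℝ => x) (𝓝[>] 0) (𝓝 0) := nhdsWithin_le_nhds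
  have hlim := (((hc1.pow 3).mul (hc3.pow 4)).mul hx).mul hc2
  rw [mul_zero, zero_mul] at hlim
  have hlow : ∀ᶠ x : ℝ in 𝓝[>] 0, |t| ^ 4 * |t| ≤ ‖H (1 + x)‖ ^ 3 *
      (‖H (1 + x + Complex.I * t)‖ / x) ^ 4 * x * ‖H (1 + x + 2 * (Complex.I * t))‖ := by
    filter_upwards [self_mem_nhdsWithin] with x (hx : 0 < x)
    have hH' : ∀ s : ℂ, 1 < s.re → ‖H s‖ = ‖s - 1‖ * Real.exp (logZeta K s).re := fun s hs => by
      rw [hH s hs, ← exp_logZeta hs, norm_mul, Complex.norm_exp]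
    rw [hH' _ (by simpa), hH' _ (by simpa), hH' _ (by simpa)]
    have n1 : ‖(1 + x - 1 : ℂ)‖ = x := by
      rw [add_sub_cancel_left, Complex.norm_real, Real.norm_of_nonneg hx.le]
    have n2 : |t| ≤ ‖(1 + x + Complex.I * t - 1 : ℂ)‖ := by
      simpa using Complex.abs_im_le_norm (1 + x + Complex.I * t - 1 : ℂ)
    have n3 : |t| ≤ ‖(1 + x + 2 * (Complex.I * t) - 1 : ℂ)‖ := by
      have := Complex.abs_im_le_norm (1 + x + 2 * (Complex.I * t) - 1 : ℂ)
      simp [abs_mul] at this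
      linarith [abs_nonneg t]
    rw [n1]
    have hexp := Real.one_le_exp (logZeta_comb_nonneg (K := K) hx t)
    set A := (logZeta K (1 + x)).re
    set B := (logZeta K (1 + x + Complex.I * t)).re
    set C := (logZeta K (1 + x + 2 * (Complex.I * t))).re
    set m := ‖(1 + x + Complex.I * t - 1 : ℂ)‖
    set n := ‖(1 + x + 2 * (Complex.I * t) - 1 : ℂ)‖
    have hE : Real.exp (3 * A + 4 * B + C) = Real.exp A ^ 3 * Real.exp B ^ 4 * Real.exp C := by
      rw [Real.exp_add, Real.exp_add, ← Real.exp_nat_mul, ← Real.exp_nat_mul]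
      norm_num
    calc |t| ^ 4 * |t| ≤ m ^ 4 * n := by gcongr
      _ ≤ m ^ 4 * n * Real.exp (3 * A + 4 * B + C) := le_mul_of_one_le_right (by positivity) hexp
      _ = _ := by
        rw [hE]
        field_simp
  have := ge_of_tendsto hlim hlow
  have : 0 < |t| := abs_pos.mpr ht
  have : 0 < |t| ^ 4 * |t| := by positivity
  linarith

lemma sub_one_mem_slitPlane {s : ℂ} (hs : 1 < s.re) : s - 1 ∈ Complex.slitPlane :=
  Or.inl (by simpa using hs)

variable (K) in
/-- `log ζ_K(s) + log (s - 1)` extends analytically across the line `re s = 1`. -/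
theorem exists_logZeta_extension {s₀ : ℂ} (hs₀ : s₀.re = 1) :
    ∃ ρ : ℝ, 0 < ρ ∧ ∃ h : ℂ → ℂ, DifferentiableOn ℂ h (ball s₀ ρ) ∧
      ∀ s ∈ ball s₀ ρ, 1 < s.re → logZeta K s + Complex.log (s - 1) = h s := by
  obtain ⟨δ, H, hδ, hd, h1, hH⟩ := exists_zeta_extension K
  have hne := extension_ne_zero hδ hd h1 hH hs₀
  have hmem : {s : ℂ | 1 - δ < s.re} ∈ 𝓝 s₀ :=
    (isOpen_lt_re _).mem_nhds (show 1 - δ < s₀.re by linarith)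
  have hcont := (hd.differentiableAt hmem).continuousAt
  obtain ⟨ρ, hρ, hsub⟩ := Metric.mem_nhds_iff.mp (inter_mem hmem (hcont.eventually_ne hne))
  obtain ⟨h, hh, heq⟩ := exists_extension_of_exp_eq (H := H) (s₀ := s₀) (ρ := ρ)
    (g := fun s => logZeta K s + Complex.log (s - 1)) (isOpen_lt_re 1)
    (convex_halfSpace_re_gt 1) (hd.mono fun s hs => (hsub hs).1) (fun s hs => (hsub hs).2)
    (fun s hs => by
      have h3 := differentiableOn_logZeta (K := K) s hs
      have h4 : DifferentiableAt ℂ (fun s : ℂ => Complex.log (s - 1)) s :=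
        (differentiableAt_id.sub_const 1).clog (sub_one_mem_slitPlane hs)
      exact h3.add h4.differentiableWithinAt)
    (fun s hs => by
      have hs1 : 1 < s.re := hs.2
      have : s - 1 ≠ 0 := Complex.slitPlane_ne_zero (sub_one_mem_slitPlane hs1)
      rw [Complex.exp_add, Complex.exp_log this, exp_logZeta hs1, hH s hs1, mul_comm])
  exact ⟨ρ, hρ, h, hh, fun s hs hs1 => heq s ⟨hs, hs1⟩⟩

end LogZeta

section Comparison

open Ideal IsDedekindDomain

/-- `f` agrees on `re s > 1` with a function that is analytic on `re s > 1 / 2`. -/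
def ExtendsToHalf (f : ℂ → ℂ) : Prop :=
  ∃ g : ℂ → ℂ, DifferentiableOn ℂ g {s | 1 / 2 < s.re} ∧ ∀ s : ℂ, 1 < s.re → f s = g s

lemma ExtendsToHalf.add {f g : ℂ → ℂ} (hf : ExtendsToHalf f) (hg : ExtendsToHalf g) :
    ExtendsToHalf fun s => f s + g s := by
  obtain ⟨f', hf, hf'⟩ := hf
  obtain ⟨g', hg, hg'⟩ := hg
  exact ⟨_, hf.add hg, fun s hs => by simp only [hf' s hs, hg' s hs, Pi.add_apply]⟩

lemma ExtendsToHalf.const_mul {f : ℂ → ℂ} (hf : ExtendsToHalf f) (a : ℂ) :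
    ExtendsToHalf fun s => a * f s := by
  obtain ⟨f', hf, hf'⟩ := hf
  exact ⟨_, hf.const_mul a, fun s hs => by simp only [hf' s hs]⟩

lemma ExtendsToHalf.sum {ι : Type*} {f : ι → ℂ → ℂ} (T : Finset ι)
    (hf : ∀ i ∈ T, ExtendsToHalf (f i)) : ExtendsToHalf fun s => ∑ i ∈ T, f i s := by
  classical
  induction T using Finset.induction_on with
  | empty => exact ⟨fun _ => 0, differentiableOn_const 0, fun s _ => by simp⟩
  | insert i T hi ih =>
    simp only [Finset.sum_insert hi]
    exact (hf i (by simp)).add (ih fun j hj => hf j (by simp [hj]))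

lemma ExtendsToHalf.congr {f g : ℂ → ℂ} (hf : ExtendsToHalf f)
    (h : ∀ s : ℂ, 1 < s.re → g s = f s) : ExtendsToHalf g := by
  obtain ⟨f', hf, hf'⟩ := hf
  exact ⟨f', hf, fun s hs => by rw [h s hs, hf' s hs]⟩

lemma extendsToHalf_tsum {ι : Type*} {D : ι → ℂ → ℂ}
    (hd : ∀ i, DifferentiableOn ℂ (D i) {s | 1 / 2 < s.re})
    (hb : ∀ σ : ℝ, 1 / 2 < σ → ∃ u : ι → ℝ, Summable u ∧ ∀ i s, σ < s.re → ‖D i s‖ ≤ u i) :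
    ExtendsToHalf fun s => ∑' i, D i s := by
  refine ⟨_, fun s hs => ?_, fun _ _ => rfl⟩
  obtain ⟨σ, h1, h2⟩ := exists_between (show 1 / 2 < s.re from hs)
  obtain ⟨u, hu, hDu⟩ := hb σ h1
  have : DifferentiableOn ℂ (fun s => ∑' i, D i s) {s | σ < s.re} :=
    Complex.differentiableOn_tsum_of_summable_norm hu
      (fun i => (hd i).mono fun z (hz : σ < z.re) => h1.trans hz) (isOpen_lt_re σ)
      fun i z hz => hDu i z hz
  exact (this.differentiableAt ((isOpen_lt_re σ).mem_nhds h2)).differentiableWithinAt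

lemma norm_log_one_add_sub_le {x : ℂ} (hx : ‖x‖ ≤ 3 / 4) :
    ‖Complex.log (1 + x) - x‖ ≤ 2 * ‖x‖ ^ 2 := by
  refine (Complex.norm_log_one_add_sub_self_le (by linarith)).trans ?_
  have : (1 - ‖x‖)⁻¹ ≤ 4 := by
    rw [inv_le_comm₀ (by linarith) (by norm_num)]
    linarith
  nlinarith [sq_nonneg ‖x‖]

lemma norm_log_one_add_le {x : ℂ} (hx : ‖x‖ ≤ 3 / 4) : ‖Complex.log (1 + x)‖ ≤ 4 * ‖x‖ := by
  have h := norm_log_one_add_sub_le hx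
  have h2 : ‖Complex.log (1 + x)‖ ≤ ‖Complex.log (1 + x) - x‖ + ‖x‖ := by
    simpa using norm_add_le (Complex.log (1 + x) - x) x
  nlinarith [norm_nonneg x]

variable {K : Type*} [Field K] [NumberField K]

lemma norm_asIdeal_cpow_le (v : HeightOneSpectrum (𝓞 K)) {s : ℂ} {σ : ℝ} (hσ : 0 < σ)
    (hs : σ ≤ s.re) : ‖(absNorm v.asIdeal : ℂ) ^ (-s)‖ ≤ (absNorm v.asIdeal : ℝ) ^ (-σ) := by
  rw [norm_absNorm_cpow _ (by linarith)]
  exact absNorm_rpow_anti v hs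

lemma asIdeal_rpow_le {v : HeightOneSpectrum (𝓞 K)} {σ : ℝ} (hσ : 1 / 2 ≤ σ) :
    (absNorm v.asIdeal : ℝ) ^ (-σ) ≤ 3 / 4 := by
  have h2 : (2 : ℝ) ≤ absNorm v.asIdeal := by exact_mod_cast two_le_absNorm_asIdeal v
  refine (absNorm_rpow_anti v hσ).trans ?_
  rw [Real.rpow_neg (by positivity), ← Real.sqrt_eq_rpow]
  rw [inv_le_comm₀ (by positivity) (by norm_num)]
  exact Real.le_sqrt_of_sq_le (by norm_num; linarith)

lemma norm_asIdeal_cpow_le_three_quarters (v : HeightOneSpectrum (𝓞 K)) {s : ℂ}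
    (hs : 1 / 2 ≤ s.re) : ‖(absNorm v.asIdeal : ℂ) ^ (-s)‖ ≤ 3 / 4 :=
  (norm_asIdeal_cpow_le v (by norm_num) hs).trans (asIdeal_rpow_le le_rfl)

lemma rpow_neg_sq {x : ℝ} (hx : 0 ≤ x) (σ : ℝ) : (x ^ (-σ)) ^ 2 = x ^ (-(2 * σ)) := by
  rw [← Real.rpow_natCast, ← Real.rpow_mul hx]
  congr 1
  push_cast
  ring

/-- The Dirichlet series `∑ N(v)⁻ˢ` over the primes in `S`. -/
def primeSeries (S : Set (HeightOneSpectrum (𝓞 K))) (s : ℂ) : ℂ :=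
  ∑' v, S.indicator (fun v => (absNorm v.asIdeal : ℂ) ^ (-s)) v

lemma summable_primeSeries (S : Set (HeightOneSpectrum (𝓞 K))) {s : ℂ} (hs : 1 < s.re) :
    Summable fun v => S.indicator (fun v => (absNorm v.asIdeal : ℂ) ^ (-s)) v := by
  refine Summable.indicator ?_ S
  exact Summable.of_norm_bounded (summable_asIdeal_rpow hs)
    fun v => norm_asIdeal_cpow_le v (by linarith) le_rfl

lemma summable_log_indicator (S : Set (HeightOneSpectrum (𝓞 K))) {s : ℂ} (hs : 1 < s.re) :
    Summable fun v => Complex.log (1 + S.indicator (fun v => (absNorm v.asIdeal : ℂ) ^ (-s)) v) :=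
  Complex.summable_log_one_add_of_summable (summable_primeSeries S hs)

lemma extendsToHalf_log_sub_primeSeries (S : Set (HeightOneSpectrum (𝓞 K))) :
    ExtendsToHalf fun s => (∑' v : HeightOneSpectrum (𝓞 K),
      Complex.log (1 + S.indicator (fun v => (absNorm v.asIdeal : ℂ) ^ (-s)) v)) -
        primeSeries S s := by
  have key : ExtendsToHalf fun s => ∑' v : HeightOneSpectrum (𝓞 K),
      (Complex.log (1 + S.indicator (fun v => (absNorm v.asIdeal : ℂ) ^ (-s)) v) -
        S.indicator (fun v => (absNorm v.asIdeal : ℂ) ^ (-s)) v) := by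
    refine extendsToHalf_tsum (fun v s hs => ?_) fun σ hσ => ?_
    · have hs : 1 / 2 < s.re := hs
      by_cases hv : v ∈ S
      · simp only [Set.indicator_of_mem hv]
        exact ((differentiableAt_log_one_add (differentiable_absNorm_cpow v s)
          (norm_asIdeal_cpow_lt_one v (by linarith))).sub
          (differentiable_absNorm_cpow v s)).differentiableWithinAt
      · simp only [Set.indicator_of_notMem hv]
        exact differentiableWithinAt_const _
    · refine ⟨_, (summable_asIdeal_rpow (K := K) (σ := 2 * σ) (by linarith)).mul_left 2,
        fun v s hs => ?_⟩
      by_cases hv : v ∈ S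
      · simp only [Set.indicator_of_mem hv]
        refine (norm_log_one_add_sub_le
          (norm_asIdeal_cpow_le_three_quarters v (by linarith))).trans ?_
        rw [← rpow_neg_sq (by positivity)]
        gcongr
        exact norm_asIdeal_cpow_le v (by linarith) hs.le
      · simp only [Set.indicator_of_notMem hv, add_zero, Complex.log_one, sub_zero, norm_zero]
        positivity
  refine key.congr fun s hs => ?_
  rw [primeSeries, ← (summable_log_indicator S hs).tsum_sub (summable_primeSeries S hs)]

variable {M : Type*} [Field M] [NumberField M]

lemma norm_sum_fiber_sub_le {v : HeightOneSpectrum (𝓞 K)} (W : Finset (HeightOneSpectrum (𝓞 M)))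
    (hW : ∀ w ∈ W, absNorm w.asIdeal = absNorm v.asIdeal ∨
      absNorm v.asIdeal ^ 2 ≤ absNorm w.asIdeal)
    {s : ℂ} {σ : ℝ} (hσ : 1 / 2 < σ) (hs : σ < s.re) :
    ‖(∑ w ∈ W, -Complex.log (1 + -(absNorm w.asIdeal : ℂ) ^ (-s))) -
      ((W.filter fun w => absNorm w.asIdeal = absNorm v.asIdeal).card : ℂ) *
        (absNorm v.asIdeal : ℂ) ^ (-s)‖ ≤ W.card * (4 * (absNorm v.asIdeal : ℝ) ^ (-(2 * σ))) := by
  have e : ((W.filter fun w => absNorm w.asIdeal = absNorm v.asIdeal).card : ℂ) *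
        (absNorm v.asIdeal : ℂ) ^ (-s) = ∑ w ∈ W, if absNorm w.asIdeal = absNorm v.asIdeal then
          (absNorm v.asIdeal : ℂ) ^ (-s) else 0 := by
    rw [← Finset.sum_filter, Finset.sum_const, nsmul_eq_mul]
  rw [e, ← Finset.sum_sub_distrib]
  refine (norm_sum_le _ _).trans ?_
  rw [← nsmul_eq_mul, ← Finset.sum_const]
  refine Finset.sum_le_sum fun w hw => ?_
  have hw34 : ‖-(absNorm w.asIdeal : ℂ) ^ (-s)‖ ≤ 3 / 4 := by
    rw [norm_neg]
    exact norm_asIdeal_cpow_le_three_quarters w (by linarith)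
  have h0 : (0 : ℝ) ≤ (absNorm v.asIdeal : ℝ) ^ (-(2 * σ)) := by positivity
  split_ifs with h
  · have := norm_log_one_add_sub_le hw34
    rw [← h]
    rw [← h] at h0
    calc _ = ‖Complex.log (1 + -(absNorm w.asIdeal : ℂ) ^ (-s)) -
          -(absNorm w.asIdeal : ℂ) ^ (-s)‖ := by rw [← norm_neg]; congr 1; ring
      _ ≤ 2 * ‖-(absNorm w.asIdeal : ℂ) ^ (-s)‖ ^ 2 := this
      _ ≤ 2 * (absNorm w.asIdeal : ℝ) ^ (-(2 * σ)) := by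
        rw [← rpow_neg_sq (by positivity), norm_neg]
        gcongr
        exact norm_asIdeal_cpow_le w (by linarith) hs.le
      _ ≤ _ := by linarith
  · have h2 := (hW w hw).resolve_left h
    rw [sub_zero, norm_neg]
    refine (norm_log_one_add_le hw34).trans ?_
    rw [norm_neg]
    gcongr
    refine (norm_asIdeal_cpow_le w (by linarith) hs.le).trans ?_
    have hv := two_le_absNorm_asIdeal v
    calc (absNorm w.asIdeal : ℝ) ^ (-σ) ≤ ((absNorm v.asIdeal : ℝ) ^ 2) ^ (-σ) := by
          refine Real.rpow_le_rpow_of_nonpos (by positivity) (by exact_mod_cast h2) (by linarith)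
      _ = _ := by
          rw [← Real.rpow_natCast, ← Real.rpow_mul (by positivity)]
          congr 1
          push_cast
          ring

/-- If `M → K` on primes has uniformly finite fibres and, away from finitely many primes, exactly
`n` or `0` primes of the same norm lie over a given prime, then the logarithm of `ζ_M` is
essentially `n` times the prime series of the set of primes of the first kind. -/
lemma extendsToHalf_logZeta_sub (π : HeightOneSpectrum (𝓞 M) → HeightOneSpectrum (𝓞 K))
    (m n : ℕ) (hfin : ∀ v, (π ⁻¹' {v}).Finite) (hcard : ∀ v, (hfin v).toFinset.card ≤ m)
    (hnorm : ∀ w, absNorm w.asIdeal = absNorm (π w).asIdeal ∨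
      absNorm (π w).asIdeal ^ 2 ≤ absNorm w.asIdeal)
    (S : Set (HeightOneSpectrum (𝓞 K))) {E : Set (HeightOneSpectrum (𝓞 K))} (hE : E.Finite)
    (hS : ∀ v ∉ E, v ∈ S → {w | π w = v ∧ absNorm w.asIdeal = absNorm v.asIdeal}.ncard = n)
    (hS' : ∀ v ∉ E, v ∉ S → ∀ w, π w = v → absNorm w.asIdeal ≠ absNorm v.asIdeal) :
    ExtendsToHalf fun s => logZeta M s - n * primeSeries S s := by
  classical
  have hfib : ∀ v ∉ E, (((hfin v).toFinset.filter
      fun w => absNorm w.asIdeal = absNorm v.asIdeal).card : ℂ) = n * S.indicator 1 v := by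
    intro v hv
    have e : {w | π w = v ∧ absNorm w.asIdeal = absNorm v.asIdeal} =
        ((hfin v).toFinset.filter fun w => absNorm w.asIdeal = absNorm v.asIdeal : Finset _) := by
      ext w
      simp
    by_cases h : v ∈ S
    · have := hS v hv h
      rw [e, Set.ncard_coe_finset] at this
      rw [this, Set.indicator_of_mem h]
      simp
    · rw [Set.indicator_of_notMem h, mul_zero, Nat.cast_eq_zero, Finset.card_eq_zero,
        Finset.filter_eq_empty_iff]
      exact fun w hw => hS' v hv h w (by simpa using hw)
  have key : ExtendsToHalf fun s => ∑' v : HeightOneSpectrum (𝓞 K),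
      ((∑ w ∈ (hfin v).toFinset, -Complex.log (1 + -(absNorm w.asIdeal : ℂ) ^ (-s))) -
        n * S.indicator (fun v => (absNorm v.asIdeal : ℂ) ^ (-s)) v) := by
    refine extendsToHalf_tsum (fun v s hs => ?_) fun σ hσ => ?_
    · have hs : 1 / 2 < s.re := hs
      refine DifferentiableAt.differentiableWithinAt ?_
      refine DifferentiableAt.sub (DifferentiableAt.fun_sum fun w _ => ?_) (DifferentiableAt.const_mul ?_ _)
      · refine (differentiableAt_log_one_add (differentiable_absNorm_cpow w s).neg ?_).neg
        rw [Pi.neg_apply, norm_neg]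
        exact norm_asIdeal_cpow_lt_one w (by linarith)
      · by_cases hv : v ∈ S
        · simp only [Set.indicator_of_mem hv]
          exact differentiable_absNorm_cpow v s
        · simp only [Set.indicator_of_notMem hv]
          exact differentiableAt_const _
    · refine ⟨fun v => m * (4 * (absNorm v.asIdeal : ℝ) ^ (-(2 * σ))) +
        E.indicator (fun _ => (m * 4 + n : ℝ)) v, ?_, fun v s hs => ?_⟩
      · refine (((summable_asIdeal_rpow (K := K) (σ := 2 * σ) (by linarith)).mul_left 4).mul_left
          (m : ℝ)).add ?_
        exact summable_of_hasFiniteSupport (hE.subset Set.support_indicator_subset)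
      · have hc : ((hfin v).toFinset.card : ℝ) ≤ m := by exact_mod_cast hcard v
        beta_reduce
        by_cases hv : v ∈ E
        · rw [Set.indicator_of_mem hv]
          have h1 : ‖∑ w ∈ (hfin v).toFinset, -Complex.log (1 + -(absNorm w.asIdeal : ℂ) ^ (-s))‖ ≤
              m * 4 := by
            refine (norm_sum_le _ _).trans ?_
            refine (Finset.sum_le_card_nsmul _ _ 4 fun w _ => ?_).trans ?_
            · have := norm_asIdeal_cpow_le_three_quarters w (s := s) (by linarith)
              rw [norm_neg]
              refine (norm_log_one_add_le (by rwa [norm_neg])).trans ?_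
              rw [norm_neg]
              linarith
            · rw [nsmul_eq_mul]
              gcongr
          have h2 : ‖(n : ℂ) * S.indicator (fun v => (absNorm v.asIdeal : ℂ) ^ (-s)) v‖ ≤ n := by
            rw [norm_mul, Complex.norm_natCast]
            refine mul_le_of_le_one_right (by positivity) ((norm_indicator_le_norm_self _ _).trans ?_)
            exact (norm_asIdeal_cpow_lt_one v (by linarith)).le
          have h3 : (0 : ℝ) ≤ m * (4 * (absNorm v.asIdeal : ℝ) ^ (-(2 * σ))) := by positivity
          exact (norm_sub_le _ _).trans (by linarith)
        · rw [Set.indicator_of_notMem hv, add_zero]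
          have e : (n : ℂ) * S.indicator (fun v => (absNorm v.asIdeal : ℂ) ^ (-s)) v =
              (((hfin v).toFinset.filter
                fun w => absNorm w.asIdeal = absNorm v.asIdeal).card : ℂ) *
              (absNorm v.asIdeal : ℂ) ^ (-s) := by
            rw [hfib v hv]
            by_cases h : v ∈ S <;> simp [Set.indicator, h]
          rw [e]
          refine (norm_sum_fiber_sub_le _ (fun w hw => ?_) hσ hs).trans (by gcongr)
          have hw : π w = v := by simpa using hw
          exact hw ▸ hnorm w
  refine key.congr fun s hs => ?_
  have h1 : HasSum (fun v => ∑ w ∈ (hfin v).toFinset,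
      -Complex.log (1 + -(absNorm w.asIdeal : ℂ) ^ (-s))) (logZeta M s) := by
    have := (summable_neg_log (K := M) hs).hasSum.tsum_fiberwise π
    convert! this using 2 with v
    rw [← Finset.tsum_subtype', Set.Finite.coe_toFinset]
  have h2 := (summable_primeSeries S hs).hasSum.mul_left (n : ℂ)
  exact (h1.sub h2).tsum_eq.symm

end Comparison

section SplitPrimes

open Ideal IsDedekindDomain
open scoped Pointwise

variable {K M : Type*} [Field K] [Field M] [Algebra K M]

lemma under_eq_iff {v : HeightOneSpectrum (𝓞 K)} {w : HeightOneSpectrum (𝓞 M)} :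
    w.under (𝓞 K) = v ↔ w.asIdeal.LiesOver v.asIdeal :=
  ⟨fun h => ⟨by rw [← h]; rfl⟩, fun h => HeightOneSpectrum.ext h.over.symm⟩

lemma ncard_under_preimage (v : HeightOneSpectrum (𝓞 K)) :
    ((fun w : HeightOneSpectrum (𝓞 M) => w.under (𝓞 K)) ⁻¹' {v}).ncard =
      (primesOver v.asIdeal (𝓞 M)).ncard := by
  refine Set.ncard_congr (fun w _ => w.asIdeal) (fun w hw => ⟨w.isPrime, under_eq_iff.mp hw⟩)
    (fun _ _ _ _ h => HeightOneSpectrum.ext h) fun P hP => ?_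
  have h1 := hP.1
  have h2 := hP.2
  exact ⟨⟨P, h1, ne_bot_of_liesOver_of_ne_bot v.ne_bot P⟩, under_eq_iff.mpr h2, rfl⟩

variable [NumberField K] [NumberField M]

lemma differentIdeal_ringOfIntegers_ne_bot : differentIdeal (𝓞 K) (𝓞 M) ≠ ⊥ := by
  intro h
  have := coeIdeal_differentIdeal (𝓞 K) K M (𝓞 M)
  rw [h] at this
  rw [FractionalIdeal.coeIdeal_bot, eq_comm, inv_eq_zero] at this
  have h1 : (1 : FractionalIdeal (nonZeroDivisors (𝓞 M)) M) ≠ 0 := one_ne_zero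
  exact FractionalIdeal.dual_ne_zero (𝓞 K) K h1 this

lemma finite_ramified : {v : HeightOneSpectrum (𝓞 K) | ∃ Q : HeightOneSpectrum (𝓞 M),
    Q.asIdeal ^ 2 ∣ v.asIdeal.map (algebraMap (𝓞 K) (𝓞 M))}.Finite := by
  refine ((Ideal.finite_factors (differentIdeal_ringOfIntegers_ne_bot (K := K) (M := M))).image
    fun w => w.under (𝓞 K)).subset ?_
  rintro v ⟨Q, hQ⟩
  refine ⟨Q, ?_, ?_⟩
  · have := v.isMaximal
    simpa using pow_sub_one_dvd_differentIdeal_aux (𝓞 K) K M Q.asIdeal two_ne_zero v.ne_bot hQ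
  · have := v.isMaximal
    have h1 : Q.asIdeal.LiesOver v.asIdeal :=
      (liesOver_iff_dvd_map Q.isPrime.ne_top).mpr ((dvd_pow_self _ two_ne_zero).trans hQ)
    exact HeightOneSpectrum.ext h1.over.symm

lemma absNorm_eq_pow_inertiaDeg_under {v : HeightOneSpectrum (𝓞 K)} (w : HeightOneSpectrum (𝓞 M))
    [w.asIdeal.LiesOver v.asIdeal] :
    absNorm w.asIdeal = absNorm v.asIdeal ^ w.asIdeal.inertiaDeg (𝓞 K) := by
  have := v.isMaximal
  have := w.isMaximal
  rw [← inertiaDeg'_eq_inertiaDeg v.asIdeal]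
  exact absNorm_eq_pow_inertiaDeg'_of_liesOver w.asIdeal v.asIdeal v.isPrime v.ne_bot

lemma inertiaDeg_ne_zero (w : HeightOneSpectrum (𝓞 M)) : w.asIdeal.inertiaDeg (𝓞 K) ≠ 0 := by
  have := w.isMaximal
  have := (w.under (𝓞 K)).isMaximal
  have : w.asIdeal.LiesOver (w.under (𝓞 K)).asIdeal := under_eq_iff.mp rfl
  rw [← inertiaDeg'_eq_inertiaDeg (w.under (𝓞 K)).asIdeal]
  exact Ideal.inertiaDeg'_ne_zero _ _

lemma absNorm_under_dichotomy (w : HeightOneSpectrum (𝓞 M)) :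
    absNorm w.asIdeal = absNorm (w.under (𝓞 K)).asIdeal ∨
      absNorm (w.under (𝓞 K)).asIdeal ^ 2 ≤ absNorm w.asIdeal := by
  have : w.asIdeal.LiesOver (w.under (𝓞 K)).asIdeal := under_eq_iff.mp rfl
  have h := inertiaDeg_ne_zero (K := K) w
  have hv := two_le_absNorm_asIdeal (w.under (𝓞 K))
  rw [absNorm_eq_pow_inertiaDeg_under (v := w.under (𝓞 K)) w]
  by_cases h1 : w.asIdeal.inertiaDeg (𝓞 K) = 1
  · exact Or.inl (by rw [h1, pow_one])
  · exact Or.inr (Nat.pow_le_pow_right (by omega) (by omega))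

lemma absNorm_eq_iff_inertiaDeg {v : HeightOneSpectrum (𝓞 K)} (w : HeightOneSpectrum (𝓞 M))
    [w.asIdeal.LiesOver v.asIdeal] :
    absNorm w.asIdeal = absNorm v.asIdeal ↔ w.asIdeal.inertiaDeg (𝓞 K) = 1 := by
  have hv := two_le_absNorm_asIdeal v
  rw [absNorm_eq_pow_inertiaDeg_under (v := v) w, Nat.pow_eq_self_iff (by omega)]

lemma finite_under_preimage (v : HeightOneSpectrum (𝓞 K)) :
    ((fun w : HeightOneSpectrum (𝓞 M) => w.under (𝓞 K)) ⁻¹' {v}).Finite := by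
  have := v.isMaximal
  refine ((IsDedekindDomain.primesOver_finite v.asIdeal (𝓞 M)).preimage
    (f := HeightOneSpectrum.asIdeal) (fun _ _ _ _ h => HeightOneSpectrum.ext h)).subset ?_
  intro w hw
  exact ⟨w.isPrime, under_eq_iff.mp hw⟩

section Galois

variable [IsGalois K M]

lemma ncard_primesOver_mul (v : HeightOneSpectrum (𝓞 K)) :
    (primesOver v.asIdeal (𝓞 M)).ncard *
      (ramificationIdxIn v.asIdeal (𝓞 M) * inertiaDegIn v.asIdeal (𝓞 M)) = Module.finrank K M := by
  rw [ncard_primesOver_mul_ramificationIdxIn_mul_inertiaDegIn _ _ Gal(M/K),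
    IsGaloisGroup.card_eq_finrank Gal(M/K) K M]

lemma ncard_under_preimage_le (v : HeightOneSpectrum (𝓞 K)) :
    ((fun w : HeightOneSpectrum (𝓞 M) => w.under (𝓞 K)) ⁻¹' {v}).ncard ≤ Module.finrank K M := by
  rw [ncard_under_preimage]
  have h := ncard_primesOver_mul (M := M) v
  refine Nat.le_of_dvd (Module.finrank_pos) ⟨_, h.symm⟩

lemma ncard_eq_finrank_of_stabilizer_eq_bot {v : HeightOneSpectrum (𝓞 K)}
    {w : HeightOneSpectrum (𝓞 M)} [w.asIdeal.LiesOver v.asIdeal]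
    (h : MulAction.stabilizer Gal(M/K) w.asIdeal = ⊥) :
    {w : HeightOneSpectrum (𝓞 M) | w.under (𝓞 K) = v ∧ absNorm w.asIdeal = absNorm v.asIdeal}.ncard =
      Module.finrank K M := by
  have h1 := card_stabilizer_eq (G := Gal(M/K)) v.asIdeal w.asIdeal
  rw [h, Subgroup.card_bot] at h1
  have h2 := ncard_primesOver_mul (M := M) v
  rw [← h1, mul_one] at h2
  rw [← h2, ← ncard_under_preimage]
  congr 1
  ext w'
  refine ⟨fun h => h.1, fun h => ⟨h, ?_⟩⟩
  have := under_eq_iff.mp h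
  rw [absNorm_eq_iff_inertiaDeg (v := v), ← inertiaDegIn_eq_inertiaDeg v.asIdeal _ Gal(M/K)]
  exact Nat.eq_one_of_mul_eq_one_left h1.symm

end Galois

section Quadratic

variable {F : Type*} [Field F] [NumberField F] [Algebra K F]

/-- The prime `v` of `K` decomposes in `F` as a product of two distinct primes. -/
def IsSplitPrime (F : Type*) [Field F] [NumberField F] [Algebra K F]
    (v : HeightOneSpectrum (𝓞 K)) : Prop :=
  ∃ P Q : Ideal (𝓞 F), P ≠ Q ∧ P.IsPrime ∧ Q.IsPrime ∧
    v.asIdeal.map (algebraMap (𝓞 K) (𝓞 F)) = P * Q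

lemma isGalois_of_finrank_eq_two (h2 : Module.finrank K F = 2) : IsGalois K F := by
  have : Algebra.IsQuadraticExtension K F := { finrank_eq_two' := h2 }
  infer_instance

lemma IsSplitPrime.stabilizer_eq_bot (h2 : Module.finrank K F = 2) {v : HeightOneSpectrum (𝓞 K)}
    (hv : IsSplitPrime F v) (Q : Ideal (𝓞 F)) [Q.IsPrime] [Q.LiesOver v.asIdeal] :
    MulAction.stabilizer Gal(F/K) Q = ⊥ := by
  have := isGalois_of_finrank_eq_two h2
  have := v.isMaximal
  have h1 := card_stabilizer_eq (G := Gal(F/K)) v.asIdeal Q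
  have h3 := ncard_primesOver_mul (M := F) v
  rw [h2, ← h1] at h3
  obtain ⟨P, P', hne, hP, hP', hmul⟩ := hv
  have hmem : {P, P'} ⊆ primesOver v.asIdeal (𝓞 F) := by
    rintro R (rfl | rfl)
    · exact ⟨hP, (liesOver_iff_dvd_map hP.ne_top).mpr (hmul ▸ dvd_mul_right _ _)⟩
    · exact ⟨hP', (liesOver_iff_dvd_map hP'.ne_top).mpr (hmul ▸ dvd_mul_left _ _)⟩
  have h4 := Set.ncard_le_ncard hmem (IsDedekindDomain.primesOver_finite v.asIdeal (𝓞 F))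
  rw [Set.ncard_pair hne] at h4
  refine Subgroup.card_eq_one.mp ?_
  have h5 : 0 < Nat.card (MulAction.stabilizer Gal(F/K) Q) := Nat.card_pos
  nlinarith

lemma isSplitPrime_of_absNorm_eq (h2 : Module.finrank K F = 2) {v : HeightOneSpectrum (𝓞 K)}
    (Q : HeightOneSpectrum (𝓞 F)) [Q.asIdeal.LiesOver v.asIdeal]
    (hram : ¬ Q.asIdeal ^ 2 ∣ v.asIdeal.map (algebraMap (𝓞 K) (𝓞 F)))
    (hQ : absNorm Q.asIdeal = absNorm v.asIdeal) : IsSplitPrime F v := by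
  have := v.isMaximal
  have hv := two_le_absNorm_asIdeal v
  obtain ⟨J, hJ⟩ := (liesOver_iff_dvd_map Q.isPrime.ne_top).mp
    (inferInstance : Q.asIdeal.LiesOver v.asIdeal)
  have hN : absNorm Q.asIdeal * absNorm J = absNorm v.asIdeal ^ 2 := by
    rw [← map_mul, ← hJ, absNorm_algebraMap, ← h2, IsFractionRing.finrank_eq (𝓞 K) K (𝓞 F) F]
  have hNJ : absNorm J = absNorm v.asIdeal := by
    rw [hQ, sq] at hN
    exact Nat.eq_of_mul_eq_mul_left (by omega) hN
  have hJtop : J ≠ ⊤ := fun h => by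
    rw [h, absNorm_top] at hNJ
    omega
  obtain ⟨Q', hQ', hle⟩ := exists_le_maximal J hJtop
  have hJ0 : J ≠ ⊥ := fun h => by
    rw [h, absNorm_bot] at hNJ
    omega
  have hQ'0 : Q' ≠ ⊥ := fun h => hJ0 (le_bot_iff.mp (h ▸ hle))
  obtain ⟨J', hJ'⟩ := dvd_iff_le.mpr hle
  have : Q'.LiesOver v.asIdeal := (liesOver_iff_dvd_map hQ'.ne_top).mpr
    (by rw [hJ, hJ']; exact ⟨Q.asIdeal * J', by ring⟩)
  let w : HeightOneSpectrum (𝓞 F) := ⟨Q', hQ'.isPrime, hQ'0⟩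
  have : w.asIdeal.LiesOver v.asIdeal := this
  have h3 : absNorm v.asIdeal ≤ absNorm Q' := by
    rw [show absNorm Q' = _ from absNorm_eq_pow_inertiaDeg_under (v := v) w]
    exact Nat.le_self_pow (inertiaDeg_ne_zero w) _
  have h4 : absNorm Q' * absNorm J' = absNorm v.asIdeal := by rw [← map_mul, ← hJ', hNJ]
  have h5 : absNorm J' = 1 := by
    have : 0 < absNorm J' := by
      rw [Nat.pos_iff_ne_zero]
      intro h
      rw [h] at h4
      omega
    nlinarith
  rw [absNorm_eq_one_iff] at h5
  rw [h5, mul_top] at hJ'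
  subst hJ'
  refine ⟨Q.asIdeal, J, ?_, Q.isPrime, hQ'.isPrime, hJ⟩
  rintro rfl
  exact hram (by rw [hJ, sq])

end Quadratic

end SplitPrimes

section Compositum

open Ideal IsDedekindDomain
open scoped Pointwise

variable {K M : Type*} [Field K] [NumberField K] [Field M] [Algebra K M]

lemma IsSplitPrime.apply_algebraMap_of_mem_stabilizer {F : Type*} [Field F] [NumberField F]
    [Algebra K F] [Algebra F M] [IsScalarTower K F M] (h2 : Module.finrank K F = 2)
    {v : HeightOneSpectrum (𝓞 K)} (hv : IsSplitPrime F v) (w : HeightOneSpectrum (𝓞 M))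
    [w.asIdeal.LiesOver v.asIdeal] {σ : Gal(M/K)}
    (hσ : σ ∈ MulAction.stabilizer Gal(M/K) w.asIdeal) (x : F) :
    σ (algebraMap F M x) = algebraMap F M x := by
  have := isGalois_of_finrank_eq_two h2
  set τ : Gal(F/K) := AlgEquiv.restrictNormal σ F with hτ
  have hcomm : ∀ y : F, algebraMap F M (τ y) = σ (algebraMap F M y) :=
    AlgEquiv.restrictNormal_commutes σ F
  set Q := w.under (𝓞 F) with hQ
  have hw : w.asIdeal.LiesOver Q.asIdeal := under_eq_iff.mp rfl
  have : Q.asIdeal.LiesOver v.asIdeal := by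
    constructor
    rw [hw.over, under_under]
    exact Ideal.LiesOver.over
  have hmem : ∀ z : 𝓞 F, z ∈ Q.asIdeal ↔ algebraMap (𝓞 F) (𝓞 M) z ∈ w.asIdeal := fun z => Iff.rfl
  have hint : ∀ z : 𝓞 F, algebraMap (𝓞 F) (𝓞 M) (τ • z) = σ • algebraMap (𝓞 F) (𝓞 M) z := by
    intro z
    apply RingOfIntegers.ext
    exact hcomm z
  have hle : τ ∈ MulAction.stabilizer Gal(F/K) Q.asIdeal := by
    rw [MulAction.mem_stabilizer_iff] at hσ ⊢
    ext z
    obtain ⟨z, rfl⟩ : ∃ z', z = τ • z' := ⟨τ⁻¹ • z, by simp⟩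
    rw [Ideal.smul_mem_pointwise_smul_iff, hmem, hmem, hint]
    conv_rhs => rw [← hσ]
    rw [Ideal.smul_mem_pointwise_smul_iff]
  rw [hv.stabilizer_eq_bot h2, Subgroup.mem_bot] at hle
  rw [← hcomm, hle, AlgEquiv.one_apply]

variable [NumberField M]

lemma isSplitPrime_of_absNorm_eq_of_tower {F : Type*} [Field F] [NumberField F]
    [Algebra K F] [Algebra F M] [IsScalarTower K F M] (h2 : Module.finrank K F = 2)
    {v : HeightOneSpectrum (𝓞 K)}
    (hram : ¬ ∃ Q : HeightOneSpectrum (𝓞 F), Q.asIdeal ^ 2 ∣ v.asIdeal.map (algebraMap (𝓞 K) (𝓞 F)))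
    (w : HeightOneSpectrum (𝓞 M)) (hwv : w.under (𝓞 K) = v)
    (hw : absNorm w.asIdeal = absNorm v.asIdeal) : IsSplitPrime F v := by
  have h1 : w.asIdeal.LiesOver v.asIdeal := under_eq_iff.mp hwv
  set Q := w.under (𝓞 F) with hQ
  have h3 : w.asIdeal.LiesOver Q.asIdeal := under_eq_iff.mp rfl
  have h4 : Q.asIdeal.LiesOver v.asIdeal := by
    constructor
    rw [h3.over, under_under]
    exact Ideal.LiesOver.over
  refine isSplitPrime_of_absNorm_eq h2 Q (fun h => hram ⟨Q, h⟩) ?_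
  have hv := two_le_absNorm_asIdeal v
  have h5 : absNorm Q.asIdeal ≤ absNorm w.asIdeal := by
    rw [absNorm_eq_pow_inertiaDeg_under (v := Q) w]
    exact Nat.le_self_pow (inertiaDeg_ne_zero w) _
  have h6 : absNorm v.asIdeal ≤ absNorm Q.asIdeal := by
    rw [absNorm_eq_pow_inertiaDeg_under (v := v) Q]
    exact Nat.le_self_pow (inertiaDeg_ne_zero Q) _
  omega

theorem extendsToHalf_logZeta_sub_split [IsGalois K M] {ι : Type*} [Finite ι] (F : ι → Type*)
    [∀ i, Field (F i)] [∀ i, NumberField (F i)] [∀ i, Algebra K (F i)] [∀ i, Algebra (F i) M]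
    [∀ i, IsScalarTower K (F i) M] (h2 : ∀ i, Module.finrank K (F i) = 2)
    (hgen : ∀ σ : Gal(M/K), (∀ i x, σ (algebraMap (F i) M x) = algebraMap (F i) M x) → σ = 1) :
    ExtendsToHalf fun s => logZeta M s -
      Module.finrank K M * primeSeries {v | ∀ i, IsSplitPrime (K := K) (F i) v} s := by
  refine extendsToHalf_logZeta_sub (fun w => w.under (𝓞 K)) (Module.finrank K M)
    (Module.finrank K M) finite_under_preimage (fun v => ?_) absNorm_under_dichotomy _
    (Set.finite_iUnion fun i => finite_ramified (K := K) (M := F i)) ?_ ?_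
  · rw [← Set.ncard_eq_toFinset_card _ (finite_under_preimage v)]
    exact ncard_under_preimage_le v
  · intro v _ hv
    obtain ⟨P, hP1, hP2⟩ := (inferInstance : Nonempty (primesOver v.asIdeal (𝓞 M)))
    let w : HeightOneSpectrum (𝓞 M) := ⟨P, hP1, ne_bot_of_liesOver_of_ne_bot v.ne_bot P⟩
    have : w.asIdeal.LiesOver v.asIdeal := hP2
    refine ncard_eq_finrank_of_stabilizer_eq_bot (w := w) ?_
    rw [eq_bot_iff]
    intro σ hσ
    exact hgen σ fun i x => (hv i).apply_algebraMap_of_mem_stabilizer (h2 i) w hσ x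
  · intro v hv hvS w hwv hw
    refine hvS fun i => isSplitPrime_of_absNorm_eq_of_tower (h2 i) ?_ w hwv hw
    intro h
    exact hv (Set.mem_iUnion.mpr ⟨i, h⟩)

end Compositum

section QuadraticFamily

open Ideal IsDedekindDomain

variable {K : Type*} [Field K] {Ω : Type*} [Field Ω] [Algebra K Ω]

lemma finrank_finset_sup_le {ι : Type*} {L : ι → IntermediateField K Ω}
    (h2 : ∀ i, Module.finrank K (L i) = 2) (T : Finset ι) :
    Module.finrank K ↥(T.sup L) ≤ 2 ^ T.card := by
  classical
  induction T using Finset.induction_on with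
  | empty => rw [Finset.sup_empty, IntermediateField.finrank_bot, Finset.card_empty, pow_zero]
  | insert i T hi ih =>
    rw [Finset.sup_insert, Finset.card_insert_of_notMem hi, pow_succ']
    exact (IntermediateField.finrank_sup_le _ _).trans (by rw [h2 i]; gcongr)

lemma finrank_finset_sup {ι : Type*} [Fintype ι] {L : ι → IntermediateField K Ω}
    (h2 : ∀ i, Module.finrank K (L i) = 2)
    (hsup : Module.finrank K ↥(⨆ i, L i) = 2 ^ Fintype.card ι) (T : Finset ι) :
    Module.finrank K ↥(T.sup L) = 2 ^ T.card := by
  classical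
  refine le_antisymm (finrank_finset_sup_le h2 T) ?_
  have h3 : T.sup L ⊔ (Tᶜ).sup L = ⨆ i, L i := by
    rw [← Finset.sup_union, Finset.union_compl, Finset.sup_univ_eq_iSup]
  have h4 := IntermediateField.finrank_sup_le (T.sup L) (Tᶜ.sup L)
  rw [h3, hsup] at h4
  have h5 := h4.trans (Nat.mul_le_mul_left _ (finrank_finset_sup_le h2 Tᶜ))
  rw [← Finset.card_add_card_compl T, pow_add] at h5
  exact Nat.le_of_mul_le_mul_right h5 (by positivity)

lemma algEquiv_eq_one_of_fix_iSup {ι : Type*} (L : ι → IntermediateField K Ω)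
    {E : IntermediateField K Ω} (hE : E = ⨆ i, L i) (hle : ∀ i, L i ≤ E) (σ : Gal(E/K))
    (h : ∀ i (x : L i), σ (IntermediateField.inclusion (hle i) x) =
      IntermediateField.inclusion (hle i) x) : σ = 1 := by
  have key : E ≤ IntermediateField.lift (IntermediateField.fixedField (Subgroup.zpowers σ)) := by
    conv_lhs => rw [hE]
    refine iSup_le fun i y hy => ?_
    have : IntermediateField.inclusion (hle i) ⟨y, hy⟩ ∈
        IntermediateField.fixedField (Subgroup.zpowers σ) := by
      rw [IntermediateField.mem_fixedField_iff]
      intro f hf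
      have : Subgroup.zpowers σ ≤
          MulAction.stabilizer Gal(E/K) (IntermediateField.inclusion (hle i) ⟨y, hy⟩) :=
        Subgroup.zpowers_le.mpr (h i ⟨y, hy⟩)
      exact this hf
    exact (IntermediateField.mem_lift (IntermediateField.inclusion (hle i) ⟨y, hy⟩)).mpr this
  ext x
  have := (IntermediateField.mem_lift x).mp (key x.2)
  rw [IntermediateField.mem_fixedField_iff] at this
  rw [this σ (Subgroup.mem_zpowers σ), AlgEquiv.one_apply]

variable [NumberField K]

lemma numberField_of_finrank_eq_two {F : IntermediateField K Ω} (h : Module.finrank K F = 2) :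
    NumberField F := by
  have : Module.Finite K F := Module.finite_of_finrank_pos (by omega)
  exact NumberField.of_module_finite K F

lemma numberField_of_finrank_eq_two_pow {F : IntermediateField K Ω} {n : ℕ}
    (h : Module.finrank K F = 2 ^ n) : NumberField F := by
  have : Module.Finite K F := Module.finite_of_finrank_pos (by rw [h]; positivity)
  exact NumberField.of_module_finite K F

theorem exists_numberField_extendsToHalf {ι : Type} [Fintype ι] (L : ι → IntermediateField K Ω)
    [∀ i, NumberField (L i)]
    (h2 : ∀ i, Module.finrank K (L i) = 2)
    (hsup : Module.finrank K ↥(⨆ i, L i) = 2 ^ Fintype.card ι) (T : Finset ι) :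
    ∃ (M : IntermediateField K Ω) (_ : NumberField M), ExtendsToHalf fun s => logZeta M s -
      (2 ^ T.card : ℕ) * primeSeries {v | ∀ i ∈ T, IsSplitPrime (K := K) (L i) v} s := by
  have hfr := finrank_finset_sup h2 hsup T
  set M := T.sup L with hM
  have : NumberField M := numberField_of_finrank_eq_two_pow hfr
  refine ⟨M, this, ?_⟩
  have hM' : M = ⨆ i : T, L i := by
    rw [hM, Finset.sup_eq_iSup, iSup_subtype']
  have hle : ∀ i : T, L i ≤ M := fun i => Finset.le_sup (f := L) i.2
  let _ : ∀ i : T, Algebra (L i) M := fun i => (IntermediateField.inclusion (hle i)).toAlgebra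
  have : ∀ i : T, IsScalarTower K (L i) M := fun i => IsScalarTower.of_algebraMap_eq fun _ => rfl
  have : ∀ i : T, Normal K (L i) := fun i =>
    have := isGalois_of_finrank_eq_two (h2 i)
    inferInstance
  have : Normal K M := hM' ▸ IntermediateField.normal_iSup K Ω _
  have : IsGalois K M := {}
  have h := extendsToHalf_logZeta_sub_split (K := K) (M := M) (fun i : T => L i)
    (fun i => h2 i) (fun σ hσ => algEquiv_eq_one_of_fix_iSup (fun i : T => L i) hM' hle σ hσ)
  rw [hfr] at h
  simpa only [Subtype.forall] using h

end QuadraticFamily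

section NonsplitPrimes

open Ideal IsDedekindDomain

lemma sum_neg_one_pow_indicator {ι V : Type*} [Fintype ι] (p : ι → V → Prop) (f : V → ℂ) (v : V) :
    {v | ∀ i, ¬ p i v}.indicator f v =
      ∑ T : Finset ι, (-1) ^ T.card * {v | ∀ i ∈ T, p i v}.indicator f v := by
  classical
  have h := Finset.prod_add_one (s := (Finset.univ : Finset ι))
    (f := fun i => if p i v then (-1 : ℂ) else 0)
  have h1 : ∏ i, ((if p i v then (-1 : ℂ) else 0) + 1) = if ∀ i, ¬ p i v then 1 else 0 := by
    split_ifs with hv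
    · exact Finset.prod_eq_one fun i _ => by rw [if_neg (hv i), zero_add]
    · push Not at hv
      obtain ⟨i, hi⟩ := hv
      exact Finset.prod_eq_zero (Finset.mem_univ i) (by rw [if_pos hi, neg_add_cancel])
  have h2 : ∀ T : Finset ι, ∏ i ∈ T, (if p i v then (-1 : ℂ) else 0) =
      if ∀ i ∈ T, p i v then (-1) ^ T.card else 0 := by
    intro T
    split_ifs with hv
    · rw [Finset.prod_congr rfl fun i hi => if_pos (hv i hi), Finset.prod_const]
    · push Not at hv
      obtain ⟨i, hi, hi'⟩ := hv
      exact Finset.prod_eq_zero hi (if_neg hi')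
  rw [h1, Finset.powerset_univ] at h
  have h3 : {v | ∀ i, ¬ p i v}.indicator f v = (if ∀ i, ¬ p i v then 1 else 0) * f v := by
    rw [Set.indicator_apply]
    simp only [Set.mem_ofPred_eq, ite_mul, one_mul, zero_mul]
  rw [h3, h, Finset.sum_mul]
  refine Finset.sum_congr rfl fun T _ => ?_
  rw [h2, Set.indicator_apply]
  simp only [Set.mem_ofPred_eq]
  split_ifs <;> simp

variable {K : Type*} [Field K] [NumberField K] {Ω : Type*} [Field Ω] [Algebra K Ω]

lemma primeSeries_forall_not {ι : Type*} [Fintype ι] (p : ι → HeightOneSpectrum (𝓞 K) → Prop)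
    {s : ℂ} (hs : 1 < s.re) :
    primeSeries {v | ∀ i, ¬ p i v} s =
      ∑ T : Finset ι, (-1) ^ T.card * primeSeries {v | ∀ i ∈ T, p i v} s := by
  simp only [primeSeries]
  rw [tsum_congr fun v => sum_neg_one_pow_indicator p _ v,
    Summable.tsum_finsetSum fun T _ => (summable_primeSeries _ hs).mul_left _]
  exact Finset.sum_congr rfl fun T _ => tsum_mul_left

/-- The primes that split in none of the fields `L i`. -/
def nonsplitPrimes {ι : Type*} (L : ι → IntermediateField K Ω) [∀ i, NumberField (L i)] :
    Set (HeightOneSpectrum (𝓞 K)) :=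
  {v | ∀ i, ¬ IsSplitPrime (L i) v}

lemma exists_extendsToHalf_nonsplitPrimes {ι : Type} [Fintype ι] (L : ι → IntermediateField K Ω)
    [∀ i, NumberField (L i)] (h2 : ∀ i, Module.finrank K (L i) = 2)
    (hsup : Module.finrank K ↥(⨆ i, L i) = 2 ^ Fintype.card ι) :
    ∃ (M : Finset ι → IntermediateField K Ω) (_ : ∀ T, NumberField (M T)),
      ExtendsToHalf fun s => (∑' v : HeightOneSpectrum (𝓞 K), Complex.log
        (1 + (nonsplitPrimes L).indicator (fun v => (absNorm v.asIdeal : ℂ) ^ (-s)) v)) -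
        ∑ T : Finset ι, (-1 / 2) ^ T.card * logZeta (M T) s := by
  choose M hM hext using exists_numberField_extendsToHalf L h2 hsup
  refine ⟨M, hM, ?_⟩
  have h1 := extendsToHalf_log_sub_primeSeries (nonsplitPrimes L)
  have h3 := (ExtendsToHalf.sum Finset.univ
    fun T (_ : T ∈ Finset.univ) => (hext T).const_mul ((-1 / 2) ^ T.card)).const_mul (-1)
  refine (h1.add h3).congr fun s hs => ?_
  have h4 : primeSeries (nonsplitPrimes L) s = _ := primeSeries_forall_not _ hs
  rw [h4]
  have h5 : ∀ T : Finset ι, (-1 / 2 : ℂ) ^ T.card * (logZeta (M T) s - (2 ^ T.card : ℕ) *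
      primeSeries {v | ∀ i ∈ T, IsSplitPrime (K := K) (L i) v} s) =
      (-1 / 2) ^ T.card * logZeta (M T) s -
        (-1) ^ T.card * primeSeries {v | ∀ i ∈ T, IsSplitPrime (K := K) (L i) v} s := by
    intro T
    rw [div_pow]
    push_cast
    field_simp
  simp only [h5, Finset.sum_sub_distrib]
  ring

lemma sum_neg_half_pow_card (ι : Type*) [Fintype ι] :
    ∑ T : Finset ι, (-1 / 2 : ℂ) ^ T.card = 1 / 2 ^ Fintype.card ι := by
  classical
  have h := Finset.prod_add_one (s := (Finset.univ : Finset ι)) (f := fun _ => (-1 / 2 : ℂ))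
  simp only [Finset.prod_const, Finset.powerset_univ, Finset.card_univ] at h
  rw [← h, one_div, ← inv_pow]
  norm_num

/-- The Dirichlet series of the squarefree ideals supported on nonsplit primes is, locally on the
line `re s = 1`, a nonvanishing analytic function times `(s - 1) ^ (-1 / 2 ^ r)`. -/
theorem exists_idealSeries_eq_exp_mul_cpow {ι : Type} [Fintype ι] (L : ι → IntermediateField K Ω)
    [∀ i, NumberField (L i)] (h2 : ∀ i, Module.finrank K (L i) = 2)
    (hsup : Module.finrank K ↥(⨆ i, L i) = 2 ^ Fintype.card ι) {s₀ : ℂ} (hs₀ : s₀.re = 1) :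
    ∃ ρ : ℝ, 0 < ρ ∧ ∃ H : ℂ → ℂ, DifferentiableOn ℂ H (Metric.ball s₀ ρ) ∧
      ∀ s ∈ Metric.ball s₀ ρ, 1 < s.re → idealSeries (squarefreeOver (nonsplitPrimes L)) s =
        Complex.exp (H s) * (s - 1) ^ (-(1 / 2 ^ Fintype.card ι) : ℂ) := by
  obtain ⟨M, hM, g, hg, hg'⟩ := exists_extendsToHalf_nonsplitPrimes L h2 hsup
  choose ρ hρ h hh hh' using fun T => exists_logZeta_extension (M T) hs₀
  obtain ⟨ε, hε, hεle⟩ : ∃ ε : ℝ, 0 < ε ∧ ∀ T, ε ≤ ρ T := by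
    refine ⟨Finset.univ.inf' Finset.univ_nonempty ρ, ?_, fun T => Finset.inf'_le _ (Finset.mem_univ T)⟩
    rw [Finset.lt_inf'_iff]
    exact fun T _ => hρ T
  refine ⟨min ε (1 / 2), lt_min hε (by norm_num),
    fun s => g s + ∑ T : Finset ι, (-1 / 2) ^ T.card * h T s, ?_, ?_⟩
  · refine DifferentiableOn.add (hg.mono fun s hs => ?_)
      (DifferentiableOn.fun_sum fun T _ => DifferentiableOn.const_mul ((hh T).mono
        (Metric.ball_subset_ball ((min_le_left _ _).trans (hεle T)))) _)
    have h1 : ‖s - s₀‖ < 1 / 2 := by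
      rw [← dist_eq_norm]
      exact (Metric.mem_ball.mp hs).trans_le (min_le_right _ _)
    have h3 := (abs_lt.mp ((Complex.abs_re_le_norm (s - s₀)).trans_lt h1)).1
    rw [Complex.sub_re, hs₀] at h3
    change 1 / 2 < s.re
    linarith
  · intro s hs hs1
    have hne : s - 1 ≠ 0 := fun h0 => by
      rw [sub_eq_zero.mp h0, Complex.one_re] at hs1
      exact lt_irrefl _ hs1
    rw [idealSeries_squarefreeOver _ hs1, Complex.cpow_def_of_ne_zero hne, ← Complex.exp_add]
    congr 1
    have h3 := hg' s hs1
    have h4 : ∀ T, h T s = logZeta (M T) s + Complex.log (s - 1) := fun T =>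
      (hh' T s (Metric.ball_subset_ball ((min_le_left _ _).trans (hεle T)) hs) hs1).symm
    rw [sub_eq_iff_eq_add] at h3
    simp only [h3, h4, mul_add, Finset.sum_add_distrib, ← Finset.sum_mul, sum_neg_half_pow_card]
    ring

end NonsplitPrimes

section Laplace

open MeasureTheory

lemma abs_exp_smul_mellin_kernel (f : ℝ → ℂ) (s : ℂ) (u : ℝ) :
    |Real.exp u| • ((Real.exp u : ℂ) ^ (-s - 1) • f (Real.exp u)) =
      f (Real.exp u) * Complex.exp (-(s * u)) := by
  rw [abs_of_pos (Real.exp_pos u), Complex.real_smul, smul_eq_mul, ← mul_assoc, mul_comm (f _)]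
  congr 1
  rw [Complex.ofReal_exp, Complex.cpow_def_of_ne_zero (Complex.exp_ne_zero _), ← Complex.ofReal_exp,
    ← Complex.ofReal_log (Real.exp_pos u).le, Real.log_exp, Complex.ofReal_exp, ← Complex.exp_add]
  congr 1
  ring

lemma mellin_neg_eq_integral_exp (f : ℝ → ℂ) (s : ℂ) :
    mellin f (-s) = ∫ u : ℝ, f (Real.exp u) * Complex.exp (-(s * u)) := by
  have h := integral_image_eq_integral_abs_deriv_smul MeasurableSet.univ
    (fun x _ => (Real.hasDerivAt_exp x).hasDerivWithinAt) Real.exp_injective.injOn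
    (fun t : ℝ => (t : ℂ) ^ (-s - 1) • f t)
  rw [Set.image_univ, Real.range_exp, setIntegral_univ] at h
  rw [mellin, h]
  exact integral_congr_ae (Eventually.of_forall fun u => abs_exp_smul_mellin_kernel f s u)

lemma mellinConvergent_neg_iff_integrable_exp (f : ℝ → ℂ) (s : ℂ) :
    MellinConvergent f (-s) ↔
      Integrable fun u : ℝ => f (Real.exp u) * Complex.exp (-(s * u)) := by
  have h := integrableOn_image_iff_integrableOn_abs_deriv_smul MeasurableSet.univ
    (fun x _ => (Real.hasDerivAt_exp x).hasDerivWithinAt) Real.exp_injective.injOn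
    (fun t : ℝ => (t : ℂ) ^ (-s - 1) • f t)
  rw [Set.image_univ, Real.range_exp, integrableOn_univ] at h
  rw [MellinConvergent, h]
  exact integrable_congr (Eventually.of_forall fun u => abs_exp_smul_mellin_kernel f s u)


lemma mellin_neg_log_rpow_aux {γ : ℝ} (hγ : 0 ≤ γ) {z : ℂ} (hz : 0 < z.re) :
    Integrable (fun u : ℝ => ((if 0 < u then u ^ γ else 0 : ℝ) : ℂ) * Complex.exp (-(z * u))) ∧
    DifferentiableAt ℂ (fun z : ℂ =>
      ∫ u : ℝ, ((if 0 < u then u ^ γ else 0 : ℝ) : ℂ) * Complex.exp (-(z * u))) z := by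
  set f : ℝ → ℝ := fun t => if 1 < t then Real.log t ^ γ else 0 with hf
  have hmono : Monotone f := by
    intro x y hxy
    simp only [hf]
    split_ifs with h1 h2 h2
    · exact Real.rpow_le_rpow (Real.log_nonneg h1.le) (Real.log_le_log (by linarith) hxy) hγ
    · linarith
    · exact Real.rpow_nonneg (Real.log_nonneg h2.le) _
    · exact le_rfl
  have h0 : ∀ t < 1, f t = 0 := fun t ht => if_neg (by linarith)
  obtain ⟨β, hβ0, hβ⟩ : ∃ β, 0 < β ∧ β * γ < z.re := by
    refine ⟨z.re / (2 * (γ + 1)), by positivity, ?_⟩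
    rw [div_mul_eq_mul_div, div_lt_iff₀ (by positivity)]
    nlinarith
  have hb : ∀ t, 1 ≤ t → |f t| ≤ (1 / β) ^ γ * t ^ (β * γ) := by
    intro t ht
    simp only [hf]
    split_ifs with h1
    · have hl := Real.log_nonneg ht
      rw [abs_of_nonneg (Real.rpow_nonneg hl _), Real.rpow_mul (by linarith),
        ← Real.mul_rpow (by positivity) (by positivity)]
      refine Real.rpow_le_rpow hl ?_ hγ
      rw [one_div, inv_mul_eq_div]
      exact Real.log_le_rpow_div (by linarith) hβ0
    · rw [abs_zero]
      positivity
  obtain ⟨h1, -, h2⟩ := mellin_neg_of_vanish hmono.locallyIntegrable h0 hb hβ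
  have hfe : ∀ u, f (Real.exp u) = if 0 < u then u ^ γ else 0 := by
    intro u
    simp only [hf, Real.one_lt_exp_iff, Real.log_exp]
  constructor
  · rw [mellinConvergent_neg_iff_integrable_exp] at h1
    simpa only [hfe] using h1
  · have h3 := h2.differentiableAt.comp z (differentiableAt_id.neg)
    refine h3.congr_of_eventuallyEq (Eventually.of_forall fun w => ?_)
    simp only [Function.comp_apply, mellin_neg_eq_integral_exp, hfe]

lemma integrable_ite_rpow_mul_cexp {γ : ℝ} (hγ : 0 ≤ γ) {z : ℂ} (hz : 0 < z.re) :
    Integrable fun u : ℝ => ((if 0 < u then u ^ γ else 0 : ℝ) : ℂ) * Complex.exp (-(z * u)) :=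
  (mellin_neg_log_rpow_aux hγ hz).1

lemma integral_ite_rpow_mul_cexp {γ : ℝ} (hγ : 0 ≤ γ) {z : ℂ} (hz : 0 < z.re) :
    ∫ u : ℝ, ((if 0 < u then u ^ γ else 0 : ℝ) : ℂ) * Complex.exp (-(z * u)) =
      Real.Gamma (γ + 1) * z ^ (-(γ + 1) : ℂ) := by
  have hopen : IsOpen {z : ℂ | 0 < z.re} := isOpen_lt_re 0
  have hreal : ∀ x : ℝ, 0 < x →
      ∫ u : ℝ, ((if 0 < u then u ^ γ else 0 : ℝ) : ℂ) * Complex.exp (-((x : ℂ) * u)) =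
      Real.Gamma (γ + 1) * (x : ℂ) ^ (-(γ + 1) : ℂ) := by
    intro x hx
    have h := Complex.integral_cpow_mul_exp_neg_mul_Ioi (a := γ + 1) (r := x)
      (by simpa using by linarith) hx
    have harg : (x : ℂ).arg ≠ Real.pi := by
      rw [Complex.arg_ofReal_of_nonneg hx.le]
      exact Real.pi_pos.ne
    rw [one_div, Complex.inv_cpow _ _ harg, ← Complex.cpow_neg] at h
    have h1 : Complex.Gamma (γ + 1) = (Real.Gamma (γ + 1) : ℂ) := by
      rw [← Complex.ofReal_one, ← Complex.ofReal_add, Complex.Gamma_ofReal]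
    rw [← h1, mul_comm, ← h, ← integral_indicator measurableSet_Ioi]
    refine integral_congr_ae (Eventually.of_forall fun u => ?_)
    beta_reduce
    rw [Set.indicator_apply]
    simp only [Set.mem_Ioi]
    split_ifs with hu
    · rw [Complex.ofReal_cpow hu.le, add_sub_cancel_right]
    · simp
  have hd1 : DifferentiableOn ℂ (fun z : ℂ => ∫ u : ℝ, ((if 0 < u then u ^ γ else 0 : ℝ) : ℂ) *
      Complex.exp (-(z * u))) {z : ℂ | 0 < z.re} :=
    fun w hw => (mellin_neg_log_rpow_aux hγ hw).2.differentiableWithinAt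
  have hd2 : DifferentiableOn ℂ (fun z : ℂ => (Real.Gamma (γ + 1) : ℂ) * z ^ (-(γ + 1) : ℂ))
      {z : ℂ | 0 < z.re} := fun w hw =>
    ((differentiableAt_id.cpow_const (Or.inl hw)).const_mul _).differentiableWithinAt
  refine (hd1.analyticOnNhd hopen).eqOn_of_preconnected_of_frequently_eq
    (hd2.analyticOnNhd hopen) (convex_halfSpace_re_gt 0).isPreconnected (z₀ := 1)
    (by simp) ?_ hz
  have ht : Tendsto (fun n : ℕ => ((1 + 1 / ((n : ℝ) + 1) : ℝ) : ℂ)) atTop (𝓝[≠] 1) := by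
    refine tendsto_nhdsWithin_iff.mpr ⟨?_, Eventually.of_forall fun n => ?_⟩
    · have := (tendsto_one_div_add_atTop_nhds_zero_nat (𝕜 := ℝ)).const_add 1
      rw [add_zero] at this
      exact (Complex.continuous_ofReal.tendsto 1).comp this
    · have : (0 : ℝ) < 1 / ((n : ℝ) + 1) := by positivity
      simp only [Set.mem_compl_iff, Set.mem_singleton_iff, Complex.ofReal_eq_one]
      exact (lt_add_of_pos_right 1 this).ne'
  refine ht.frequently (Frequently.of_forall fun n => ?_)
  exact hreal _ (by positivity)

end Laplace

section Boundary

lemma exists_bound_of_locally_bounded {D : ℂ → ℂ} {α : ℝ} (hα : 0 ≤ α)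
    (hD : ContinuousOn D {z | 0 < z.re})
    (hloc : ∀ z₀ : ℂ, z₀.re = 0 → z₀ ≠ 0 → ∃ ρ > 0, ∃ C : ℝ,
      ∀ z ∈ Metric.ball z₀ ρ, 0 < z.re → ‖D z‖ ≤ C)
    (hzero : ∃ ρ > 0, ∃ C : ℝ, ∀ z ∈ Metric.ball 0 ρ, 0 < z.re → ‖D z‖ ≤ C * ‖z‖ ^ (-α)) (B : ℝ) :
    ∃ C : ℝ, ∀ σ t : ℝ, 0 < σ → σ ≤ 1 → t ≠ 0 → |t| ≤ B →
      ‖D (σ + Complex.I * t)‖ ≤ C * |t| ^ (-α) := by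
  have hcpt : IsCompact (Set.Icc (0 : ℝ) 1 ×ℂ Set.Icc (-B) B) := isCompact_Icc.reProdIm isCompact_Icc
  have upgrade : ∀ C t : ℝ, t ≠ 0 → |t| ≤ B → C ≤ |C| * B ^ α * |t| ^ (-α) := by
    intro C t ht htB
    have ht0 : 0 < |t| := abs_pos.mpr ht
    have h1 : |t| ^ α ≤ B ^ α := Real.rpow_le_rpow ht0.le htB hα
    rw [Real.rpow_neg ht0.le, ← div_eq_mul_inv, le_div_iff₀ (by positivity)]
    calc C * |t| ^ α ≤ |C| * |t| ^ α := by gcongr; exact le_abs_self C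
      _ ≤ |C| * B ^ α := by gcongr
  obtain ⟨C, hC⟩ := hcpt.induction_on (p := fun s => ∃ C : ℝ, ∀ z ∈ s, 0 < z.re → z.im ≠ 0 →
      |z.im| ≤ B → ‖D z‖ ≤ C * |z.im| ^ (-α)) ⟨0, by simp⟩
    (fun s t hst ⟨C, hC⟩ => ⟨C, fun z hz => hC z (hst hz)⟩)
    (fun s t ⟨C, hC⟩ ⟨C', hC'⟩ => ⟨max C C', fun z hz h1 h2 h3 => by
      rcases hz with hz | hz
      · exact (hC z hz h1 h2 h3).trans (by gcongr; exact le_max_left _ _)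
      · exact (hC' z hz h1 h2 h3).trans (by gcongr; exact le_max_right _ _)⟩)
    (fun z₀ hz₀ => by
      rcases (Complex.mem_reProdIm.mp hz₀).1.1.lt_or_eq with hre | hre
      · have h1 : ContinuousAt D z₀ := hD.continuousAt ((isOpen_lt_re 0).mem_nhds hre)
        have h2 : ∀ᶠ z in 𝓝 z₀, ‖D z‖ < ‖D z₀‖ + 1 :=
          h1.norm.eventually_lt continuousAt_const (lt_add_one _)
        exact ⟨_, mem_nhdsWithin_of_mem_nhds h2, _, fun z hz _ him hB =>
          (le_of_lt hz).trans (upgrade _ _ him hB)⟩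
      · by_cases h0 : z₀ = 0
        · obtain ⟨ρ, hρ, C, hC⟩ := hzero
          refine ⟨Metric.ball z₀ ρ, mem_nhdsWithin_of_mem_nhds (Metric.ball_mem_nhds _ hρ), |C|, ?_⟩
          intro z hz hzre him _
          rw [h0] at hz
          refine (hC z hz hzre).trans ?_
          have h3 : ‖z‖ ^ (-α) ≤ |z.im| ^ (-α) :=
            Real.rpow_le_rpow_of_nonpos (abs_pos.mpr him) (Complex.abs_im_le_norm z) (by linarith)
          have h4 : 0 ≤ ‖z‖ ^ (-α) := by positivity
          nlinarith [le_abs_self C, abs_nonneg C]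
        · obtain ⟨ρ, hρ, C, hC⟩ := hloc z₀ hre.symm h0
          exact ⟨Metric.ball z₀ ρ, mem_nhdsWithin_of_mem_nhds (Metric.ball_mem_nhds _ hρ), _,
            fun z hz hzre him hB => (hC z hz hzre).trans (upgrade _ _ him hB)⟩)
  refine ⟨C, fun σ t hσ hσ1 ht htB => ?_⟩
  have hre : (σ + Complex.I * t : ℂ).re = σ := by simp
  have him : (σ + Complex.I * t : ℂ).im = t := by simp
  have := hC (σ + Complex.I * t) (Complex.mem_reProdIm.mpr ⟨by rw [hre]; exact ⟨hσ.le, hσ1⟩,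
    by rw [him]; exact abs_le.mp htB⟩) (by rw [hre]; exact hσ) (by rw [him]; exact ht)
    (by rw [him]; exact htB)
  rwa [him] at this

/-- A Laplace-transform Tauberian theorem whose boundary hypotheses are local: the transform of
`a - c u ^ γ` extends continuously to the imaginary axis away from `0`, with at most a
`‖z‖ ^ (-α)` singularity at `0`. -/
theorem tendsto_div_rpow_of_local {a : ℝ → ℝ} (ha0 : ∀ u, 0 ≤ a u) (haneg : ∀ u < 0, a u = 0)
    (hmono : Monotone fun u => Real.exp u * a u)
    (ha : ∀ σ, 0 < σ → MeasureTheory.Integrable fun u => a u * Real.exp (-(σ * u)))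
    {γ c α : ℝ} (hγ0 : 0 ≤ γ) (hγ : γ < 1) (hα0 : 0 ≤ α) (hα : α < 1) {D : ℂ → ℂ}
    (hD : ContinuousOn D {z | 0 < z.re})
    (hDeq : ∀ z : ℂ, 0 < z.re → ∫ u : ℝ, ((a u - c * (if 0 < u then u ^ γ else 0) : ℝ) : ℂ) *
      Complex.exp (-(z * u)) = D z)
    (hloc : ∀ z₀ : ℂ, z₀.re = 0 → z₀ ≠ 0 → ∃ Q : ℂ → ℂ, ContinuousAt Q z₀ ∧
      ∀ᶠ z in 𝓝 z₀, 0 < z.re → D z = Q z)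
    (hzero : ∃ C : ℝ, ∀ᶠ z in 𝓝 (0 : ℂ), 0 < z.re → ‖D z‖ ≤ C * ‖z‖ ^ (-α)) :
    Tendsto (fun y => a y / y ^ γ) atTop (𝓝 c) := by
  have hre : ∀ σ t : ℝ, (σ + Complex.I * t : ℂ).re = σ := fun σ t => by simp
  have hne : ∀ t : ℝ, t ≠ 0 → Complex.I * t ≠ 0 := fun t ht =>
    mul_ne_zero Complex.I_ne_zero (Complex.ofReal_ne_zero.mpr ht)
  choose! Q hQ hQ' using hloc
  refine tendsto_div_rpow_of_laplace ha0 haneg hmono ha hγ0 hγ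
    (R0 := fun t => Q (Complex.I * t) (Complex.I * t)) hα ?_ ?_
  · intro t ht
    have hz : (Complex.I * t : ℂ).re = 0 := by simp
    have h1 : Tendsto (fun σ : ℝ => (σ + Complex.I * t : ℂ)) (𝓝[>] 0) (𝓝 (Complex.I * t)) := by
      have : Tendsto (fun σ : ℝ => (σ + Complex.I * t : ℂ)) (𝓝 0) (𝓝 ((0 : ℝ) + Complex.I * t)) :=
        (Complex.continuous_ofReal.tendsto 0).add_const _
      rw [Complex.ofReal_zero, zero_add] at this
      exact this.mono_left nhdsWithin_le_nhds
    refine ((hQ _ hz (hne t ht)).tendsto.comp h1).congr' ?_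
    filter_upwards [h1.eventually (hQ' _ hz (hne t ht)), self_mem_nhdsWithin] with σ hσ hσ0
    rw [Function.comp_apply, hDeq _ (by rw [hre]; exact hσ0), hσ (by rw [hre]; exact hσ0)]
  · intro B
    obtain ⟨C, hC⟩ := exists_bound_of_locally_bounded hα0 hD (fun z₀ h1 h2 => by
      have h3 : ∀ᶠ z in 𝓝 z₀, ‖Q z₀ z‖ < ‖Q z₀ z₀‖ + 1 :=
        (hQ z₀ h1 h2).norm.eventually_lt continuousAt_const (lt_add_one _)
      obtain ⟨ρ, hρ, h4⟩ := Metric.eventually_nhds_iff_ball.mp (h3.and (hQ' z₀ h1 h2))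
      exact ⟨ρ, hρ, ‖Q z₀ z₀‖ + 1, fun z hz hz0 => by
        rw [(h4 z hz).2 hz0]
        exact (h4 z hz).1.le⟩) (by
      obtain ⟨C, hC⟩ := hzero
      obtain ⟨ρ, hρ, h4⟩ := Metric.eventually_nhds_iff_ball.mp hC
      exact ⟨ρ, hρ, C, h4⟩) B
    exact ⟨C, fun σ t hσ hσ1 ht htB => by
      rw [hDeq _ (by rw [hre]; exact hσ)]
      exact hC σ t hσ hσ1 ht htB⟩

end Boundary

section LaplaceSingularity

open MeasureTheory

/-- The Laplace transform of a real function on the whole line. -/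
def laplace (a : ℝ → ℝ) (z : ℂ) : ℂ := ∫ u : ℝ, (a u : ℂ) * Complex.exp (-(z * u))

lemma integrable_real_of_cexp {a : ℝ → ℝ} {σ : ℝ}
    (h : Integrable fun u : ℝ => (a u : ℂ) * Complex.exp (-((σ : ℂ) * u))) :
    Integrable fun u : ℝ => a u * Real.exp (-(σ * u)) := by
  refine h.re.congr (Eventually.of_forall fun u => ?_)
  beta_reduce
  rw [← Complex.ofReal_mul, ← Complex.ofReal_neg, ← Complex.ofReal_exp, ← Complex.ofReal_mul]
  rfl

lemma laplace_ofReal (a : ℝ → ℝ) (σ : ℝ) :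
    laplace a σ = ((∫ u : ℝ, a u * Real.exp (-(σ * u)) : ℝ) : ℂ) := by
  rw [laplace, ← integral_complex_ofReal]
  refine integral_congr_ae (Eventually.of_forall fun u => ?_)
  push_cast
  rfl

lemma laplace_sub_rpow {a : ℝ → ℝ} {γ c : ℝ} (hγ : 0 ≤ γ) {z : ℂ} (hz : 0 < z.re)
    (ha : Integrable fun u : ℝ => (a u : ℂ) * Complex.exp (-(z * u))) :
    ∫ u : ℝ, ((a u - c * (if 0 < u then u ^ γ else 0) : ℝ) : ℂ) * Complex.exp (-(z * u)) =
      laplace a z - c * Real.Gamma (γ + 1) * z ^ (-(γ + 1) : ℂ) := by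
  rw [mul_assoc, ← integral_ite_rpow_mul_cexp hγ hz, ← integral_const_mul, laplace,
    ← integral_sub ha ((integrable_ite_rpow_mul_cexp hγ hz).const_mul _)]
  refine integral_congr_ae (Eventually.of_forall fun u => ?_)
  beta_reduce
  push_cast
  ring

lemma exists_pos_eq_of_laplace {b : ℝ → ℝ} (hb : ∀ u, 0 ≤ b u) {τ : ℝ} {P : ℂ → ℂ}
    (hP : ContinuousAt P 0) (hP0 : P 0 ≠ 0)
    (h : ∀ᶠ z in 𝓝 (0 : ℂ), 0 < z.re → laplace b z = P z * z ^ ((-τ : ℝ) : ℂ)) :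
    ∃ p : ℝ, 0 < p ∧ P 0 = p := by
  have h1 : Tendsto (fun σ : ℝ => (σ : ℂ)) (𝓝[>] 0) (𝓝 0) := by
    have := Complex.continuous_ofReal.tendsto 0
    rw [Complex.ofReal_zero] at this
    exact this.mono_left nhdsWithin_le_nhds
  have h2 : ∀ᶠ σ : ℝ in 𝓝[>] 0, P σ ∈ {z : ℂ | 0 ≤ z.re} ∩ {z : ℂ | z.im = 0} := by
    filter_upwards [h1.eventually h, self_mem_nhdsWithin] with σ hσ hσ0
    have hσ0 : 0 < σ := hσ0
    have h3 := hσ (by simpa using hσ0)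
    rw [laplace_ofReal, ← Complex.ofReal_cpow hσ0.le] at h3
    have h4 : P σ = ((∫ u : ℝ, b u * Real.exp (-(σ * u))) / σ ^ (-τ) : ℝ) := by
      rw [Complex.ofReal_div, h3, mul_div_cancel_right₀]
      exact Complex.ofReal_ne_zero.mpr (Real.rpow_pos_of_pos hσ0 _).ne'
    rw [h4]
    refine ⟨?_, Complex.ofReal_im _⟩
    change 0 ≤ (Complex.ofReal _).re
    rw [Complex.ofReal_re]
    exact div_nonneg (integral_nonneg fun u => mul_nonneg (hb u) (Real.exp_pos _).le)
      (Real.rpow_nonneg hσ0.le _)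
  have h5 : P 0 ∈ {z : ℂ | 0 ≤ z.re} ∩ {z : ℂ | z.im = 0} :=
    ((isClosed_le continuous_const Complex.continuous_re).inter
      (isClosed_eq Complex.continuous_im continuous_const)).mem_of_tendsto (hP.tendsto.comp h1) h2
  have h6 : P 0 = ((P 0).re : ℂ) := Complex.ext (by simp) (by simpa using h5.2)
  refine ⟨(P 0).re, lt_of_le_of_ne h5.1 fun h0 => hP0 ?_, h6⟩
  rw [h6, ← h0, Complex.ofReal_zero]

lemma mem_slitPlane_of_re_eq_zero {z : ℂ} (h : z.re = 0) (h0 : z ≠ 0) : z ∈ Complex.slitPlane :=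
  Or.inr fun him => h0 (Complex.ext h him)

/-- A Tauberian theorem for a nonnegative function `b` whose Laplace transform is, near every point
of the imaginary axis, an analytic nonvanishing function times `1 / z`. -/
theorem exists_tendsto_of_laplace_simple_pole {b : ℝ → ℝ} (hb : ∀ u, 0 ≤ b u)
    (hbneg : ∀ u < 0, b u = 0) (hmono : Monotone fun u => Real.exp u * b u)
    (hint : ∀ z : ℂ, 0 < z.re → Integrable fun u : ℝ => (b u : ℂ) * Complex.exp (-(z * u)))
    (hd : DifferentiableOn ℂ (laplace b) {z | 0 < z.re})
    (hP : ∀ z₀ : ℂ, z₀.re = 0 → ∃ P : ℂ → ℂ, AnalyticAt ℂ P z₀ ∧ P z₀ ≠ 0 ∧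
      ∀ᶠ z in 𝓝 z₀, 0 < z.re → laplace b z = P z * z ^ ((-1 : ℝ) : ℂ)) :
    ∃ c, 0 < c ∧ Tendsto b atTop (𝓝 c) := by
  obtain ⟨P₀, hPa, hPne, hPeq⟩ := hP 0 rfl
  obtain ⟨p, hp, hpP⟩ := exists_pos_eq_of_laplace hb hPa.continuousAt hPne hPeq
  refine ⟨p, hp, ?_⟩
  have hcpow : ∀ z : ℂ, z ^ ((-1 : ℝ) : ℂ) = z⁻¹ := fun z => by
    rw [Complex.ofReal_neg, Complex.ofReal_one, Complex.cpow_neg_one]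
  have hmain := tendsto_div_rpow_of_local (a := b) (γ := 0) (α := 0) (c := p)
    (D := fun z => laplace b z - p * z⁻¹) hb hbneg hmono
    (fun σ hσ => integrable_real_of_cexp (hint σ (by simpa using hσ)))
    le_rfl one_pos le_rfl one_pos ?_ ?_ ?_ ?_
  · simpa only [Real.rpow_zero, div_one] using hmain
  · refine hd.continuousOn.sub (continuousOn_const.mul (continuousOn_id.inv₀ fun z hz h => ?_))
    have hz : 0 < z.re := hz
    rw [show z = 0 from h] at hz
    exact lt_irrefl _ hz
  · intro z hz
    rw [laplace_sub_rpow le_rfl hz (hint z hz), zero_add, Real.Gamma_one, Complex.ofReal_one,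
      mul_one, Complex.ofReal_zero, zero_add, Complex.cpow_neg_one]
  · intro z₀ hre h0
    obtain ⟨P, hPa', -, hPeq'⟩ := hP z₀ hre
    refine ⟨fun z => P z * z⁻¹ - p * z⁻¹, ?_, ?_⟩
    · exact (hPa'.continuousAt.mul (continuousAt_inv₀ h0)).sub
        (continuousAt_const.mul (continuousAt_inv₀ h0))
    · filter_upwards [hPeq'] with z hz hz0
      rw [hz hz0, hcpow]
  · obtain ⟨C, hC⟩ := hPa.differentiableAt.hasDerivAt.isBigO_sub.bound
    refine ⟨C, ?_⟩
    filter_upwards [hC, hPeq] with z hz1 hz2 hz0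
    have hne : z ≠ 0 := fun h => by simp [h] at hz0
    have hnz : 0 < ‖z‖ := norm_pos_iff.mpr hne
    rw [sub_zero, hpP] at hz1
    rw [hz2 hz0, hcpow, ← sub_mul, norm_mul, norm_inv, neg_zero, Real.rpow_zero, mul_one,
      ← div_eq_mul_inv, div_le_iff₀ hnz]
    exact hz1

end LaplaceSingularity

section LaplaceBranch

open MeasureTheory

lemma monotone_exp_mul_mul {b : ℝ → ℝ} (hb : ∀ u, 0 ≤ b u) (hbneg : ∀ u < 0, b u = 0)
    (hmono : Monotone fun u => Real.exp u * b u) :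
    Monotone fun u => Real.exp u * (u * b u) := by
  intro u v huv
  simp only [mul_left_comm (Real.exp _)]
  have hv := mul_nonneg (Real.exp_pos v).le (hb v)
  rcases lt_or_ge u 0 with hu | hu
  · rw [hbneg u hu, mul_zero, mul_zero]
    rcases lt_or_ge v 0 with hv' | hv'
    · rw [hbneg v hv', mul_zero, mul_zero]
    · exact mul_nonneg hv' hv
  · exact mul_le_mul huv (hmono huv) (mul_nonneg (Real.exp_pos u).le (hb u)) (hu.trans huv)

/-- A Tauberian theorem for a nonnegative function `b` whose Laplace transform is, near every point
of the imaginary axis, an analytic nonvanishing function times `z ^ (-τ)` with `0 < τ < 1`. -/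
theorem exists_tendsto_of_laplace_branch {b : ℝ → ℝ} (hb : ∀ u, 0 ≤ b u)
    (hbneg : ∀ u < 0, b u = 0) (hmono : Monotone fun u => Real.exp u * b u)
    (hint : ∀ z : ℂ, 0 < z.re →
      Integrable fun u : ℝ => ((u * b u : ℝ) : ℂ) * Complex.exp (-(z * u)))
    (hd : ∀ z : ℂ, 0 < z.re → HasDerivAt (laplace b) (-laplace (fun u => u * b u) z) z)
    {τ : ℝ} (hτ0 : 0 < τ) (hτ : τ < 1)
    (hP : ∀ z₀ : ℂ, z₀.re = 0 → ∃ P : ℂ → ℂ, AnalyticAt ℂ P z₀ ∧ P z₀ ≠ 0 ∧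
      ∀ᶠ z in 𝓝 z₀, 0 < z.re → laplace b z = P z * z ^ ((-τ : ℝ) : ℂ)) :
    ∃ c, 0 < c ∧ Tendsto (fun u => b u * u ^ (1 - τ)) atTop (𝓝 c) := by
  have hopen : IsOpen {z : ℂ | 0 < z.re} := isOpen_lt_re 0
  obtain ⟨P₀, hPa, hPne, hPeq⟩ := hP 0 rfl
  obtain ⟨p, hp, hpP⟩ := exists_pos_eq_of_laplace hb hPa.continuousAt hPne hPeq
  have hΓ := Real.Gamma_pos_of_pos hτ0
  refine ⟨p / Real.Gamma τ, by positivity, ?_⟩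
  have hslit : ∀ z : ℂ, 0 < z.re → z ∈ Complex.slitPlane := fun z hz => Or.inl hz
  have hexp : (-(τ + 1) : ℂ) = ((-τ : ℝ) : ℂ) - 1 := by
    push_cast
    ring
  have hexp' : ((-τ : ℝ) : ℂ) - 1 = ((-τ - 1 : ℝ) : ℂ) := by push_cast; rfl
  have hcont : ∀ z : ℂ, z ∈ Complex.slitPlane → ∀ w : ℂ, ContinuousAt (fun z : ℂ => z ^ w) z :=
    fun z hz w => ((hasDerivAt_id z).cpow_const (c := w) hz).continuousAt
  have hder : ∀ (z₀ : ℂ) (P : ℂ → ℂ), AnalyticAt ℂ P z₀ →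
      (∀ᶠ z in 𝓝 z₀, 0 < z.re → laplace b z = P z * z ^ ((-τ : ℝ) : ℂ)) →
      ∀ᶠ z in 𝓝 z₀, 0 < z.re → laplace (fun u => u * b u) z =
        τ * P z * z ^ (((-τ : ℝ) : ℂ) - 1) - deriv P z * z ^ ((-τ : ℝ) : ℂ) := by
    intro z₀ P hPa' hPeq'
    filter_upwards [hPa'.eventually_analyticAt, hPeq'.eventually_nhds] with z h1 h2 hz
    have h3 : laplace b =ᶠ[𝓝 z] fun z => P z * z ^ ((-τ : ℝ) : ℂ) := by
      filter_upwards [h2, hopen.mem_nhds hz] with w h3 h4 using h3 h4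
    have h4 := h1.differentiableAt.hasDerivAt.mul
      ((hasDerivAt_id z).cpow_const (c := ((-τ : ℝ) : ℂ)) (hslit z hz))
    have h5 := (hd z hz).unique (h4.congr_of_eventuallyEq h3)
    rw [← neg_neg (laplace _ z), h5]
    simp only [id, mul_one]
    push_cast
    ring
  have hmain := tendsto_div_rpow_of_local (a := fun u => u * b u) (γ := τ) (α := τ)
    (c := p / Real.Gamma τ)
    (D := fun z => laplace (fun u => u * b u) z - τ * p * z ^ (((-τ : ℝ) : ℂ) - 1)) ?_
    (fun u hu => by rw [hbneg u hu, mul_zero]) (monotone_exp_mul_mul hb hbneg hmono)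
    (fun σ hσ => integrable_real_of_cexp (hint σ (by simpa using hσ)))
    hτ0.le hτ hτ0.le hτ ?_ ?_ ?_ ?_
  · refine hmain.congr' ?_
    filter_upwards [eventually_gt_atTop 0] with u hu
    rw [Real.rpow_sub hu, Real.rpow_one]
    ring
  · intro u
    rcases lt_or_ge u 0 with hu | hu
    · rw [hbneg u hu, mul_zero]
    · exact mul_nonneg hu (hb u)
  · have h1 : DifferentiableOn ℂ (laplace b) {z | 0 < z.re} :=
      fun z hz => (hd z hz).differentiableAt.differentiableWithinAt
    have h2 : ContinuousOn (laplace fun u => u * b u) {z : ℂ | 0 < z.re} := by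
      refine ((h1.deriv hopen).continuousOn.neg).congr fun z hz => ?_
      rw [Pi.neg_apply, (hd z hz).deriv, neg_neg]
    exact h2.sub (continuousOn_const.mul
      fun z hz => (hcont z (hslit z hz) _).continuousWithinAt)
  · intro z hz
    rw [laplace_sub_rpow hτ0.le hz (hint z hz), hexp, Real.Gamma_add_one hτ0.ne']
    have : (Real.Gamma τ : ℂ) ≠ 0 := Complex.ofReal_ne_zero.mpr hΓ.ne'
    push_cast
    field_simp
  · intro z₀ hre h0
    obtain ⟨P, hPa', -, hPeq'⟩ := hP z₀ hre
    have hs := mem_slitPlane_of_re_eq_zero hre h0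
    refine ⟨fun z => τ * P z * z ^ (((-τ : ℝ) : ℂ) - 1) - deriv P z * z ^ ((-τ : ℝ) : ℂ) -
      τ * p * z ^ (((-τ : ℝ) : ℂ) - 1), ?_, ?_⟩
    · exact (((continuousAt_const.mul hPa'.continuousAt).mul (hcont z₀ hs _)).sub
        (hPa'.deriv.continuousAt.mul (hcont z₀ hs _))).sub (continuousAt_const.mul (hcont z₀ hs _))
    · filter_upwards [hder z₀ P hPa' hPeq'] with z hz hz0
      rw [hz hz0]
  · obtain ⟨C, hC⟩ := hPa.differentiableAt.hasDerivAt.isBigO_sub.bound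
    have h1 : ∀ᶠ z in 𝓝 (0 : ℂ), ‖deriv P₀ z‖ < ‖deriv P₀ 0‖ + 1 :=
      hPa.deriv.continuousAt.norm.eventually_lt continuousAt_const (lt_add_one _)
    refine ⟨τ * C + (‖deriv P₀ 0‖ + 1), ?_⟩
    filter_upwards [hC, h1, hder 0 P₀ hPa hPeq] with z hz1 hz2 hz3 hz0
    have hne : z ≠ 0 := fun h => by simp [h] at hz0
    have hnz : 0 < ‖z‖ := norm_pos_iff.mpr hne
    rw [sub_zero, hpP] at hz1
    have h4 : laplace (fun u => u * b u) z - τ * p * z ^ (((-τ : ℝ) : ℂ) - 1) =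
        τ * (P₀ z - p) * z ^ ((-τ - 1 : ℝ) : ℂ) - deriv P₀ z * z ^ ((-τ : ℝ) : ℂ) := by
      rw [hz3 hz0, hexp']
      ring
    rw [h4]
    refine (norm_sub_le _ _).trans ?_
    simp only [norm_mul, Complex.norm_cpow_real, Complex.norm_real, Real.norm_eq_abs, abs_of_pos hτ0]
    rw [add_mul, Real.rpow_sub_one hnz.ne']
    refine add_le_add ?_ (by gcongr)
    calc τ * ‖P₀ z - p‖ * (‖z‖ ^ (-τ) / ‖z‖) = τ * (‖P₀ z - p‖ / ‖z‖) * ‖z‖ ^ (-τ) := by ring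
      _ ≤ τ * C * ‖z‖ ^ (-τ) := by
        gcongr
        rwa [div_le_iff₀ hnz]

/-- The common form of the two preceding theorems. -/
theorem exists_tendsto_of_laplace {b : ℝ → ℝ} (hb : ∀ u, 0 ≤ b u)
    (hbneg : ∀ u < 0, b u = 0) (hmono : Monotone fun u => Real.exp u * b u)
    (hint : ∀ z : ℂ, 0 < z.re → Integrable fun u : ℝ => (b u : ℂ) * Complex.exp (-(z * u)))
    (hint' : ∀ z : ℂ, 0 < z.re →
      Integrable fun u : ℝ => ((u * b u : ℝ) : ℂ) * Complex.exp (-(z * u)))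
    (hd : ∀ z : ℂ, 0 < z.re → HasDerivAt (laplace b) (-laplace (fun u => u * b u) z) z)
    {τ : ℝ} (hτ0 : 0 < τ) (hτ : τ ≤ 1)
    (hP : ∀ z₀ : ℂ, z₀.re = 0 → ∃ P : ℂ → ℂ, AnalyticAt ℂ P z₀ ∧ P z₀ ≠ 0 ∧
      ∀ᶠ z in 𝓝 z₀, 0 < z.re → laplace b z = P z * z ^ ((-τ : ℝ) : ℂ)) :
    ∃ c, 0 < c ∧ Tendsto (fun u => b u * u ^ (1 - τ)) atTop (𝓝 c) := by
  rcases hτ.lt_or_eq with hlt | rfl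
  · exact exists_tendsto_of_laplace_branch hb hbneg hmono hint' hd hτ0 hlt hP
  · obtain ⟨c, hc, h⟩ := exists_tendsto_of_laplace_simple_pole hb hbneg hmono hint
      (fun z hz => (hd z hz).differentiableAt.differentiableWithinAt) hP
    exact ⟨c, hc, by simpa only [sub_self, Real.rpow_zero, mul_one] using h⟩

end LaplaceBranch

section Counting

open MeasureTheory Ideal IsDedekindDomain

lemma laplace_counting {N : ℝ → ℝ} (h0 : ∀ t < 1, N t = 0) (hpos : ∀ t, 0 ≤ N t)
    (hmono : Monotone N) {A : ℝ} (hA : ∀ t, 1 ≤ t → N t ≤ A * t) {z : ℂ} (hz : 0 < z.re) :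
    (Integrable fun u : ℝ => ((Real.exp (-u) * N (Real.exp u) : ℝ) : ℂ) * Complex.exp (-(z * u))) ∧
    (Integrable fun u : ℝ => ((u * (Real.exp (-u) * N (Real.exp u)) : ℝ) : ℂ) *
      Complex.exp (-(z * u))) ∧
    HasDerivAt (laplace fun u => Real.exp (-u) * N (Real.exp u))
      (-laplace (fun u => u * (Real.exp (-u) * N (Real.exp u))) z) z ∧
    laplace (fun u => Real.exp (-u) * N (Real.exp u)) z = mellin (fun t => (N t : ℂ)) (-(1 + z)) := by
  obtain ⟨h1, h2, h3⟩ := mellin_neg_of_vanish hmono.locallyIntegrable h0 (D := A) (β := 1)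
    (fun t ht => by rw [Real.rpow_one, abs_of_nonneg (hpos t)]; exact hA t ht)
    (s := 1 + z) (by simpa using hz)
  have e1 : ∀ (z : ℂ) (u : ℝ), (N (Real.exp u) : ℂ) * Complex.exp (-((1 + z) * u)) =
      ((Real.exp (-u) * N (Real.exp u) : ℝ) : ℂ) * Complex.exp (-(z * u)) := by
    intro z u
    rw [Complex.ofReal_mul, Complex.ofReal_exp, mul_comm (Complex.exp _), mul_assoc,
      ← Complex.exp_add]
    congr 2
    push_cast
    ring
  have e2 : ∀ u : ℝ, Real.log (Real.exp u) • (N (Real.exp u) : ℂ) *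
      Complex.exp (-((1 + z) * u)) =
      ((u * (Real.exp (-u) * N (Real.exp u)) : ℝ) : ℂ) * Complex.exp (-(z * u)) := by
    intro u
    rw [Real.log_exp, Complex.real_smul, mul_assoc, e1, Complex.ofReal_mul u, mul_assoc]
  have e3 : ∀ z : ℂ, laplace (fun u => Real.exp (-u) * N (Real.exp u)) z =
      mellin (fun t => (N t : ℂ)) (-(1 + z)) := by
    intro z
    rw [mellin_neg_eq_integral_exp, laplace]
    simp only [e1]
  rw [mellinConvergent_neg_iff_integrable_exp] at h1 h2
  simp only [e1] at h1
  simp only [e2] at h2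
  refine ⟨h1, h2, ?_, e3 z⟩
  rw [mellin_neg_eq_integral_exp] at h3
  simp only [e2] at h3
  have h4 : HasDerivAt (fun z : ℂ => -(1 + z)) (-1) z := ((hasDerivAt_id z).const_add 1).neg
  have h5 := h3.comp z h4
  rw [mul_neg_one] at h5
  exact h5.congr_of_eventuallyEq (Eventually.of_forall e3)

/-- **Delange's theorem** for monotone functions whose Mellin transform is locally, on the line
`re s = 1`, a nonvanishing analytic function times `(s - 1) ^ (-τ)`. -/
theorem exists_tendsto_of_mellin {N : ℝ → ℝ} (h0 : ∀ t < 1, N t = 0) (hpos : ∀ t, 0 ≤ N t)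
    (hmono : Monotone N) {A : ℝ} (hA : ∀ t, 1 ≤ t → N t ≤ A * t) {τ : ℝ} (hτ0 : 0 < τ) (hτ : τ ≤ 1)
    (hH : ∀ s₀ : ℂ, s₀.re = 1 → ∃ ρ : ℝ, 0 < ρ ∧ ∃ H : ℂ → ℂ,
      DifferentiableOn ℂ H (Metric.ball s₀ ρ) ∧ ∀ s ∈ Metric.ball s₀ ρ, 1 < s.re →
        s * mellin (fun t => (N t : ℂ)) (-s) = Complex.exp (H s) * (s - 1) ^ ((-τ : ℝ) : ℂ)) :
    ∃ c : ℝ, 0 < c ∧ Tendsto (fun y => N y / (y / Real.log y ^ (1 - τ))) atTop (𝓝 c) := by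
  have hl := fun (z : ℂ) (hz : 0 < z.re) => laplace_counting h0 hpos hmono hA hz
  have hexp : ∀ u, Real.exp u * (Real.exp (-u) * N (Real.exp u)) = N (Real.exp u) := fun u => by
    rw [← mul_assoc, ← Real.exp_add, add_neg_cancel, Real.exp_zero, one_mul]
  have hP : ∀ z₀ : ℂ, z₀.re = 0 → ∃ P : ℂ → ℂ, AnalyticAt ℂ P z₀ ∧ P z₀ ≠ 0 ∧
      ∀ᶠ z in 𝓝 z₀, 0 < z.re →
        laplace (fun u => Real.exp (-u) * N (Real.exp u)) z = P z * z ^ ((-τ : ℝ) : ℂ) := by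
    intro z₀ hz₀
    obtain ⟨ρ, hρ, H, hHd, hHeq⟩ := hH (1 + z₀) (by simp [hz₀])
    have hne : 1 + z₀ ≠ 0 := fun h => by
      have := congrArg Complex.re h
      simp [hz₀] at this
    have hH1 : AnalyticAt ℂ H (1 + z₀) := hHd.analyticAt (Metric.ball_mem_nhds _ hρ)
    have hadd : AnalyticAt ℂ (fun z : ℂ => 1 + z) z₀ := analyticAt_const.add analyticAt_id
    refine ⟨fun z => Complex.exp (H (1 + z)) / (1 + z), ?_, div_ne_zero (Complex.exp_ne_zero _) hne,
      ?_⟩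
    · exact (AnalyticAt.cexp (AnalyticAt.fun_comp hH1 hadd)).div hadd hne
    · filter_upwards [hadd.continuousAt.preimage_mem_nhds (Metric.ball_mem_nhds _ hρ)] with z hz hz0
      have hre : 1 < (1 + z).re := by simpa using hz0
      have h1 := hHeq (1 + z) hz hre
      have h2 : 1 + z ≠ 0 := fun h => by
        rw [h, Complex.zero_re] at hre
        linarith
      rw [add_sub_cancel_left] at h1
      rw [(hl z hz0).2.2.2, div_mul_eq_mul_div, ← h1, mul_div_cancel_left₀ _ h2]
  obtain ⟨c, hc, h⟩ := exists_tendsto_of_laplace (b := fun u => Real.exp (-u) * N (Real.exp u))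
    (fun u => mul_nonneg (Real.exp_pos _).le (hpos _))
    (fun u hu => by rw [h0 _ (by simpa using hu), mul_zero])
    (by simpa only [hexp, Function.comp_def] using hmono.comp Real.exp_monotone)
    (fun z hz => (hl z hz).1) (fun z hz => (hl z hz).2.1) (fun z hz => (hl z hz).2.2.1) hτ0 hτ hP
  refine ⟨c, hc, (h.comp Real.tendsto_log_atTop).congr' ?_⟩
  filter_upwards [eventually_gt_atTop 0] with y hy
  rw [Function.comp_apply, Real.exp_neg, Real.exp_log hy, div_div_eq_mul_div, div_eq_mul_inv]
  ring

/-- The asymptotic number of squarefree ideals supported on the primes that split in none of the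
quadratic fields `L i`. -/
theorem exists_tendsto_idealCount_nonsplit {K : Type*} [Field K] [NumberField K] {Ω : Type*}
    [Field Ω] [Algebra K Ω] {ι : Type} [Fintype ι] (L : ι → IntermediateField K Ω)
    [∀ i, NumberField (L i)] (h2 : ∀ i, Module.finrank K (L i) = 2)
    (hsup : Module.finrank K ↥(⨆ i, L i) = 2 ^ Fintype.card ι) :
    ∃ c : ℝ, 0 < c ∧ Tendsto (fun y => idealCount (squarefreeOver (nonsplitPrimes L)) y /
      (y / Real.log y ^ ((1 : ℝ) - 1 / 2 ^ Fintype.card ι))) atTop (𝓝 c) := by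
  have hG : ∀ I ∈ squarefreeOver (nonsplitPrimes L), I ≠ ⊥ := fun I hI => hI.1.ne_zero
  obtain ⟨A, -, hA⟩ := exists_idealCount_le (K := K)
  refine exists_tendsto_of_mellin (fun t ht => idealCount_of_lt_one hG ht)
    (fun t => normCount_nonneg t) (monotone_idealCount hG) (hA _ hG) (by positivity)
    (div_le_one_of_le₀ (one_le_pow₀ one_le_two) (by positivity)) fun s₀ hs₀ => ?_
  obtain ⟨ρ, hρ, H, hH, h⟩ := exists_idealSeries_eq_exp_mul_cpow L h2 hsup hs₀
  refine ⟨ρ, hρ, H, hH, fun s hs hs1 => ?_⟩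
  rw [← idealSeries_eq_mellin hG hs1, h s hs hs1]
  push_cast
  rfl

end Counting

/-- **Counting squarefree ideals supported on nonsplit primes.**  Let `L 0, …, L (r-1)`
be quadratic extensions of `k` whose compositum has degree `2^r` over `k`, and call a
finite prime of `k` nonsplit if it splits in no `L i`.  Then the number of squarefree
nonzero ideals `I` of `O_k` with `N(I) ≤ y`, all of whose prime divisors are nonsplit,
is asymptotic to `c · y/(log y)^{1 - 1/2^r}` for some constant `c > 0`. -/
theorem count_squarefree_nonsplit_ideals
    (r : ℕ) (L : Fin r → IntermediateField k (AlgebraicClosure k))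
    (hquad : ∀ i, Module.finrank k (L i) = 2)
    (hcomp : Module.finrank k (⨆ i, L i : IntermediateField k (AlgebraicClosure k))
      = 2 ^ r) :
    ∃ c : ℝ, 0 < c ∧
      Filter.Tendsto
        (fun y : ℝ =>
          (Nat.card {I : Ideal (𝓞 k) //
              Squarefree I ∧ I ≠ ⊥ ∧
              (∀ P : Ideal (𝓞 k), P.IsPrime → P ∣ I → ∀ i, ¬ SplitsIn k P (L i)) ∧
              (Ideal.absNorm I : ℝ) ≤ y} : ℝ) /
            (y / Real.log y ^ ((1 : ℝ) - 1 / 2 ^ r)))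
        atTop (𝓝 c) := by
  have : ∀ i, NumberField (L i) := fun i => numberField_of_finrank_eq_two (hquad i)
  obtain ⟨c, hc, h⟩ := exists_tendsto_idealCount_nonsplit L hquad (by rwa [Fintype.card_fin])
  rw [Fintype.card_fin] at h
  refine ⟨c, hc, h.congr fun y => ?_⟩
  congr 2
  have hiff : ∀ I : Ideal (𝓞 k), (Squarefree I ∧ I ≠ ⊥ ∧
      (∀ P : Ideal (𝓞 k), P.IsPrime → P ∣ I → ∀ i, ¬ SplitsIn k P (L i)) ∧
      (Ideal.absNorm I : ℝ) ≤ y) ↔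
      I ∈ squarefreeOver (nonsplitPrimes L) ∧ (Ideal.absNorm I : ℝ) ≤ y := by
    intro I
    constructor
    · rintro ⟨h1, h2, h3, h4⟩
      exact ⟨⟨h1, fun v hv i => h3 v.asIdeal v.isPrime hv i⟩, h4⟩
    · rintro ⟨⟨h1, h2⟩, h4⟩
      have h0 : I ≠ ⊥ := h1.ne_zero
      exact ⟨h1, h0, fun P hP hPI i => h2 ⟨P, hP, ne_zero_of_dvd_ne_zero h0 hPI⟩ hPI i, h4⟩
  rw [idealCount, normCount]
  exact congrArg Nat.cast (Nat.card_congr ((Equiv.subtypeSubtypeEquivSubtypeInter _ _).trans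
    (Equiv.subtypeEquivRight fun I => (hiff I).symm)))

end
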